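/- For every even n ≥ 2 there exists a bichromatic set P = B ∪ R of 2n points in the plane in general position with |B| = |R| = n and two BR-matchings M and M' on P such that M and M' are not t-compatible for any t < n/2 (i.e., every transformation between M and M' has length at least n/2). Consequently, the maximum over all such point sets P of the diameter of the transformation graph of BR-matchings is Θ(n): it is at least n/2 for these point sets and at most 2n for all point sets. -/

import Mathlib

open Finset
open scoped Classical

/-- Points in the plane. -/
abbrev Pt : Type := ℝ × ℝ

/-- A finite point set is in general position if no three distinct points are collinear. -/
def GenPos (S : Finset Pt) : Prop :=
  ∀ p ∈ S, ∀ q ∈ S, ∀ r ∈ S, p ≠ q → p ≠ r → q ≠ r →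
    ¬ Collinear ℝ ({p, q, r} : Set Pt)

/-- `M` is a plane perfect bichromatic (BR-) matching on the bichromatic point set `B ∪ R`:
each edge `e ∈ M` is a pair (blue endpoint, red endpoint); every blue point is the blue
endpoint of exactly one edge, every red point is the red endpoint of exactly one edge, and
the (closed) segments of distinct edges are disjoint. -/
def IsBRMatching (B R : Finset Pt) (M : Finset (Pt × Pt)) : Prop :=
  (∀ e ∈ M, e.1 ∈ B ∧ e.2 ∈ R) ∧
  (∀ b ∈ B, ∃! e, e ∈ M ∧ e.1 = b) ∧
  (∀ r ∈ R, ∃! e, e ∈ M ∧ e.2 = r) ∧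
  (∀ e ∈ M, ∀ e' ∈ M, e ≠ e' →
    segment ℝ e.1 e.2 ∩ segment ℝ e'.1 e'.2 = ∅)

/-- Two matchings are compatible if any two of their segments intersect in at most a
common endpoint (shared edges are allowed). -/
def Compatible (M M' : Finset (Pt × Pt)) : Prop :=
  ∀ e ∈ M, ∀ e' ∈ M', e = e' ∨
    segment ℝ e.1 e.2 ∩ segment ℝ e'.1 e'.2 ⊆
      {x : Pt | (x = e.1 ∨ x = e.2) ∧ (x = e'.1 ∨ x = e'.2)}

/-- `M` and `M'` are `t`-compatible: there is a transformation (sequence of BR-matchings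
on `B ∪ R` in which consecutive matchings are compatible) of length `k ≤ t` between them. -/
def TCompatible (B R : Finset Pt) (t : ℕ) (M M' : Finset (Pt × Pt)) : Prop :=
  ∃ k ≤ t, ∃ f : ℕ → Finset (Pt × Pt),
    f 0 = M ∧ f k = M' ∧ (∀ i ≤ k, IsBRMatching B R (f i)) ∧
    ∀ i < k, Compatible (f i) (f (i + 1))

/-- The line `{p | a * p.1 + b * p.2 = c}`. -/
def lineSet (a b c : ℝ) : Set Pt := {p : Pt | a * p.1 + b * p.2 = c}

/-- The line given by `a * x + b * y = c` is a ham-sandwich cut of the bichromatic point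
set `B ∪ R` (with `|B| = |R| = n`): it contains no point of `B ∪ R`, and one of its open
sides contains exactly `⌊n/2⌋` blue and `⌊n/2⌋` red points while the other open side
contains exactly `⌈n/2⌉` blue and `⌈n/2⌉` red points. -/
def IsHamSandwichCut (a b c : ℝ) (B R : Finset Pt) (n : ℕ) : Prop :=
  (a, b) ≠ ((0 : ℝ), (0 : ℝ)) ∧
  (∀ p ∈ B ∪ R, a * p.1 + b * p.2 ≠ c) ∧
  (((B.filter fun p => a * p.1 + b * p.2 < c).card = n / 2 ∧
    (R.filter fun p => a * p.1 + b * p.2 < c).card = n / 2 ∧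
    (B.filter fun p => a * p.1 + b * p.2 > c).card = (n + 1) / 2 ∧
    (R.filter fun p => a * p.1 + b * p.2 > c).card = (n + 1) / 2) ∨
   ((B.filter fun p => a * p.1 + b * p.2 < c).card = (n + 1) / 2 ∧
    (R.filter fun p => a * p.1 + b * p.2 < c).card = (n + 1) / 2 ∧
    (B.filter fun p => a * p.1 + b * p.2 > c).card = n / 2 ∧
    (R.filter fun p => a * p.1 + b * p.2 > c).card = n / 2))

/-- The edge `e` crosses the line `a * x + b * y = c`: its segment meets the line. -/
def Crosses (a b c : ℝ) (e : Pt × Pt) : Prop :=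
  ∃ x ∈ segment ℝ e.1 e.2, a * x.1 + b * x.2 = c

def cr (p q x : Pt) : ℝ := (q.1 - p.1) * (x.2 - p.2) - (q.2 - p.2) * (x.1 - p.1)

def sg (κ : Bool) : ℝ := if κ then 1 else -1

def kcr (κ : Bool) (p q x : Pt) : ℝ := sg κ * cr p q x

def kd (κ : Bool) (p q : Pt) : Pt × Pt := if κ then (p, q) else (q, p)

def ip (x y : Pt) (t : ℝ) : Pt := (x.1 + t * (y.1 - x.1), x.2 + t * (y.2 - x.2))

lemma sg_sq (κ : Bool) : sg κ * sg κ = 1 := by cases κ <;> simp [sg]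

lemma sg_ne (κ : Bool) : sg κ ≠ 0 := by cases κ <;> simp [sg]

lemma kcr_true (p q x : Pt) : kcr true p q x = cr p q x := by simp [kcr, sg]

lemma kcr_false (p q x : Pt) : kcr false p q x = - cr p q x := by simp [kcr, sg]

lemma kcr_not (κ : Bool) (p q x : Pt) : kcr (!κ) p q x = - kcr κ p q x := by
  cases κ <;> simp [kcr, sg]

lemma kcr_rot (κ : Bool) (p q x : Pt) : kcr κ q x p = kcr κ p q x := by
  simp only [kcr, cr]; ring

lemma kcr_swap (κ : Bool) (p q x : Pt) : kcr κ q p x = - kcr κ p q x := by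
  simp only [kcr, cr]; ring

lemma kcr_swap' (κ : Bool) (p q x : Pt) : kcr κ p x q = - kcr κ p q x := by
  simp only [kcr, cr]; ring

@[simp] lemma kcr_left (κ : Bool) (p q : Pt) : kcr κ p q p = 0 := by simp [kcr, cr]

@[simp] lemma kcr_right (κ : Bool) (p q : Pt) : kcr κ p q q = 0 := by
  simp only [kcr, cr]; ring

lemma kcr_ip (κ : Bool) (p q x y : Pt) (t : ℝ) :
    kcr κ p q (ip x y t) = (1 - t) * kcr κ p q x + t * kcr κ p q y := by
  simp only [kcr, cr, ip]; ring

lemma cr_ip (p q x y : Pt) (t : ℝ) :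
    cr p q (ip x y t) = (1 - t) * cr p q x + t * cr p q y := by
  simp only [cr, ip]; ring

lemma kcr_sum (κ : Bool) (v a c x : Pt) :
    kcr κ v a x + kcr κ a c x + kcr κ c v x = kcr κ v a c := by
  simp only [kcr, cr]; ring

lemma kcr_pluecker (κ : Bool) (v a b c d : Pt) :
    kcr κ v a b * kcr κ v c d - kcr κ v a c * kcr κ v b d + kcr κ v a d * kcr κ v b c = 0 := by
  simp only [kcr, cr]; ring

/-- Barycentric coordinates in a triangle. -/
lemma bary (κ : Bool) (v a c x : Pt) :
    kcr κ v a c * x.1 = kcr κ a c x * v.1 + kcr κ c v x * a.1 + kcr κ v a x * c.1 ∧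
    kcr κ v a c * x.2 = kcr κ a c x * v.2 + kcr κ c v x * a.2 + kcr κ v a x * c.2 := by
  simp only [kcr, cr]; constructor <;> ring

@[simp] lemma ip_zero (x y : Pt) : ip x y 0 = x := by simp [ip]

@[simp] lemma ip_one (x y : Pt) : ip x y 1 = y := by simp [ip]

lemma ip_symm (x y : Pt) (t : ℝ) : ip y x (1 - t) = ip x y t := by
  ext <;> simp [ip] <;> ring

lemma ip_ip (x y : Pt) (s t : ℝ) : ip x (ip x y s) t = ip x y (t * s) := by
  ext <;> simp [ip] <;> ring

lemma ip_ip_ip (x y : Pt) (s t r : ℝ) :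
    ip (ip x y s) (ip x y t) r = ip x y (s + r * (t - s)) := by
  ext <;> simp [ip] <;> ring

lemma ip_ip_right (x y : Pt) (s r : ℝ) :
    ip (ip x y s) y r = ip x y (s + r * (1 - s)) := by
  ext <;> simp [ip] <;> ring

lemma ip_inj {x y : Pt} (h : x ≠ y) {s t : ℝ} (e : ip x y s = ip x y t) : s = t := by
  simp only [ip, Prod.ext_iff, add_right_inj] at e
  by_contra hst
  apply h
  have h1 : (s - t) * (y.1 - x.1) = 0 := by linarith [e.1]
  have h2 : (s - t) * (y.2 - x.2) = 0 := by linarith [e.2]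
  have h3 : s - t ≠ 0 := sub_ne_zero.2 hst
  ext
  · have := (mul_eq_zero.1 h1).resolve_left h3; linarith
  · have := (mul_eq_zero.1 h2).resolve_left h3; linarith

lemma mem_seg {x y z : Pt} : z ∈ segment ℝ x y ↔ ∃ t : ℝ, 0 ≤ t ∧ t ≤ 1 ∧ z = ip x y t := by
  rw [segment_eq_image']
  constructor
  · rintro ⟨t, ⟨h0, h1⟩, rfl⟩
    exact ⟨t, h0, h1, by ext <;> simp [ip]⟩
  · rintro ⟨t, h0, h1, rfl⟩
    exact ⟨t, ⟨h0, h1⟩, by ext <;> simp [ip]⟩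

lemma mem_oseg {x y z : Pt} :
    z ∈ openSegment ℝ x y ↔ ∃ t : ℝ, 0 < t ∧ t < 1 ∧ z = ip x y t := by
  rw [openSegment_eq_image']
  constructor
  · rintro ⟨t, ⟨h0, h1⟩, rfl⟩
    exact ⟨t, h0, h1, by ext <;> simp [ip]⟩
  · rintro ⟨t, h0, h1, rfl⟩
    exact ⟨t, ⟨h0, h1⟩, by ext <;> simp [ip]⟩

lemma ip_mem_seg {x y : Pt} {t : ℝ} (h0 : 0 ≤ t) (h1 : t ≤ 1) : ip x y t ∈ segment ℝ x y :=
  mem_seg.2 ⟨t, h0, h1, rfl⟩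

lemma ip_mem_oseg {x y : Pt} {t : ℝ} (h0 : 0 < t) (h1 : t < 1) : ip x y t ∈ openSegment ℝ x y :=
  mem_oseg.2 ⟨t, h0, h1, rfl⟩

lemma ends_of_mem_seg {x y z : Pt} (h : z ∈ segment ℝ x y) (h' : z ∉ openSegment ℝ x y) :
    z = x ∨ z = y := by
  obtain ⟨t, h0, h1, rfl⟩ := mem_seg.1 h
  rcases h0.eq_or_lt with rfl | h0
  · simp
  rcases h1.eq_or_lt with rfl | h1
  · simp
  exact absurd (ip_mem_oseg h0 h1) h'

lemma left_notMem_oseg {x y : Pt} (h : x ≠ y) : x ∉ openSegment ℝ x y := by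
  intro hx
  obtain ⟨t, h0, h1, e⟩ := mem_oseg.1 hx
  have := ip_inj h (s := 0) (t := t) (by simpa using e)
  linarith

lemma right_notMem_oseg {x y : Pt} (h : x ≠ y) : y ∉ openSegment ℝ x y := by
  rw [openSegment_symm]; exact left_notMem_oseg h.symm

/-- A point on the line through two distinct points is an affine combination of them. -/
lemma exists_ip_of_cr {p q x : Pt} (h : p ≠ q) (h0 : cr p q x = 0) : ∃ t : ℝ, x = ip p q t := by
  simp only [cr] at h0
  by_cases h1 : q.1 - p.1 = 0
  · have h2 : q.2 - p.2 ≠ 0 := by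
      intro h2; apply h; ext <;> linarith
    refine ⟨(x.2 - p.2) / (q.2 - p.2), ?_⟩
    have : x.1 - p.1 = 0 := by
      rw [h1] at h0
      have : (q.2 - p.2) * (x.1 - p.1) = 0 := by linarith
      exact (mul_eq_zero.1 this).resolve_left h2
    ext
    · simp only [ip, h1]; linarith
    · simp only [ip]; field_simp; ring
  · refine ⟨(x.1 - p.1) / (q.1 - p.1), ?_⟩
    ext
    · simp only [ip]; field_simp; ring
    · simp only [ip]; field_simp; linarith

lemma kcr_eq_zero_iff {κ : Bool} {p q x : Pt} : kcr κ p q x = 0 ↔ cr p q x = 0 := by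
  simp [kcr, sg_ne]

def otri (κ : Bool) (v a u : Pt) : Set Pt :=
  {x | 0 < kcr κ v a x ∧ 0 < kcr κ a u x ∧ 0 < kcr κ u v x}

def ctri (κ : Bool) (v a u : Pt) : Set Pt :=
  {x | 0 ≤ kcr κ v a x ∧ 0 ≤ kcr κ a u x ∧ 0 ≤ kcr κ u v x}

lemma mem_side {κ : Bool} {v a u z : Pt} (hΔ : 0 < kcr κ v a u) (h0 : kcr κ v a z = 0)
    (h1 : 0 ≤ kcr κ a u z) (h2 : 0 ≤ kcr κ u v z) : z ∈ segment ℝ v a := by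
  have hs := kcr_sum κ v a u z
  obtain ⟨b1, b2⟩ := bary κ v a u z
  rw [h0] at b1 b2 hs
  refine mem_seg.2 ⟨kcr κ u v z / kcr κ v a u, by positivity, ?_, ?_⟩
  · rw [div_le_one hΔ]; linarith
  · have hne := hΔ.ne'
    have e : kcr κ a u z = kcr κ v a u - kcr κ u v z := by linarith
    rw [e] at b1 b2
    ext
    · simp only [ip]; field_simp; linarith
    · simp only [ip]; field_simp; linarith

/-- Leaving an open triangle, one meets a closed side. -/
lemma tri_exit {κ : Bool} {v a u x y : Pt} (hΔ : 0 < kcr κ v a u) (hx : x ∈ otri κ v a u)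
    (hy : y ∉ otri κ v a u) : ∃ t : ℝ, 0 < t ∧ t ≤ 1 ∧
      ip x y t ∈ ctri κ v a u ∧
      (ip x y t ∈ segment ℝ v a ∨ ip x y t ∈ segment ℝ a u ∨ ip x y t ∈ segment ℝ u v) := by
  let f : ℝ → ℝ := fun t => min (kcr κ v a (ip x y t)) (min (kcr κ a u (ip x y t))
    (kcr κ u v (ip x y t)))
  have hf : Continuous f := by
    simp only [f, kcr_ip]; fun_prop
  have h0 : 0 < f 0 := by
    simp only [f, ip_zero]; exact lt_min hx.1 (lt_min hx.2.1 hx.2.2)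
  have h1 : f 1 ≤ 0 := by
    simp only [f, ip_one]
    by_contra h
    push Not at h
    rw [lt_min_iff, lt_min_iff] at h
    exact hy h
  obtain ⟨t, ⟨ht0, ht1⟩, ht⟩ := intermediate_value_Icc' zero_le_one hf.continuousOn ⟨h1, h0.le⟩
  have htp : 0 < t := by
    rcases ht0.eq_or_lt with rfl | h
    · linarith
    · exact h
  have ge : 0 ≤ f t := ht.ge
  simp only [f, le_min_iff] at ge
  obtain ⟨g1, g2, g3⟩ := ge
  refine ⟨t, htp, ht1, ⟨g1, g2, g3⟩, ?_⟩
  by_cases e1 : kcr κ v a (ip x y t) = 0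
  · exact Or.inl (mem_side hΔ e1 g2 g3)
  by_cases e2 : kcr κ a u (ip x y t) = 0
  · refine Or.inr (Or.inl (mem_side (u := v) ?_ e2 g3 g1))
    rw [kcr_rot]; exact hΔ
  by_cases e3 : kcr κ u v (ip x y t) = 0
  · refine Or.inr (Or.inr (mem_side (u := a) ?_ e3 g1 g2))
    rw [kcr_rot, kcr_rot]; exact hΔ
  exfalso
  have : 0 < f t := lt_min (lt_of_le_of_ne g1 (Ne.symm e1))
    (lt_min (lt_of_le_of_ne g2 (Ne.symm e2)) (lt_of_le_of_ne g3 (Ne.symm e3)))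
  linarith

lemma kd_swap (κ : Bool) (p q : Pt) : (kd κ p q).swap = kd κ q p := by
  cases κ <;> simp [kd]

lemma kd_not (κ : Bool) (p q : Pt) : kd (!κ) p q = kd κ q p := by
  cases κ <;> simp [kd]

lemma kd_cases (κ : Bool) (p q : Pt) : kd κ p q = (p, q) ∨ kd κ p q = (q, p) := by
  cases κ <;> simp [kd]

def carrier (D : Finset (Pt × Pt)) : Set Pt := {z | ∃ d ∈ D, z ∈ segment ℝ d.1 d.2}

lemma carrier_mono {D D' : Finset (Pt × Pt)} (h : D ⊆ D') : carrier D ⊆ carrier D' :=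
  fun _ ⟨d, hd, hz⟩ => ⟨d, h hd, hz⟩

/-- A plane drawing `D` (a symmetric set of darts on the vertex set `V`) containing the oriented
edges `O`, whose complement is two-coloured by `X`; `T` is the set of darts with colour `X` on their
left-hand side. -/
structure St (V : Finset Pt) (O D T : Finset (Pt × Pt)) (X : Set Pt) : Prop where
  verts : ∀ d ∈ D, d.1 ∈ V ∧ d.2 ∈ V
  symm : ∀ d ∈ D, d.swap ∈ D
  ne : ∀ d ∈ D, d.1 ≠ d.2
  sub : O ⊆ D
  asym : ∀ d ∈ O, d.swap ∉ O
  cov : ∀ v ∈ V, ∃ u, (v, u) ∈ O ∨ (u, v) ∈ O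
  tsub : T ⊆ D
  plane : ∀ d ∈ D, ∀ e ∈ D, e ≠ d → e ≠ d.swap → ∀ z ∈ openSegment ℝ d.1 d.2,
    z ∉ segment ℝ e.1 e.2
  face : ∀ x y, (∀ z ∈ segment ℝ x y, z ∉ carrier D) → (x ∈ X ↔ y ∈ X)
  side : ∀ d ∈ D, ∀ z ∈ openSegment ℝ d.1 d.2, ∀ x, 0 < cr d.1 d.2 x →
    (∀ t, 0 < t → t ≤ 1 → ip z x t ∉ carrier D) → (x ∈ X ↔ d ∈ T)

namespace St

variable {V : Finset Pt} {O D T : Finset (Pt × Pt)} {X : Set Pt}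

lemma cov' (h : St V O D T X) {v : Pt} (hv : v ∈ V) : ∃ u, (v, u) ∈ D := by
  obtain ⟨u, hu | hu⟩ := h.cov v hv
  · exact ⟨u, h.sub hu⟩
  · exact ⟨u, h.symm _ (h.sub hu)⟩

lemma mem_swap (h : St V O D T X) {p q : Pt} (hd : (p, q) ∈ D) : (q, p) ∈ D := h.symm _ hd

lemma kd_mem (h : St V O D T X) (κ : Bool) {p q : Pt} (hd : (p, q) ∈ D) : kd κ p q ∈ D := by
  cases κ
  · exact h.mem_swap hd
  · exact hd

/-- A vertex never lies in the relative interior of an edge. -/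
lemma vert_notMem (h : St V O D T X) {v : Pt} (hv : v ∈ V) {p q : Pt} (hd : (p, q) ∈ D) :
    v ∉ openSegment ℝ p q := by
  intro hz
  obtain ⟨u, hu⟩ := h.cov' hv
  by_cases h1 : (v, u) = (p, q)
  · have : v = p := (Prod.ext_iff.1 h1).1
    subst this
    exact left_notMem_oseg (h.ne _ hd) hz
  by_cases h2 : (v, u) = (q, p)
  · have : v = q := (Prod.ext_iff.1 h2).1
    subst this
    exact right_notMem_oseg (h.ne _ hd) hz
  exact h.plane _ hd _ hu h1 h2 v hz (left_mem_segment ℝ v u)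

lemma vert_mem_seg (h : St V O D T X) {v : Pt} (hv : v ∈ V) {p q : Pt} (hd : (p, q) ∈ D)
    (hz : v ∈ segment ℝ p q) : v = p ∨ v = q :=
  ends_of_mem_seg hz (h.vert_notMem hv hd)

lemma kside (h : St V O D T X) {κ : Bool} {p q : Pt} (hd : (p, q) ∈ D) {z : Pt}
    (hz : z ∈ openSegment ℝ p q) {x : Pt} (hx : 0 < kcr κ p q x)
    (hf : ∀ t, 0 < t → t ≤ 1 → ip z x t ∉ carrier D) : x ∈ X ↔ kd κ p q ∈ T := by
  cases κ
  · refine h.side (q, p) (h.mem_swap hd) z (by rwa [openSegment_symm]) x ?_ hf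
    rw [← kcr_true, kcr_swap]
    rw [kcr_false] at hx; rwa [kcr_true]
  · rw [kcr_true] at hx
    exact h.side _ hd z hz x hx hf

/-- Adding an edge in a face. -/
lemma add (h : St V O D T X) {p q : Pt} (hp : p ∈ V) (hq : q ∈ V) (hne : p ≠ q)
    (hpq : (p, q) ∉ D) (hfree : ∀ z ∈ openSegment ℝ p q, z ∉ carrier D) :
    ∃ T', St V O (insert (p, q) (insert (q, p) D)) T' X ∧ (∀ d ∈ D, d ∈ T' ↔ d ∈ T) ∧
      ((p, q) ∈ T' ↔ (q, p) ∈ T') := by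
  set D' := insert (p, q) (insert (q, p) D) with hD'
  have hqp : (q, p) ∉ D := fun hh => hpq (h.mem_swap hh)
  have hsub : D ⊆ D' := fun d hd => by simp [hD', hd]
  set m := ip p q (1/2) with hm
  let L : Finset (Pt × Pt) := if m ∈ X then {(p, q), (q, p)} else ∅
  have hL : ∀ d, d ∈ L ↔ (d = (p, q) ∨ d = (q, p)) ∧ m ∈ X := by
    intro d; simp only [L]; split_ifs with hh <;> simp [hh]
  have hmo : m ∈ openSegment ℝ p q := ip_mem_oseg (by norm_num) (by norm_num)
  have hface : ∀ x y, (∀ z ∈ segment ℝ x y, z ∉ carrier D') → (x ∈ X ↔ y ∈ X) :=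
    fun x y hxy => h.face x y fun z hz hz' => hxy z hz (carrier_mono hsub hz')
  have hnew : ∀ z ∈ openSegment ℝ p q, ∀ x,
      (∀ t, 0 < t → t ≤ 1 → ip z x t ∉ carrier D') → (x ∈ X ↔ m ∈ X) := by
    intro z hz x hx
    have h1 : z ∈ X ↔ x ∈ X := by
      apply h.face
      intro w hw hw'
      obtain ⟨t, t0, t1, rfl⟩ := mem_seg.1 hw
      rcases t0.eq_or_lt with rfl | t0
      · rw [ip_zero] at hw'; exact hfree z hz hw'
      · exact hx t t0 t1 (carrier_mono hsub hw')
    have h2 : z ∈ X ↔ m ∈ X := by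
      apply h.face
      intro w hw
      exact hfree w ((convex_openSegment p q).segment_subset hz hmo hw)
    rw [← h1, h2]
  have hold : ∀ d ∈ D, (d ∈ T ∪ L ↔ d ∈ T) := by
    intro d hd
    have : d ∉ L := by
      rw [hL]; rintro ⟨rfl | rfl, -⟩
      · exact hpq hd
      · exact hqp hd
    simp [this]
  have hn1 : (p, q) ∈ T ∪ L ↔ m ∈ X := by
    have : (p, q) ∉ T := fun hh => hpq (h.tsub hh)
    simp [this, hL]
  have hn2 : (q, p) ∈ T ∪ L ↔ m ∈ X := by
    have : (q, p) ∉ T := fun hh => hqp (h.tsub hh)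
    simp [this, hL]
  have hpl1 : ∀ e ∈ D, ∀ z ∈ openSegment ℝ p q, z ∉ segment ℝ e.1 e.2 :=
    fun e he z hz hz' => hfree z hz ⟨e, he, hz'⟩
  have hpl2 : ∀ d ∈ D, ∀ z ∈ openSegment ℝ d.1 d.2, z ∉ segment ℝ p q := by
    intro d hd z hz hz'
    by_cases ho : z ∈ openSegment ℝ p q
    · exact hfree z ho ⟨d, hd, openSegment_subset_segment _ _ _ hz⟩
    · rcases ends_of_mem_seg hz' ho with rfl | rfl
      · exact h.vert_notMem hp (p := d.1) (q := d.2) hd hz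
      · exact h.vert_notMem hq (p := d.1) (q := d.2) hd hz
  refine ⟨T ∪ L, ⟨?_, ?_, ?_, h.sub.trans hsub, h.asym, h.cov, ?_, ?_, hface, ?_⟩, hold, ?_⟩
  · intro d hd
    simp only [hD', mem_insert] at hd
    rcases hd with rfl | rfl | hd
    exacts [⟨hp, hq⟩, ⟨hq, hp⟩, h.verts d hd]
  · intro d hd
    simp only [hD', mem_insert] at hd ⊢
    rcases hd with rfl | rfl | hd
    exacts [by simp, by simp, Or.inr (Or.inr (h.symm d hd))]
  · intro d hd
    simp only [hD', mem_insert] at hd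
    rcases hd with rfl | rfl | hd
    exacts [hne, hne.symm, h.ne d hd]
  · intro d hd
    rw [mem_union] at hd
    rcases hd with hd | hd
    · exact hsub (h.tsub hd)
    · rcases ((hL d).1 hd).1 with rfl | rfl <;> simp [hD']
  · intro d hd e he h1 h2 z hz
    simp only [hD', mem_insert] at hd he
    rcases hd with rfl | rfl | hd <;> rcases he with rfl | rfl | he
    · exact absurd rfl h1
    · exact absurd rfl h2
    · exact hpl1 e he z hz
    · exact absurd rfl h2
    · exact absurd rfl h1
    · exact hpl1 e he z (by rwa [openSegment_symm])
    · exact hpl2 d hd z hz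
    · rw [segment_symm]; exact hpl2 d hd z hz
    · exact h.plane d hd e he h1 h2 z hz
  · intro d hd z hz x hx hf
    simp only [hD', mem_insert] at hd
    rcases hd with rfl | rfl | hd
    · rw [hn1]; exact hnew z hz x hf
    · rw [hn2]; exact hnew z (by rwa [openSegment_symm]) x hf
    · rw [hold d hd]
      exact h.side d hd z hz x hx fun t t0 t1 ht => hf t t0 t1 (carrier_mono hsub ht)
  · rw [hn1, hn2]

/-- Deleting an edge whose two sides have the same colour. -/
lemma remove (h : St V O D T X) {p q : Pt} (hpq : (p, q) ∈ D) (ho : (p, q) ∉ O)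
    (ho' : (q, p) ∉ O) (heq : (p, q) ∈ T ↔ (q, p) ∈ T) :
    ∃ X', St V O (D.filter fun d => d ≠ (p, q) ∧ d ≠ (q, p))
      (T.filter fun d => d ≠ (p, q) ∧ d ≠ (q, p)) X' := by
  set D' := D.filter fun d => d ≠ (p, q) ∧ d ≠ (q, p) with hD'
  set Q : Prop := (p, q) ∈ T with hQ
  have hmD : ∀ d, d ∈ D' ↔ d ∈ D ∧ d ≠ (p, q) ∧ d ≠ (q, p) := fun d => by simp [hD']
  have hsub : D' ⊆ D := filter_subset _ _
  have hOD : O ⊆ D' := by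
    intro d hd
    refine (hmD d).2 ⟨h.sub hd, ?_, ?_⟩ <;> rintro rfl <;> contradiction
  have hne : p ≠ q := h.ne _ hpq
  have hV := h.verts _ hpq
  have hvc : ∀ v ∈ V, v ∈ carrier D' := by
    intro v hv
    obtain ⟨u, hu | hu⟩ := h.cov v hv
    · exact ⟨_, hOD hu, left_mem_segment ℝ v u⟩
    · exact ⟨_, hOD hu, right_mem_segment ℝ u v⟩
  have hcar : ∀ z, z ∈ carrier D → z ∉ carrier D' → z ∈ openSegment ℝ p q := by
    rintro z ⟨d, hd, hz⟩ hz'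
    have hzpq : z ∈ segment ℝ p q := by
      by_contra hcon
      refine hz' ⟨d, (hmD d).2 ⟨hd, ?_, ?_⟩, hz⟩
      · rintro rfl; exact hcon hz
      · rintro rfl; rw [segment_symm] at hz; exact hcon hz
    by_contra hcon
    rcases ends_of_mem_seg hzpq hcon with rfl | rfl
    · exact hz' (hvc _ hV.1)
    · exact hz' (hvc _ hV.2)
  let X' : Set Pt := {x | if x ∈ openSegment ℝ p q then Q else x ∈ X}
  have hX1 : ∀ x, x ∈ openSegment ℝ p q → (x ∈ X' ↔ Q) := by
    intro x hx; simp only [X', Set.mem_ofPred_eq, if_pos hx]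
  have hX2 : ∀ x, x ∉ openSegment ℝ p q → (x ∈ X' ↔ x ∈ X) := by
    intro x hx; simp only [X', Set.mem_ofPred_eq, if_neg hx]
  -- points visible from the open edge
  have key : ∀ z ∈ openSegment ℝ p q, ∀ w, (∀ t, 0 < t → t ≤ 1 → ip z w t ∉ carrier D') →
      (w ∈ X' ↔ Q) := by
    intro z hz w hw
    obtain ⟨s, s0, s1, hzs⟩ := mem_oseg.1 hz
    have hz0 : cr p q z = 0 := by rw [hzs, cr_ip]; simp [cr]; right; ring
    have hoff : cr p q w ≠ 0 → ∀ t, 0 < t → ip z w t ∉ openSegment ℝ p q := by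
      intro hc t ht hmem
      obtain ⟨r, -, -, hr⟩ := mem_oseg.1 hmem
      have e1 : cr p q (ip z w t) = t * cr p q w := by rw [cr_ip, hz0]; ring
      have e2 : cr p q (ip z w t) = 0 := by rw [hr, cr_ip]; simp [cr]; right; ring
      rw [e1] at e2
      rcases mul_eq_zero.1 e2 with h' | h'
      · exact ht.ne' h'
      · exact hc h'
    have hcfree : cr p q w ≠ 0 → ∀ t, 0 < t → t ≤ 1 → ip z w t ∉ carrier D := by
      intro hc t t0 t1 hmem
      exact hoff hc t t0 (hcar _ hmem (hw t t0 t1))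
    rcases lt_trichotomy (cr p q w) 0 with hc | hc | hc
    · have hw1 : w ∉ openSegment ℝ p q := by
        have := hoff hc.ne 1 one_pos; rwa [ip_one] at this
      rw [hX2 w hw1, heq]
      refine h.side (q, p) (h.mem_swap hpq) z (by rwa [openSegment_symm]) w ?_ (hcfree hc.ne)
      have : cr q p w = - cr p q w := by simp only [cr]; ring
      show 0 < cr q p w
      linarith
    · refine hX1 w ?_
      obtain ⟨r, rfl⟩ := exists_ip_of_cr hne hc
      refine ip_mem_oseg ?_ ?_
      · by_contra hr
        push Not at hr
        refine hw (s / (s - r)) (div_pos s0 (by linarith)) ?_ ?_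
        · rw [div_le_one (by linarith)]; linarith
        · have : ip z (ip p q r) (s / (s - r)) = p := by
            have hsr : s - r ≠ 0 := by linarith
            rw [hzs, ip_ip_ip]
            have : s + s / (s - r) * (r - s) = 0 := by field_simp; ring
            rw [this, ip_zero]
          rw [this]; exact hvc _ hV.1
      · by_contra hr
        push Not at hr
        refine hw ((1 - s) / (r - s)) (div_pos (by linarith) (by linarith)) ?_ ?_
        · rw [div_le_one (by linarith)]; linarith
        · have : ip z (ip p q r) ((1 - s) / (r - s)) = q := by
            have hsr : r - s ≠ 0 := by linarith
            rw [hzs, ip_ip_ip]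
            have : s + (1 - s) / (r - s) * (r - s) = 1 := by field_simp; ring
            rw [this, ip_one]
          rw [this]; exact hvc _ hV.2
    · have hw1 : w ∉ openSegment ℝ p q := by
        have := hoff hc.ne' 1 one_pos; rwa [ip_one] at this
      rw [hX2 w hw1]
      exact h.side (p, q) hpq z hz w hc (hcfree hc.ne')
  have hsegsub : ∀ {x y z w : Pt}, z ∈ segment ℝ x y → w ∈ segment ℝ x y → ∀ t, 0 ≤ t → t ≤ 1 →
      ip z w t ∈ segment ℝ x y := by
    intro x y z w hz hw t t0 t1
    exact (convex_segment x y).segment_subset hz hw (ip_mem_seg t0 t1)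
  refine ⟨X', ⟨fun d hd => h.verts d (hsub hd), ?_, fun d hd => h.ne d (hsub hd), hOD, h.asym,
    h.cov, filter_subset_filter _ h.tsub, ?_, ?_, ?_⟩⟩
  · intro d hd
    obtain ⟨h1, h2, h3⟩ := (hmD d).1 hd
    refine (hmD _).2 ⟨h.symm d h1, ?_, ?_⟩
    · intro e; apply h3; rw [← Prod.swap_swap d, e]; rfl
    · intro e; apply h2; rw [← Prod.swap_swap d, e]; rfl
  · intro d hd e he
    exact h.plane d (hsub hd) e (hsub he)
  · intro x y hxy
    by_cases hmeet : ∃ z ∈ segment ℝ x y, z ∈ openSegment ℝ p q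
    · obtain ⟨z, hz, hzo⟩ := hmeet
      rw [key z hzo x fun t t0 t1 => hxy _ (hsegsub hz (left_mem_segment ℝ x y) t t0.le t1),
        key z hzo y fun t t0 t1 => hxy _ (hsegsub hz (right_mem_segment ℝ x y) t t0.le t1)]
    · push Not at hmeet
      rw [hX2 x (hmeet x (left_mem_segment ℝ x y)), hX2 y (hmeet y (right_mem_segment ℝ x y))]
      exact h.face x y fun z hz hz' => hmeet z hz (hcar z hz' (hxy z hz))
  · intro e he z hz x hx hf
    obtain ⟨heD, he1, he2⟩ := (hmD e).1 he
    have hT : e ∈ T.filter (fun d => d ≠ (p, q) ∧ d ≠ (q, p)) ↔ e ∈ T := by simp [he1, he2]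
    rw [hT]
    by_cases hmeet : ∃ t, 0 < t ∧ t ≤ 1 ∧ ip z x t ∈ openSegment ℝ p q
    · obtain ⟨t, t0, t1, hw⟩ := hmeet
      have hzs : z ∉ segment ℝ p q := h.plane e heD (p, q) hpq (Ne.symm he1)
        (fun e' => he2 (by rw [← Prod.swap_swap e, ← e']; rfl)) z hz
      have hxQ : x ∈ X' ↔ Q := by
        refine key _ hw x fun s s0 s1 => ?_
        rw [ip_ip_right]
        exact hf _ (by nlinarith) (by nlinarith)
      have hzc : cr p q z ≠ 0 := by
        intro hc
        obtain ⟨r, rfl⟩ := exists_ip_of_cr hne hc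
        obtain ⟨s, s0, s1, hws⟩ := mem_oseg.1 hw
        have hr : r < 0 ∨ 1 < r := by
          by_contra hcon
          push Not at hcon
          exact hzs (ip_mem_seg hcon.1 hcon.2)
        have hwf : ∀ u, 0 < u → u ≤ 1 → ip (ip p q r) (ip p q s) u ∉ carrier D' := by
          intro u u0 u1
          rw [← hws, ip_ip]
          exact hf _ (by positivity) (by nlinarith)
        rcases hr with hr | hr
        · refine hwf ((-r) / (s - r)) (div_pos (by linarith) (by linarith)) ?_ ?_
          · rw [div_le_one (by linarith)]; linarith
          · have : ip (ip p q r) (ip p q s) ((-r) / (s - r)) = p := by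
              have hsr : s - r ≠ 0 := by linarith
              rw [ip_ip_ip]
              have : r + (-r) / (s - r) * (s - r) = 0 := by field_simp; ring
              rw [this, ip_zero]
            rw [this]; exact hvc _ hV.1
        · refine hwf ((r - 1) / (r - s)) (div_pos (by linarith) (by linarith)) ?_ ?_
          · rw [div_le_one (by linarith)]; linarith
          · have : ip (ip p q r) (ip p q s) ((r - 1) / (r - s)) = q := by
              have hsr : r - s ≠ 0 := by linarith
              rw [ip_ip_ip]
              have : r + (r - 1) / (r - s) * (s - r) = 1 := by field_simp; ring
              rw [this, ip_one]
            rw [this]; exact hvc _ hV.2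
      have hoff : ∀ s, s < 1 → ip z (ip z x t) s ∉ openSegment ℝ p q := by
        intro s s1 hmem
        obtain ⟨r, -, -, hr⟩ := mem_oseg.1 hmem
        obtain ⟨r', -, -, hr'⟩ := mem_oseg.1 hw
        have e0 : cr p q (ip z x t) = 0 := by rw [hr', cr_ip]; simp [cr]; right; ring
        have e1 : cr p q (ip z (ip z x t) s) = (1 - s) * cr p q z := by
          rw [cr_ip, e0]; ring
        have e2 : cr p q (ip z (ip z x t) s) = 0 := by rw [hr, cr_ip]; simp [cr]; right; ring
        rw [e1] at e2
        rcases mul_eq_zero.1 e2 with h' | h'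
        · linarith
        · exact hzc h'
      have hw' : ip z (ip z x t) (1/2) ∈ X ↔ e ∈ T := by
        have hez : cr e.1 e.2 z = 0 := by
          obtain ⟨r, -, -, hr⟩ := mem_oseg.1 hz
          rw [hr, cr_ip]; simp [cr]; right; ring
        refine h.side e heD z hz _ ?_ ?_
        · rw [cr_ip, cr_ip, hez]
          have : 0 < t * cr e.1 e.2 x := mul_pos t0 hx
          linarith
        · intro s s0 s1 hmem
          rw [ip_ip] at hmem
          refine hoff _ (by linarith) (hcar _ hmem ?_)
          rw [ip_ip]
          exact hf _ (by positivity) (by nlinarith)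
      have hwQ : ip z (ip z x t) (1/2) ∈ X' ↔ Q := by
        refine key _ hw _ fun s s0 s1 => ?_
        have : ip (ip z x t) (ip z (ip z x t) (1/2)) s = ip z x (t + s * (1/2 * t - t)) := by
          rw [ip_ip, ip_ip_ip]
        rw [this]
        exact hf _ (by nlinarith) (by nlinarith)
      rw [hX2 _ (hoff _ (by norm_num))] at hwQ
      rw [hxQ, ← hwQ, hw']
    · push Not at hmeet
      have hxo : x ∉ openSegment ℝ p q := by
        have := hmeet 1 one_pos le_rfl; rwa [ip_one] at this
      rw [hX2 x hxo]
      exact h.side e heD z hz x hx fun t t0 t1 ht => hmeet t t0 t1 (hcar _ ht (hf t t0 t1))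

end St

lemma exists_small {A : ℝ} (hA : 0 < A) (A' : ℝ) :
    ∃ ε₀ : ℝ, 0 < ε₀ ∧ ε₀ ≤ 1 / 2 ∧ ∀ ε, 0 ≤ ε → ε ≤ ε₀ → 0 < (1 - ε) * A + ε * A' := by
  have hp : 0 < A + |A'| := by positivity
  refine ⟨A / (2 * (A + |A'|)), by positivity, ?_, fun ε h0 h1 => ?_⟩
  · rw [div_le_div_iff₀ (by positivity) (by norm_num)]
    linarith [abs_nonneg A']
  · rw [le_div_iff₀ (by positivity)] at h1
    have : -|A'| ≤ A' := neg_abs_le A'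
    nlinarith

lemma otri_rot (κ : Bool) (v a u : Pt) : otri κ a u v = otri κ v a u := by
  ext x; simp only [otri, Set.mem_ofPred_eq]; tauto

namespace St

variable {V : Finset Pt} {O D T : Finset (Pt × Pt)} {X : Set Pt}

/-- Swapping the colour of a triangular face. -/
lemma toggle (h : St V O D T X) {κ : Bool} {v a u : Pt} (hΔ : 0 < kcr κ v a u)
    (h1 : (v, a) ∈ D) (h2 : (a, u) ∈ D) (h3 : (u, v) ∈ D)
    (hfree : ∀ z ∈ otri κ v a u, z ∉ carrier D) :
    St V O D (symmDiff T {kd κ v a, kd κ a u, kd κ u v}) (symmDiff X (otri κ v a u)) := by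
  have hΔ2 : 0 < kcr κ a u v := by rwa [kcr_rot]
  have hΔ3 : 0 < kcr κ u v a := by rwa [kcr_rot]
  have aux : ∀ x y, (∀ z ∈ segment ℝ x y, z ∉ carrier D) → x ∈ otri κ v a u →
      y ∈ otri κ v a u := by
    intro x y hxy hx
    by_contra hy
    obtain ⟨t, t0, t1, -, hs⟩ := tri_exit hΔ hx hy
    refine hxy _ (ip_mem_seg t0.le t1) ?_
    rcases hs with hs | hs | hs
    exacts [⟨_, h1, hs⟩, ⟨_, h2, hs⟩, ⟨_, h3, hs⟩]
  have aux' : ∀ x y, (∀ z ∈ segment ℝ x y, z ∉ carrier D) → (x ∈ otri κ v a u ↔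
      y ∈ otri κ v a u) := fun x y hxy =>
    ⟨aux x y hxy, aux y x (by rwa [segment_symm])⟩
  have fwd : ∀ p q, (p, q) ∈ D → ∀ e ∈ D, ∀ z ∈ openSegment ℝ e.1 e.2, z ∈ segment ℝ p q →
      ∀ x, 0 < kcr κ p q x → 0 < cr e.1 e.2 x → e = kd κ p q := by
    intro p q hpq e he z hz hzs x hx hx'
    have hh : (p, q) = e ∨ (p, q) = e.swap := by
      by_contra hcon
      push Not at hcon
      exact h.plane e he (p, q) hpq hcon.1 hcon.2 z hz hzs
    have hcr : cr q p x = - cr p q x := by simp only [cr]; ring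
    obtain ⟨e1, e2⟩ := e
    cases κ
    · rw [kcr_false] at hx
      rcases hh with hh | hh
      · simp only [Prod.mk.injEq] at hh; obtain ⟨rfl, rfl⟩ := hh; exfalso; linarith
      · simp only [Prod.swap_prod_mk, Prod.mk.injEq] at hh; obtain ⟨rfl, rfl⟩ := hh; rfl
    · rw [kcr_true] at hx
      rcases hh with hh | hh
      · rw [← hh]; rfl
      · simp only [Prod.swap_prod_mk, Prod.mk.injEq] at hh; obtain ⟨rfl, rfl⟩ := hh
        simp only at hx'
        exfalso; linarith
  have bwd : ∀ p q r, otri κ p q r = otri κ v a u → 0 < kcr κ p q r →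
      ∀ z ∈ openSegment ℝ (kd κ p q).1 (kd κ p q).2, ∀ x, 0 < cr (kd κ p q).1 (kd κ p q).2 x →
      (∀ t, 0 < t → t ≤ 1 → ip z x t ∉ carrier D) → x ∈ otri κ v a u := by
    intro p q r hr hpos z hz x hx hf
    have hx' : 0 < kcr κ p q x := by
      cases κ
      · rw [kcr_false]
        have : cr q p x = - cr p q x := by simp only [cr]; ring
        simp only [kd] at hx; simp at hx; linarith
      · rw [kcr_true]; exact hx
    have hz' : z ∈ openSegment ℝ p q := by
      cases κ
      · rw [openSegment_symm]; exact hz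
      · exact hz
    obtain ⟨s, s0, s1, rfl⟩ := mem_oseg.1 hz'
    have q1 : 0 < kcr κ q r (ip p q s) := by
      rw [kcr_ip, kcr_rot, kcr_left]
      nlinarith
    have q2 : 0 < kcr κ r p (ip p q s) := by
      have : kcr κ r p q = kcr κ p q r := by rw [kcr_rot, kcr_rot]
      rw [kcr_ip, kcr_right, this]
      nlinarith
    obtain ⟨ε1, e10, e11, e1⟩ := exists_small q1 (kcr κ q r x)
    obtain ⟨ε2, e20, e21, e2⟩ := exists_small q2 (kcr κ r p x)
    set ε := min ε1 ε2 with hε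
    have he0 : 0 < ε := lt_min e10 e20
    have hm : ip (ip p q s) x ε ∈ otri κ v a u := by
      rw [← hr]
      refine ⟨?_, ?_, ?_⟩
      · rw [kcr_ip, kcr_ip, kcr_left, kcr_right]
        nlinarith [mul_pos he0 hx']
      · rw [kcr_ip]; exact e1 ε he0.le (min_le_left _ _)
      · rw [kcr_ip]; exact e2 ε he0.le (min_le_right _ _)
    refine aux _ _ ?_ hm
    intro w hw
    obtain ⟨t, t0, t1, rfl⟩ := mem_seg.1 hw
    rw [ip_ip_right]
    have : ε ≤ 1 / 2 := (min_le_left _ _).trans e11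
    exact hf _ (by nlinarith) (by nlinarith)
  refine ⟨h.verts, h.symm, h.ne, h.sub, h.asym, h.cov, ?_, h.plane, ?_, ?_⟩
  · intro d hd
    rw [mem_symmDiff] at hd
    rcases hd with hd | hd
    · exact h.tsub hd.1
    · have := hd.1
      simp only [mem_insert, mem_singleton] at this
      rcases this with rfl | rfl | rfl
      exacts [h.kd_mem κ h1, h.kd_mem κ h2, h.kd_mem κ h3]
  · intro x y hxy
    have e1 := aux' x y hxy
    have e2 := h.face x y hxy
    simp only [Set.mem_symmDiff]
    rw [e1, e2]
  · intro e he z hz x hx hf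
    have e2 := h.side e he z hz x hx hf
    have e1 : x ∈ otri κ v a u ↔ e ∈ ({kd κ v a, kd κ a u, kd κ u v} : Finset (Pt × Pt)) := by
      constructor
      · intro hxt
        have hzt : z ∉ otri κ v a u := fun hzt =>
          hfree z hzt ⟨e, he, openSegment_subset_segment _ _ _ hz⟩
        obtain ⟨t, t0, t1, -, hs⟩ := tri_exit hΔ hxt hzt
        have ht : t = 1 := by
          by_contra hne
          have ht : t < 1 := lt_of_le_of_ne t1 hne
          refine hf (1 - t) (by linarith) (by linarith) ?_
          rw [ip_symm]
          rcases hs with hs | hs | hs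
          exacts [⟨_, h1, hs⟩, ⟨_, h2, hs⟩, ⟨_, h3, hs⟩]
        rw [ht, ip_one] at hs
        simp only [mem_insert, mem_singleton]
        rcases hs with hs | hs | hs
        · exact Or.inl (fwd v a h1 e he z hz hs x hxt.1 hx)
        · exact Or.inr (Or.inl (fwd a u h2 e he z hz hs x hxt.2.1 hx))
        · exact Or.inr (Or.inr (fwd u v h3 e he z hz hs x hxt.2.2 hx))
      · intro hm
        simp only [mem_insert, mem_singleton] at hm
        rcases hm with rfl | rfl | rfl
        · exact bwd v a u rfl hΔ z hz x hx hf
        · exact bwd a u v (otri_rot κ v a u) hΔ2 z hz x hx hf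
        · exact bwd u v a ((otri_rot κ a u v).trans (otri_rot κ v a u)) hΔ3 z hz x hx hf
    rw [Set.mem_symmDiff, mem_symmDiff, e1, e2]

end St

/-- The weight of a dart in the cost of a two-coloured drawing. -/
noncomputable def wt (O T : Finset (Pt × Pt)) (d : Pt × Pt) : ℝ :=
  if d ∈ O then 1 - (if d ∈ T then 1 else 0) + (if d.swap ∈ T then 1 else 0)
  else if d.swap ∈ O then 0
  else (if d ∈ T then 1 else 0) * (1 - (if d.swap ∈ T then 1 else 0))

noncomputable def cost (c : Pt → Pt → ℝ) (O D T : Finset (Pt × Pt)) : ℝ :=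
  ∑ d ∈ D, c d.1 d.2 * wt O T d

/-- The sign of the change of the cost when the label of `d` is switched. -/
noncomputable def chi (O T : Finset (Pt × Pt)) (d : Pt × Pt) : ℝ :=
  if d ∈ O then (if d ∈ T then 1 else -1)
  else if d.swap ∈ O then (if d ∈ T then -1 else 1)
  else (if d ∈ T ↔ d.swap ∈ T then 1 else -1)

lemma chi_le_one (O T : Finset (Pt × Pt)) (d : Pt × Pt) : chi O T d ≤ 1 := by
  unfold chi; split_ifs <;> norm_num

lemma chi_congr {O T T' : Finset (Pt × Pt)} {d : Pt × Pt} (h1 : d ∈ T ↔ d ∈ T')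
    (h2 : d.swap ∈ T ↔ d.swap ∈ T') : chi O T d = chi O T' d := by
  unfold chi; simp only [h1, h2]

lemma wt_congr {O T T' : Finset (Pt × Pt)} {d : Pt × Pt} (h1 : d ∈ T ↔ d ∈ T')
    (h2 : d.swap ∈ T ↔ d.swap ∈ T') : wt O T d = wt O T' d := by
  unfold wt; simp only [h1, h2]

lemma wt_nonneg (O T : Finset (Pt × Pt)) (d : Pt × Pt) : 0 ≤ wt O T d := by
  unfold wt; split_ifs <;> norm_num

lemma cost_congr {c : Pt → Pt → ℝ} {O D D' T T' : Finset (Pt × Pt)} (hs : D' ⊆ D)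
    (h1 : ∀ d ∈ D', wt O T' d = wt O T d) (h2 : ∀ d ∈ D, d ∉ D' → wt O T d = 0) :
    cost c O D' T' = cost c O D T := by
  unfold cost
  rw [← Finset.sum_subset hs (f := fun d => c d.1 d.2 * wt O T d)]
  · exact Finset.sum_congr rfl fun d hd => by rw [h1 d hd]
  · intro d hd hd'
    rw [h2 d hd hd', mul_zero]

lemma cost_toggle_one {c : Pt → Pt → ℝ} (hc : ∀ p q, c p q = c q p) {O D T : Finset (Pt × Pt)}
    (hO : ∀ d ∈ O, d.swap ∉ O) {e : Pt × Pt} (he : e ∈ D) (he' : e.swap ∈ D) (hne : e ≠ e.swap) :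
    cost c O D (symmDiff T {e}) = cost c O D T + chi O T e * c e.1 e.2 := by
  unfold cost
  have hsub : ({e, e.swap} : Finset (Pt × Pt)) ⊆ D := by
    intro d hd; simp only [mem_insert, mem_singleton] at hd
    rcases hd with rfl | rfl <;> assumption
  have hm : ∀ d, d ≠ e → (d ∈ symmDiff T {e} ↔ d ∈ T) := by
    intro d hd; simp [mem_symmDiff, hd]
  have hd : ∑ d ∈ D, (c d.1 d.2 * wt O (symmDiff T {e}) d - c d.1 d.2 * wt O T d)
      = ∑ d ∈ {e, e.swap}, (c d.1 d.2 * wt O (symmDiff T {e}) d - c d.1 d.2 * wt O T d) := by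
    symm
    apply Finset.sum_subset hsub
    intro d _ hd
    simp only [mem_insert, mem_singleton, not_or] at hd
    rw [wt_congr (T' := T) (hm d hd.1) (hm d.swap ?_), sub_self]
    intro hh; exact hd.2 (by rw [← hh, Prod.swap_swap])
  rw [Finset.sum_sub_distrib, Finset.sum_pair hne] at hd
  have h1 : e ∈ symmDiff T {e} ↔ e ∉ T := by simp [mem_symmDiff]
  have h2 : e.swap ∈ symmDiff T {e} ↔ e.swap ∈ T := hm _ hne.symm
  have hcs : c e.swap.1 e.swap.2 = c e.1 e.2 := hc _ _
  rw [hcs] at hd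
  have key : wt O (symmDiff T {e}) e - wt O T e + (wt O (symmDiff T {e}) e.swap - wt O T e.swap)
      = chi O T e := by
    unfold wt chi
    simp only [h1, h2, Prod.swap_swap]
    have := hO e
    by_cases o1 : e ∈ O <;> by_cases o2 : e.swap ∈ O <;> by_cases t1 : e ∈ T <;>
      by_cases t2 : e.swap ∈ T <;> simp_all
  rw [← key]
  linarith

lemma chi_symmDiff_of_ne {O T : Finset (Pt × Pt)} {d e : Pt × Pt} (h1 : d ≠ e)
    (h2 : d ≠ e.swap) : chi O (symmDiff T {e}) d = chi O T d := by
  apply chi_congr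
  · simp [mem_symmDiff, h1]
  · have : d.swap ≠ e := fun hh => h2 (by rw [← hh, Prod.swap_swap])
    simp [mem_symmDiff, this]

lemma cost_toggle_three {c : Pt → Pt → ℝ} (hc : ∀ p q, c p q = c q p) {O D T : Finset (Pt × Pt)}
    (hO : ∀ d ∈ O, d.swap ∉ O) (hD : ∀ d ∈ D, d.swap ∈ D) {κ : Bool} {v a u : Pt}
    (hva : v ≠ a) (hau : a ≠ u) (huv : u ≠ v)
    (h1 : kd κ v a ∈ D) (h2 : kd κ a u ∈ D) (h3 : kd κ u v ∈ D) :
    cost c O D (symmDiff T {kd κ v a, kd κ a u, kd κ u v}) =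
      cost c O D T + chi O T (kd κ v a) * c v a + chi O T (kd κ a u) * c a u
        + chi O T (kd κ u v) * c u v := by
  have hcc : ∀ p q, c (kd κ p q).1 (kd κ p q).2 = c p q := by
    intro p q; cases κ
    · exact hc _ _
    · rfl
  have hns : ∀ p q, p ≠ q → kd κ p q ≠ (kd κ p q).swap := by
    intro p q hpq; cases κ <;> simp [kd] <;> intro h <;> simp_all
  have n12 : kd κ a u ≠ kd κ v a := by
    cases κ <;> simp [kd] <;> intro h <;> simp_all
  have n12' : kd κ a u ≠ (kd κ v a).swap := by
    cases κ <;> simp [kd] <;> intro h <;> simp_all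
  have n13 : kd κ u v ≠ kd κ v a := by
    cases κ <;> simp [kd] <;> intro h <;> simp_all
  have n13' : kd κ u v ≠ (kd κ v a).swap := by
    cases κ <;> simp [kd] <;> intro h <;> simp_all
  have n23 : kd κ u v ≠ kd κ a u := by
    cases κ <;> simp [kd] <;> intro h <;> simp_all
  have n23' : kd κ u v ≠ (kd κ a u).swap := by
    cases κ <;> simp [kd] <;> intro h <;> simp_all
  have e : symmDiff T {kd κ v a, kd κ a u, kd κ u v} =
      symmDiff (symmDiff (symmDiff T {kd κ v a}) {kd κ a u}) {kd κ u v} := by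
    ext d
    simp only [mem_symmDiff, mem_insert, mem_singleton]
    by_cases d1 : d = kd κ v a
    · subst d1; simp [n12.symm, n13.symm]
    by_cases d2 : d = kd κ a u
    · subst d2; simp [n12, n23.symm]
    simp [d1, d2]
  rw [e, cost_toggle_one hc hO h3 (hD _ h3) (hns _ _ huv),
    cost_toggle_one hc hO h2 (hD _ h2) (hns _ _ hau),
    cost_toggle_one hc hO h1 (hD _ h1) (hns _ _ hva),
    chi_symmDiff_of_ne n23 n23', chi_symmDiff_of_ne n13 n13', chi_symmDiff_of_ne n12 n12',
    hcc, hcc, hcc]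

structure CostFn (c : Pt → Pt → ℝ) : Prop where
  symm : ∀ p q, c p q = c q p
  nonneg : ∀ p q, 0 ≤ c p q
  tri : ∀ p q r, c p r ≤ c p q + c q r
  strict : ∀ p q r, cr p q r ≠ 0 → c p r < c p q + c q r
  between : ∀ p q r, q ∈ segment ℝ p r → c p r = c p q + c q r

namespace St

variable {V : Finset Pt} {O D T : Finset (Pt × Pt)} {X : Set Pt} {c : Pt → Pt → ℝ}

lemma add_cost (h : St V O D T X) {p q : Pt} {T' : Finset (Pt × Pt)} (hpq : (p, q) ∉ D)
    (h1 : ∀ d ∈ D, d ∈ T' ↔ d ∈ T) (h2 : (p, q) ∈ T' ↔ (q, p) ∈ T') :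
    cost c O (insert (p, q) (insert (q, p) D)) T' = cost c O D T := by
  symm
  have hqp : (q, p) ∉ D := fun hh => hpq (h.mem_swap hh)
  have o1 : (p, q) ∉ O := fun hh => hpq (h.sub hh)
  have o2 : (q, p) ∉ O := fun hh => hqp (h.sub hh)
  apply cost_congr
  · intro d hd; simp [hd]
  · intro d hd; exact wt_congr (h1 d hd).symm (h1 _ (h.symm d hd)).symm
  · intro d hd hd'
    simp only [mem_insert, hd', or_false] at hd
    rcases hd with rfl | rfl
    · simp [wt, o1, o2, h2]
      by_cases t : (q, p) ∈ T' <;> simp [t]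
    · simp [wt, o1, o2, h2]
      by_cases t : (q, p) ∈ T' <;> simp [t]

lemma remove_cost {p q : Pt} (ho : (p, q) ∉ O)
    (ho' : (q, p) ∉ O) (heq : (p, q) ∈ T ↔ (q, p) ∈ T) :
    cost c O (D.filter fun d => d ≠ (p, q) ∧ d ≠ (q, p))
      (T.filter fun d => d ≠ (p, q) ∧ d ≠ (q, p)) = cost c O D T := by
  apply cost_congr
  · exact filter_subset _ _
  · intro d hd
    simp only [mem_filter] at hd
    apply wt_congr
    · simp [hd.2.1, hd.2.2]
    · have h1 : d.swap ≠ (p, q) := fun hh => hd.2.2 (by rw [← Prod.swap_swap d, hh]; rfl)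
      have h2 : d.swap ≠ (q, p) := fun hh => hd.2.1 (by rw [← Prod.swap_swap d, hh]; rfl)
      simp [h1, h2]
  · intro d hd hd'
    simp only [mem_filter, hd, true_and, not_and_or, not_not] at hd'
    rcases hd' with rfl | rfl
    · simp [wt, ho, ho', heq]
      by_cases t : (q, p) ∈ T <;> simp [t]
    · simp [wt, ho, ho', heq]
      by_cases t : (q, p) ∈ T <;> simp [t]

end St

lemma kcr_bary (κ : Bool) (p q v a u x : Pt) :
    kcr κ v a u * kcr κ p q x = kcr κ a u x * kcr κ p q v + kcr κ u v x * kcr κ p q a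
      + kcr κ v a x * kcr κ p q u := by
  simp only [kcr, cr]; ring

/-- The first zero of the minimum of two affine functions. -/
lemma exists_first_zero {f₀ g₀ f₁ g₁ : ℝ} (hf : 0 < f₀) (hg : 0 < g₀) (h : f₁ ≤ 0 ∨ g₁ ≤ 0) :
    ∃ t : ℝ, 0 < t ∧ t ≤ 1 ∧ 0 ≤ (1 - t) * f₀ + t * f₁ ∧ 0 ≤ (1 - t) * g₀ + t * g₁ ∧
      ((1 - t) * f₀ + t * f₁ = 0 ∨ (1 - t) * g₀ + t * g₁ = 0) := by
  let F : ℝ → ℝ := fun t => min ((1 - t) * f₀ + t * f₁) ((1 - t) * g₀ + t * g₁)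
  have hF : Continuous F := by simp only [F]; fun_prop
  have h1 : F 1 ≤ 0 := by simpa [F] using h
  have h0 : 0 < F 0 := by simp only [F]; apply lt_min <;> linarith
  obtain ⟨t, ⟨ht0, ht1⟩, ht⟩ := intermediate_value_Icc' zero_le_one hF.continuousOn ⟨h1, h0.le⟩
  refine ⟨t, ?_, ht1, ?_, ?_, ?_⟩
  · rcases ht0.eq_or_lt with rfl | h
    · linarith
    · exact h
  · rw [← ht]; exact min_le_left _ _
  · rw [← ht]; exact min_le_right _ _
  · rcases min_choice ((1 - t) * f₀ + t * f₁) ((1 - t) * g₀ + t * g₁) with e | e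
    · left; rw [← e]; exact ht
    · right; rw [← e]; exact ht

lemma ordered_param {r s t : ℝ} (t0 : 0 < t) (t1 : t < 1) (h0 : 0 < r + t * (s - r))
    (h1 : r + t * (s - r) < 1) (i0 : (0 - r) * (s - 0) ≤ 0) (i1 : (1 - r) * (s - 1) ≤ 0)
    (hr : ¬ (0 < r ∧ r < 1)) : r = 0 ∨ r = 1 := by
  rcases lt_trichotomy r 0 with hr0 | hr0 | hr0
  · exfalso
    have : 0 < s := by by_contra hs; push Not at hs; nlinarith
    nlinarith
  · exact Or.inl hr0
  · rcases lt_trichotomy r 1 with hr1 | hr1 | hr1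
    · exact absurd ⟨hr0, hr1⟩ hr
    · exact Or.inr hr1
    · exfalso
      have : s < 1 := by by_contra hs; push Not at hs; nlinarith
      nlinarith

namespace St

variable {V : Finset Pt} {O D T : Finset (Pt × Pt)} {X : Set Pt} {c : Pt → Pt → ℝ}

lemma param_notBetween (h : St V O D T X) {a u : Pt} {m r s : ℝ} (hm : ip a u m ∈ V)
    (hd : (ip a u r, ip a u s) ∈ D) : (m - r) * (s - m) ≤ 0 := by
  by_contra hcon
  push Not at hcon
  have hsr : s - r ≠ 0 := by
    intro e
    have : s = r := by linarith
    rw [this] at hcon; nlinarith [sq_nonneg (m - r)]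
  refine h.vert_notMem hm hd (mem_oseg.2 ⟨(m - r) / (s - r), ?_, ?_, ?_⟩)
  · rcases lt_or_gt_of_ne hsr with hlt | hgt
    · apply div_pos_of_neg_of_neg _ hlt
      by_contra hge; push Not at hge
      nlinarith
    · apply div_pos _ hgt
      by_contra hge; push Not at hge
      nlinarith
  · rcases lt_or_gt_of_ne hsr with hlt | hgt
    · rw [div_lt_one_of_neg hlt]
      by_contra hge; push Not at hge
      nlinarith
    · rw [div_lt_one hgt]
      by_contra hge; push Not at hge
      nlinarith
  · rw [ip_ip_ip, div_mul_cancel₀ _ hsr]; congr 1; ring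

/-- In an empty sector with apex `v` between the rays to `a` and `w` there is a vertex `u` such that
the triangle `v a u` can be drawn without crossings. -/
lemma exists_tri (h : St V O D T X) {κ : Bool} {v a w : Pt} (hva : (v, a) ∈ D) (hvw : (v, w) ∈ D)
    (hΔ : 0 < kcr κ v a w)
    (hcone : ∀ b, (v, b) ∈ D → 0 < kcr κ v a b → kcr κ v b w ≤ 0) :
    ∃ u ∈ V, u ∈ ctri κ v a w ∧ u ≠ a ∧ 0 < kcr κ v a u ∧ kcr κ w v u < kcr κ v a w ∧
      (∀ z ∈ V, z ∈ ctri κ v a w → z ≠ v → z ≠ a → kcr κ a u z ≤ 0) ∧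
      (u = w ∨ 0 < kcr κ v u w) ∧
      (∀ z ∈ otri κ v a u, z ∉ carrier D) ∧
      (u ≠ w → ∀ z ∈ openSegment ℝ v u, z ∉ carrier D) ∧
      ((a, u) ∉ D → ∀ z ∈ openSegment ℝ a u, z ∉ carrier D) := by
  have hvV := (h.verts _ hva).1
  have haV := (h.verts _ hva).2
  have hwV := (h.verts _ hvw).2
  have hne_va : v ≠ a := h.ne _ hva
  have hne_vw : v ≠ w := h.ne _ hvw
  have hne_wa : w ≠ a := by rintro rfl; simp at hΔ
  have hwva : kcr κ w v a = kcr κ v a w := by rw [kcr_rot, kcr_rot]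
  have hawv : kcr κ a w v = kcr κ v a w := by rw [kcr_rot]
  set S := V.filter fun u => u ∈ ctri κ v a w ∧ u ≠ v ∧ u ≠ a with hSdef
  have hmS : ∀ z, z ∈ S ↔ z ∈ V ∧ z ∈ ctri κ v a w ∧ z ≠ v ∧ z ≠ a := fun z => by
    simp [hSdef]
  have hwS : w ∈ S := (hmS w).2 ⟨hwV, ⟨hΔ.le, by simp, by simp⟩, hne_vw.symm, hne_wa⟩
  have hS : ∀ z ∈ S, 0 < kcr κ v a z ∧ kcr κ w v z < kcr κ v a w := by
    intro z hz
    obtain ⟨hzV, hzt, h1, h2⟩ := (hmS z).1 hz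
    have hB : 0 < kcr κ v a z := by
      refine lt_of_le_of_ne hzt.1 fun h0 => ?_
      rcases h.vert_mem_seg hzV hva (mem_side hΔ h0.symm hzt.2.1 hzt.2.2) with h' | h'
      · exact h1 h'
      · exact h2 h'
    refine ⟨hB, ?_⟩
    have := kcr_sum κ v a w z
    linarith [hzt.2.1]
  obtain ⟨u₁, hu₁, hmin₁⟩ := S.exists_min_image
    (fun z => kcr κ v a z / (kcr κ v a w - kcr κ w v z)) ⟨w, hwS⟩
  obtain ⟨u, hu', hmax⟩ := (S.filter fun z => kcr κ v a z / (kcr κ v a w - kcr κ w v z)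
      = kcr κ v a u₁ / (kcr κ v a w - kcr κ w v u₁)).exists_max_image (fun z => kcr κ w v z)
      ⟨u₁, by simp [hu₁]⟩
  rw [mem_filter] at hu'
  obtain ⟨hu, hueq⟩ := hu'
  obtain ⟨huV, hut, huv, hua⟩ := (hmS u).1 hu
  obtain ⟨hBu, hAu⟩ := hS u hu
  have hAu0 : 0 ≤ kcr κ w v u := hut.2.2
  have hid : ∀ z, kcr κ v a w * kcr κ a u z = kcr κ v a w * kcr κ v a u -
      (kcr κ v a u * kcr κ w v z + (kcr κ v a w - kcr κ w v u) * kcr κ v a z) := by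
    intro z; simp only [kcr, cr]; ring
  have hmin : ∀ z ∈ S, kcr κ a u z ≤ 0 := by
    intro z hz
    have h1 := hmin₁ z hz
    rw [← hueq] at h1
    have h2 := (hS z hz).2
    rw [div_le_div_iff₀ (by linarith) (by linarith)] at h1
    have h3 := hid z
    have : kcr κ v a w * kcr κ a u z ≤ 0 := by rw [h3]; linarith
    exact nonpos_of_mul_nonpos_right this hΔ
  have htie : ∀ z ∈ S, kcr κ a u z = 0 → kcr κ w v z ≤ kcr κ w v u := by
    intro z hz h0
    apply hmax
    rw [mem_filter]
    refine ⟨hz, ?_⟩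
    rw [← hueq]
    have h2 := (hS z hz).2
    rw [div_eq_div_iff (by linarith) (by linarith)]
    have h3 := hid z
    rw [h0] at h3
    linarith
  have htri : ∀ z, 0 ≤ kcr κ v a z → 0 ≤ kcr κ a u z → 0 ≤ kcr κ a w z := by
    intro z h1 h2
    have h3 := hid z
    have h4 := kcr_sum κ v a w z
    have h5 := kcr_sum κ v a w u
    have h6 : 0 ≤ kcr κ v a u * kcr κ a w z := by
      have h7 : 0 ≤ kcr κ v a w * kcr κ a u z := mul_nonneg hΔ.le h2
      have h8 : 0 ≤ kcr κ a w u * kcr κ v a z := mul_nonneg hut.2.1 h1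
      have : kcr κ a w z = kcr κ v a w - kcr κ v a z - kcr κ w v z := by linarith
      rw [this]
      have : kcr κ a w u = kcr κ v a w - kcr κ v a u - kcr κ w v u := by linarith
      rw [this] at h8
      linarith
    exact nonneg_of_mul_nonneg_right h6 hBu
  -- the open triangle spanned by `v`, `a` and the point of `vw` on the line `au` is free
  have hU : ∀ y, 0 < kcr κ v a y → 0 < kcr κ w v y → 0 < kcr κ a u y → y ∉ carrier D := by
    rintro y hB hA hC ⟨⟨p, q⟩, hd, hy⟩
    simp only at hy
    have hv0 : ∀ q, (v, q) ∈ D → y ∉ segment ℝ v q := by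
      intro q hq hyq
      obtain ⟨t, t0, t1, rfl⟩ := mem_seg.1 hyq
      rw [kcr_ip, kcr_left] at hB
      rw [kcr_ip, kcr_right] at hA
      have h1 : 0 < kcr κ v a q := by
        by_contra hcon; push Not at hcon; nlinarith
      have h2 : 0 < kcr κ w v q := by
        by_contra hcon; push Not at hcon; nlinarith
      have := hcone q hq h1
      have e : kcr κ v q w = kcr κ w v q := by simp only [kcr, cr]; ring
      linarith
    have hv1 : v ≠ p := by rintro rfl; exact hv0 q hd hy
    have hv2 : v ≠ q := by
      rintro rfl; rw [segment_symm] at hy; exact hv0 p (h.mem_swap hd) hy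
    have key : ∀ p q, (p, q) ∈ D → y ∈ segment ℝ p q → v ≠ p → v ≠ q → kcr κ a u p ≤ 0 := by
      intro p q hd hy hv1 hv2
      by_contra hcon
      push Not at hcon
      have hpV := (h.verts _ hd).1
      have hpn : kcr κ v a p ≤ 0 ∨ kcr κ w v p ≤ 0 := by
        by_contra hc
        push Not at hc
        have hpS : p ∈ S := by
          refine (hmS p).2 ⟨hpV, ⟨hc.1.le, htri p hc.1.le hcon.le, hc.2.le⟩, hv1.symm, ?_⟩
          rintro rfl; simp at hc
        exact absurd (hmin p hpS) (not_le.2 hcon)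
      obtain ⟨t, t0, t1, f0, g0, hz⟩ := exists_first_zero hB hA hpn
      rw [← kcr_ip, ← kcr_ip] at hz
      rw [← kcr_ip] at f0 g0
      have c0 : 0 < kcr κ a u (ip y p t) := by rw [kcr_ip]; nlinarith
      set z := ip y p t with hzdef
      have hzs : z ∈ segment ℝ p q :=
        (convex_segment p q).segment_subset hy (left_mem_segment ℝ p q) (ip_mem_seg t0.le t1)
      have hzt := htri z f0 c0.le
      have hside : ∀ b, (v, b) ∈ D → z ≠ b → z ∉ segment ℝ v b := by
        intro b hb hzb hzm
        by_cases hzv : z = v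
        · rw [hzv] at hzs
          rcases h.vert_mem_seg hvV hd hzs with h' | h'
          · exact hv1 h'
          · exact hv2 h'
        have hzo : z ∈ openSegment ℝ v b := by
          by_contra hno
          rcases ends_of_mem_seg hzm hno with h' | h'
          · exact hzv h'
          · exact hzb h'
        refine h.plane (v, b) hb (p, q) hd ?_ ?_ z hzo hzs
        · intro e; exact hv1 (Prod.ext_iff.1 e).1.symm
        · intro e; exact hv2 (Prod.ext_iff.1 e).2.symm
      rcases hz with hz | hz
      · refine hside a hva ?_ (mem_side hΔ hz hzt g0)
        intro e; rw [e] at c0; simp at c0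
      · refine hside w hvw ?_ ?_
        · intro e; rw [e] at c0; exact absurd (hmin w hwS) (not_le.2 c0)
        · rw [segment_symm]
          exact mem_side (u := a) (by rw [hwva]; exact hΔ) hz f0 hzt
    have k1 := key p q hd hy hv1 hv2
    have k2 := key q p (h.mem_swap hd) (by rwa [segment_symm]) hv2 hv1
    obtain ⟨t, t0, t1, rfl⟩ := mem_seg.1 hy
    rw [kcr_ip] at hC
    nlinarith
  have hAw : kcr κ w v u = kcr κ v u w := by rw [← kcr_rot]
  have huw : u = w ∨ 0 < kcr κ v u w := by
    rcases hAu0.eq_or_lt with h0 | h0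
    · left
      have : u ∈ segment ℝ w v := mem_side (u := a) (by rw [hwva]; exact hΔ) h0.symm hut.1 hut.2.1
      rw [segment_symm] at this
      exact (h.vert_mem_seg huV hvw this).resolve_left huv
    · right; rwa [← hAw]
  refine ⟨u, huV, hut, hua, hBu, hAu, fun z hz hzt h1 h2 => hmin z ((hmS z).2 ⟨hz, hzt, h1, h2⟩),
    huw, ?_, ?_, ?_⟩
  · rintro z ⟨z1, z2, z3⟩
    refine hU z z1 ?_ z2
    have := kcr_bary κ w v v a u z
    rw [kcr_right, hwva] at this
    have h1 : 0 < kcr κ v a u * kcr κ w v z := by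
      rw [this]
      have := mul_pos z3 hΔ
      have := mul_nonneg z1.le hAu0
      linarith
    exact pos_of_mul_pos_right h1 hBu.le
  · intro hne z hz
    obtain ⟨t, t0, t1, rfl⟩ := mem_oseg.1 hz
    have h0 : 0 < kcr κ w v u := by rw [hAw]; exact huw.resolve_left hne
    refine hU _ ?_ ?_ ?_
    · rw [kcr_ip, kcr_left]; nlinarith
    · rw [kcr_ip, kcr_right]; nlinarith
    · rw [kcr_ip, kcr_right, kcr_rot]; nlinarith
  · rintro hau z hz ⟨⟨p, q⟩, hd, hzs⟩
    simp only at hzs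
    have hnV : ∀ m, 0 < m → m < 1 → ip a u m ∉ V := by
      intro m m0 m1 hm
      have e1 : kcr κ v a (ip a u m) = m * kcr κ v a u := by rw [kcr_ip, kcr_right]; ring
      have e2 : kcr κ w v (ip a u m) = (1 - m) * kcr κ v a w + m * kcr κ w v u := by
        rw [kcr_ip, hwva]
      have e3 : kcr κ a u (ip a u m) = 0 := by rw [kcr_ip]; simp
      have p1 : 0 < kcr κ v a (ip a u m) := by rw [e1]; positivity
      have p2 : kcr κ w v u < kcr κ w v (ip a u m) := by rw [e2]; nlinarith
      have hmS' : ip a u m ∈ S := by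
        refine (hmS _).2 ⟨hm, ⟨p1.le, htri _ p1.le e3.ge, by linarith⟩, ?_, ?_⟩
        · intro e; rw [e] at p1; simp at p1
        · intro e; rw [e] at p1; simp at p1
      exact absurd (htie _ hmS' e3) (not_le.2 p2)
    obtain ⟨m, m0, m1, rfl⟩ := mem_oseg.1 hz
    have e1 : kcr κ v a (ip a u m) = m * kcr κ v a u := by rw [kcr_ip, kcr_right]; ring
    have e2 : kcr κ w v (ip a u m) = (1 - m) * kcr κ v a w + m * kcr κ w v u := by
      rw [kcr_ip, hwva]
    have e3 : kcr κ a u (ip a u m) = 0 := by rw [kcr_ip]; simp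
    have p1 : 0 < kcr κ v a (ip a u m) := by rw [e1]; positivity
    have p2 : 0 < kcr κ w v (ip a u m) := by rw [e2]; nlinarith
    have key : ∀ p q, (p, q) ∈ D → ip a u m ∈ segment ℝ p q → kcr κ a u p ≤ 0 := by
      intro p q hd hzs
      by_contra hcon
      push Not at hcon
      obtain ⟨ε1, e10, e11, s1⟩ := exists_small p1 (kcr κ v a p)
      obtain ⟨ε2, e20, e21, s2⟩ := exists_small p2 (kcr κ w v p)
      have he0 : 0 < min ε1 ε2 := lt_min e10 e20
      refine hU (ip (ip a u m) p (min ε1 ε2)) ?_ ?_ ?_ ⟨(p, q), hd, ?_⟩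
      · rw [kcr_ip]; exact s1 _ he0.le (min_le_left _ _)
      · rw [kcr_ip]; exact s2 _ he0.le (min_le_right _ _)
      · rw [kcr_ip, e3]; nlinarith
      · exact (convex_segment p q).segment_subset hzs (left_mem_segment ℝ p q)
          (ip_mem_seg he0.le (by linarith [min_le_left ε1 ε2]))
    have k1 := key p q hd hzs
    have k2 := key q p (h.mem_swap hd) (by rwa [segment_symm])
    obtain ⟨hpV, hqV⟩ := h.verts _ hd
    simp only at hpV hqV
    obtain ⟨t, t0, t1, ht⟩ := mem_seg.1 hzs
    have t0' : 0 < t := by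
      refine lt_of_le_of_ne t0 fun e => hnV m m0 m1 ?_
      rw [ht, ← e, ip_zero]; exact hpV
    have t1' : t < 1 := by
      refine lt_of_le_of_ne t1 fun e => hnV m m0 m1 ?_
      rw [ht, e, ip_one]; exact hqV
    have e4 : (1 - t) * kcr κ a u p + t * kcr κ a u q = 0 := by rw [← kcr_ip, ← ht, e3]
    have kp : kcr κ a u p = 0 := by nlinarith
    have kq : kcr κ a u q = 0 := by nlinarith
    obtain ⟨r, rfl⟩ := exists_ip_of_cr hua.symm (kcr_eq_zero_iff.1 kp)
    obtain ⟨s, rfl⟩ := exists_ip_of_cr hua.symm (kcr_eq_zero_iff.1 kq)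
    rw [ip_ip_ip] at ht
    have hm := ip_inj hua.symm ht
    have aux : ∀ r s t : ℝ, 0 < t → t < 1 → 0 < r + t * (s - r) → r + t * (s - r) < 1 →
        (ip a u r, ip a u s) ∈ D → r = 0 ∨ r = 1 := by
      intro r s t t0 t1 h0 h1 hd
      have hrV := (h.verts _ hd).1
      exact ordered_param t0 t1 h0 h1
        (h.param_notBetween (m := 0) (by rw [ip_zero]; exact haV) hd)
        (h.param_notBetween (m := 1) (by rw [ip_one]; exact huV) hd)
        fun hr => hnV r hr.1 hr.2 hrV
    have ar := aux r s t t0' t1' (by linarith) (by linarith) hd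
    have as := aux s r (1 - t) (by linarith) (by linarith) (by linarith) (by linarith)
      (h.mem_swap hd)
    rcases ar with rfl | rfl <;> rcases as with rfl | rfl
    · exact h.ne _ hd rfl
    · rw [ip_zero, ip_one] at hd; exact hau hd
    · rw [ip_zero, ip_one] at hd; exact hau (h.mem_swap hd)
    · exact h.ne _ hd rfl

end St

lemma seg_cr_zero {κ : Bool} {p q z : Pt} (hz : z ∈ segment ℝ p q) : kcr κ p q z = 0 := by
  obtain ⟨t, -, -, rfl⟩ := mem_seg.1 hz
  rw [kcr_ip]; simp

lemma chi_eq_one_of_iff {O T : Finset (Pt × Pt)} {κ : Bool} {p q : Pt}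
    (e : (p, q) ∈ T ↔ (q, p) ∈ T) (h1 : (p, q) ∉ O) (h2 : (q, p) ∉ O) :
    chi O T (kd κ p q) = 1 := by
  rcases κ with _ | _
  · change chi O T (q, p) = 1
    simp only [chi, Prod.swap_prod_mk, if_neg h1, if_neg h2, if_pos e.symm]
  · change chi O T (p, q) = 1
    simp only [chi, Prod.swap_prod_mk, if_neg h1, if_neg h2, if_pos e]

lemma chi_eq_neg_one_of_not_iff {O T : Finset (Pt × Pt)} {κ : Bool} {p q : Pt}
    (e : ¬ ((p, q) ∈ T ↔ (q, p) ∈ T)) (h1 : (p, q) ∉ O) (h2 : (q, p) ∉ O) :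
    chi O T (kd κ p q) = -1 := by
  have e' : ¬ ((q, p) ∈ T ↔ (p, q) ∈ T) := fun h => e h.symm
  rcases κ with _ | _
  · change chi O T (q, p) = -1
    simp only [chi, Prod.swap_prod_mk, if_neg h1, if_neg h2, if_neg e']
  · change chi O T (p, q) = -1
    simp only [chi, Prod.swap_prod_mk, if_neg h1, if_neg h2, if_neg e]

lemma not_iff_symmDiff {T S : Finset (Pt × Pt)} {κ : Bool} {p q : Pt}
    (e : (p, q) ∈ T ↔ (q, p) ∈ T) (h1 : kd κ p q ∉ S) (h2 : kd κ q p ∈ S) :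
    ¬ ((p, q) ∈ symmDiff T S ↔ (q, p) ∈ symmDiff T S) := by
  cases κ <;> simp only [kd, if_true, if_false, Bool.false_eq_true] at h1 h2 <;> simp only [mem_symmDiff, h1, h2] <;> tauto

lemma kd_notMem_tri {κ : Bool} {v a u : Pt} (h1 : v ≠ a) (h2 : a ≠ u) (h3 : u ≠ v) :
    kd κ v u ∉ ({kd κ v a, kd κ a u, kd κ u v} : Finset (Pt × Pt)) ∧
    kd κ u a ∉ ({kd κ v a, kd κ a u, kd κ u v} : Finset (Pt × Pt)) := by
  cases κ <;>
    simp only [kd, if_true, if_false, Bool.false_eq_true, mem_insert, mem_singleton, Prod.mk.injEq, not_or, not_and] <;>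
    refine ⟨⟨?_, ?_, ?_⟩, ?_, ?_, ?_⟩ <;> tauto

namespace St

variable {V : Finset Pt} {O D T : Finset (Pt × Pt)} {X : Set Pt} {c : Pt → Pt → ℝ}

lemma add_opt (h : St V O D T X) (c : Pt → Pt → ℝ) {p q : Pt} (hp : p ∈ V) (hq : q ∈ V)
    (hne : p ≠ q) (hfree : (p, q) ∉ D → ∀ z ∈ openSegment ℝ p q, z ∉ carrier D) :
    ∃ D' T', St V O D' T' X ∧ D ⊆ D' ∧ (∀ d ∈ D', d ∈ D ∨ d = (p, q) ∨ d = (q, p)) ∧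
      (p, q) ∈ D' ∧ (∀ d ∈ D, d ∈ T' ↔ d ∈ T) ∧ cost c O D' T' = cost c O D T ∧
      ((p, q) ∉ D → ((p, q) ∈ T' ↔ (q, p) ∈ T') ∧ (p, q) ∉ O ∧ (q, p) ∉ O) := by
  by_cases hpq : (p, q) ∈ D
  · exact ⟨D, T, h, Subset.refl _, fun d hd => Or.inl hd, hpq, fun _ _ => Iff.rfl, rfl,
      fun hh => absurd hpq hh⟩
  · obtain ⟨T', h', h1, h2⟩ := h.add hp hq hne hpq (hfree hpq)
    refine ⟨_, T', h', ?_, ?_, by simp, h1, h.add_cost hpq h1 h2, fun _ => ⟨h2, ?_, ?_⟩⟩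
    · intro d hd; simp [hd]
    · intro d hd; simp only [mem_insert] at hd; tauto
    · exact fun hh => hpq (h.sub hh)
    · exact fun hh => hpq (h.mem_swap (h.sub hh))

lemma step (h : St V O D T X) (hc : CostFn c) {κ : Bool} {v a w : Pt} (hva : (v, a) ∈ D)
    (hvw : (v, w) ∈ D) (hΔ : 0 < kcr κ v a w)
    (hcone : ∀ b, (v, b) ∈ D → 0 < kcr κ v a b → kcr κ v b w ≤ 0) :
    ∃ u ∈ V, u ∈ ctri κ v a w ∧ u ≠ a ∧ u ≠ v ∧ 0 < kcr κ v a u ∧ kcr κ w v u < kcr κ v a w ∧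
      (∀ z ∈ V, z ∈ ctri κ v a w → z ≠ v → z ≠ a → kcr κ a u z ≤ 0) ∧
      (u = w ∨ 0 < kcr κ v u w) ∧
      (∀ z ∈ otri κ v a u, z ∉ carrier D) ∧
      ∃ D' T' X', St V O D' T' X' ∧ D ⊆ D' ∧ (v, u) ∈ D' ∧ (u, a) ∈ D' ∧
        (∀ d ∈ D', d ∈ D ∨ d = (a, u) ∨ d = (u, a) ∨ d = (v, u) ∨ d = (u, v)) ∧
        (∀ d ∈ D, d ≠ (v, a) → d ≠ (a, v) → d ≠ (a, u) → d ≠ (u, a) → d ≠ (v, u) → d ≠ (u, v) →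
          (d ∈ T' ↔ d ∈ T)) ∧
        (u ≠ w → chi O T' (kd κ v u) = -1) ∧
        ((a, u) ∉ D → chi O T' (kd κ u a) = -1) ∧
        cost c O D' T' = cost c O D T + chi O T (kd κ v a) * c v a
          + (if (a, u) ∈ D then chi O T (kd κ a u) else 1) * c a u
          + (if u = w then chi O T (kd κ w v) else 1) * c v u := by
  obtain ⟨u, huV, hut, hua, hBu, hAu, hmin, huw, hfree, hfvu, hfau⟩ :=
    h.exists_tri hva hvw hΔ hcone
  have hvV := (h.verts _ hva).1
  have haV := (h.verts _ hva).2
  have hne_va : v ≠ a := h.ne _ hva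
  have huv : u ≠ v := by rintro rfl; simp at hBu
  refine ⟨u, huV, hut, hua, huv, hBu, hAu, hmin, huw, hfree, ?_⟩
  obtain ⟨D1, T1, h1, hs1, hD1, hau1, hT1, hc1, hn1⟩ := h.add_opt c haV huV hua.symm hfau
  have hnotin : u ≠ w → (v, u) ∉ D := by
    intro hne hvu
    have := hcone u hvu hBu
    rcases huw with h' | h'
    · exact hne h'
    · linarith
  have hvu1 : u ≠ w → (v, u) ∉ D1 := by
    intro hne hd
    rcases hD1 _ hd with h' | h' | h'
    · exact hnotin hne h'
    · exact hne_va (Prod.ext_iff.1 h').1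
    · exact huv (Prod.ext_iff.1 h').1.symm
  have hauv : 0 < kcr κ a u v := by rw [kcr_rot]; exact hBu
  have hcar1 : ∀ z, 0 < kcr κ a u z → z ∉ carrier D → z ∉ carrier D1 := by
    rintro z hz hz' ⟨d, hd, hzd⟩
    rcases hD1 d hd with h' | rfl | rfl
    · exact hz' ⟨d, h', hzd⟩
    · have := seg_cr_zero (κ := κ) hzd; simp only at this; linarith
    · rw [segment_symm] at hzd
      have := seg_cr_zero (κ := κ) hzd; simp only at this; linarith
  have hf1 : (v, u) ∉ D1 → ∀ z ∈ openSegment ℝ v u, z ∉ carrier D1 := by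
    intro hd z hz
    have hne : u ≠ w := by rintro rfl; exact hd (hs1 hvw)
    refine hcar1 z ?_ (hfvu hne z hz)
    obtain ⟨t, t0, t1, rfl⟩ := mem_oseg.1 hz
    rw [kcr_ip, kcr_right]; nlinarith
  obtain ⟨D2, T2, h2, hs2, hD2, hvu2, hT2, hc2, hn2⟩ := h1.add_opt c hvV huV huv.symm hf1
  have hfree2 : ∀ z ∈ otri κ v a u, z ∉ carrier D2 := by
    rintro z hz ⟨d, hd, hzd⟩
    have hzu : kcr κ v u z < 0 := by
      have := hz.2.2; rw [kcr_swap] at this; linarith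
    rcases hD2 d hd with h' | rfl | rfl
    · exact hcar1 z hz.2.1 (hfree z hz) ⟨d, h', hzd⟩
    · have := seg_cr_zero (κ := κ) hzd; simp only at this; linarith
    · rw [segment_symm] at hzd
      have := seg_cr_zero (κ := κ) hzd; simp only at this; linarith
  have d1 : (v, a) ∈ D2 := hs2 (hs1 hva)
  have d2 : (a, u) ∈ D2 := hs2 hau1
  have d3 : (u, v) ∈ D2 := h2.mem_swap hvu2
  have h3 := h2.toggle (κ := κ) hBu d1 d2 d3 hfree2
  have hcost := cost_toggle_three hc.symm h2.asym h2.symm hne_va hua.symm huv (h2.kd_mem κ d1)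
    (h2.kd_mem κ d2) (h2.kd_mem κ d3) (T := T2)
  have hT12 : ∀ d ∈ D, d ∈ T2 ↔ d ∈ T := fun d hd => (hT2 d (hs1 hd)).trans (hT1 d hd)
  have hchi : ∀ p q, (p, q) ∈ D → chi O T2 (kd κ p q) = chi O T (kd κ p q) := by
    intro p q hd
    refine chi_congr (hT12 _ (h.kd_mem κ hd)) (hT12 _ ?_)
    rw [kd_swap]; exact h.kd_mem κ (h.mem_swap hd)
  refine ⟨D2, _, _, h3, hs1.trans hs2, hvu2, h2.mem_swap d2, ?_, ?_, ?_, ?_, ?_⟩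
  · intro d hd
    rcases hD2 d hd with h' | h' | h'
    · rcases hD1 d h' with h' | h' | h'
      · exact Or.inl h'
      · exact Or.inr (Or.inl h')
      · exact Or.inr (Or.inr (Or.inl h'))
    · exact Or.inr (Or.inr (Or.inr (Or.inl h')))
    · exact Or.inr (Or.inr (Or.inr (Or.inr h')))
  · intro d hd n1 n2 n3 n4 n5 n6
    have : d ∉ ({kd κ v a, kd κ a u, kd κ u v} : Finset (Pt × Pt)) := by
      cases κ <;> simp [kd, n1, n2, n3, n4, n5, n6]
    rw [mem_symmDiff]
    simp only [this, not_false_iff, and_true, false_and, or_false]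
    exact hT12 d hd
  · intro hne
    obtain ⟨e1, e2, e3⟩ := hn2 (hvu1 hne)
    exact chi_eq_neg_one_of_not_iff (not_iff_symmDiff e1 (kd_notMem_tri hne_va hua.symm huv).1
      (by simp)) e2 e3
  · intro hne
    obtain ⟨e1, e2, e3⟩ := hn1 hne
    have e1 : (a, u) ∈ T2 ↔ (u, a) ∈ T2 := by
      rw [hT2 _ hau1, hT2 _ (h1.mem_swap hau1)]; exact e1
    exact chi_eq_neg_one_of_not_iff (not_iff_symmDiff e1.symm
      (kd_notMem_tri hne_va hua.symm huv).2 (by simp)) e3 e2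
  · rw [hcost, hc2, hc1, hchi v a hva, hc.symm u v]
    have x1 : chi O T2 (kd κ a u) = if (a, u) ∈ D then chi O T (kd κ a u) else 1 := by
      split_ifs with hd
      · exact hchi a u hd
      · obtain ⟨e1, e2, e3⟩ := hn1 hd
        refine chi_eq_one_of_iff ?_ e2 e3
        rw [hT2 _ hau1, hT2 _ (h1.mem_swap hau1)]; exact e1
    have x2 : chi O T2 (kd κ u v) = if u = w then chi O T (kd κ w v) else 1 := by
      split_ifs with hd
      · rw [hd]; exact hchi w v (h.mem_swap hvw)
      · obtain ⟨e1, e2, e3⟩ := hn2 (hvu1 hd)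
        exact chi_eq_one_of_iff e1.symm e3 e2
    rw [x1, x2]

/-- Filling an empty sector by triangles, with control on the cost. -/
lemma chain (hc : CostFn c) {κ : Bool} {v w : Pt} : ∀ (N : ℕ) (D T : Finset (Pt × Pt)) (X : Set Pt)
    (a : Pt) (τ : ℝ), St V O D T X → (v, a) ∈ D → (v, w) ∈ D → 0 < kcr κ v a w →
    (∀ b, (v, b) ∈ D → 0 < kcr κ v a b → kcr κ v b w ≤ 0) → 0 ≤ τ → τ ≤ 1 →
    (∀ z ∈ V, z ∈ ctri κ v a w → z ≠ v → z ≠ a →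
      τ * kcr κ v a w ≤ τ * kcr κ w v z + kcr κ v a z) →
    (V.filter fun z => z ∈ ctri κ v a w).card ≤ N →
    ∃ D' T' X', St V O D' T' X' ∧ cost c O D' T' ≤ cost c O D T + chi O T (kd κ v a) * c v a
        + chi O T (kd κ w v) * c w v + c a (ip v w τ) + c (ip v w τ) w ∧ D ⊆ D' ∧
      (∀ d ∈ D', d ∈ D ∨ (d.1 ∈ ctri κ v a w ∧ d.2 ∈ ctri κ v a w)) ∧
      (∀ d ∈ D, ¬ (d.1 ∈ ctri κ v a w ∧ d.2 ∈ ctri κ v a w) → (d ∈ T' ↔ d ∈ T)) := by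
  intro N
  induction N with
  | zero =>
    intro D T X a τ h hva hvw hΔ hcone τ0 τ1 hτ hN
    exfalso
    have hv : v ∈ V.filter fun z => z ∈ ctri κ v a w := by
      rw [mem_filter]
      refine ⟨(h.verts _ hva).1, by simp, ?_, by simp⟩
      rw [kcr_rot]; exact hΔ.le
    rw [Nat.le_zero, card_eq_zero] at hN
    rw [hN] at hv; simp at hv
  | succ N ih =>
    intro D T X a τ h hva hvw hΔ hcone τ0 τ1 hτ hN
    obtain ⟨u, huV, hut, hua, huv, hBu, hAu, hmin, huw, hfree, D1, T1, X1, h1, hs1, hvu1, -, hD1,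
      hT1, hchi1, -, hcost1⟩ := h.step hc hva hvw hΔ hcone
    have hvt : v ∈ ctri κ v a w := ⟨by simp, by rw [kcr_rot]; exact hΔ.le, by simp⟩
    have hat : a ∈ ctri κ v a w := ⟨by simp, by simp, by rw [kcr_rot, kcr_rot]; exact hΔ.le⟩
    have hlab : ∀ d ∈ D, ¬ (d.1 ∈ ctri κ v a w ∧ d.2 ∈ ctri κ v a w) → (d ∈ T1 ↔ d ∈ T) := by
      intro d hd hn
      apply hT1 d hd <;> rintro rfl <;> apply hn <;> constructor <;> assumption
    have hmem : ∀ d ∈ D1, d ∈ D ∨ (d.1 ∈ ctri κ v a w ∧ d.2 ∈ ctri κ v a w) := by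
      intro d hd
      rcases hD1 d hd with h' | rfl | rfl | rfl | rfl
      · exact Or.inl h'
      all_goals right; constructor <;> assumption
    have hau_le : (if (a, u) ∈ D then chi O T (kd κ a u) else 1) * c a u ≤ c a u := by
      have : (if (a, u) ∈ D then chi O T (kd κ a u) else 1) ≤ 1 := by
        split_ifs
        · exact chi_le_one _ _ _
        · exact le_rfl
      nlinarith [hc.nonneg a u]
    by_cases huw' : u = w
    · subst huw'
      refine ⟨D1, T1, X1, h1, ?_, hs1, hmem, hlab⟩
      rw [hcost1, if_pos (rfl : u = u), hc.symm v u]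
      have := hc.tri a (ip v u τ) u
      linarith
    · have hΔ' : 0 < kcr κ v u w := huw.resolve_left huw'
      have hAw : kcr κ w v u = kcr κ v u w := by rw [← kcr_rot]
      have hne_va : v ≠ a := h.ne _ hva
      have hden : 0 < kcr κ v a w - kcr κ w v u := by linarith
      set τ' := kcr κ v a u / (kcr κ v a w - kcr κ w v u) with hτ'
      have hτe : τ' * (kcr κ v a w - kcr κ w v u) = kcr κ v a u := div_mul_cancel₀ _ hden.ne'
      have hτ'0 : 0 ≤ τ' := by positivity
      have hτ'1 : τ' ≤ 1 := by
        rw [hτ', div_le_one hden]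
        have := kcr_sum κ v a w u
        linarith [hut.2.1]
      have hττ : τ ≤ τ' := by
        rw [hτ', le_div_iff₀ hden]
        have := hτ u huV hut huv hua
        linarith
      have hsubt : ∀ z, z ∈ ctri κ v u w → z ∈ ctri κ v a w := by
        rintro z ⟨z1, z2, z3⟩
        refine ⟨?_, ?_, z3⟩
        · have := kcr_bary κ v a v u w z
          rw [kcr_left] at this
          have : 0 ≤ kcr κ v u w * kcr κ v a z := by
            rw [this]
            have := mul_nonneg z3 hBu.le
            have := mul_nonneg z1 hΔ.le
            linarith
          exact nonneg_of_mul_nonneg_right this hΔ'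
        · have := kcr_bary κ a w v u w z
          have e : kcr κ a w v = kcr κ v a w := by rw [kcr_rot]
          rw [kcr_right, e] at this
          have : 0 ≤ kcr κ v u w * kcr κ a w z := by
            rw [this]
            have := mul_nonneg z2 hΔ.le
            have := mul_nonneg z3 hut.2.1
            linarith
          exact nonneg_of_mul_nonneg_right this hΔ'
      have hanot : a ∉ ctri κ v u w := by
        intro hh
        have := hh.1
        rw [kcr_swap'] at this
        linarith
      have hcone' : ∀ b, (v, b) ∈ D1 → 0 < kcr κ v u b → kcr κ v b w ≤ 0 := by
        intro b hb hub
        rcases hD1 _ hb with h' | h' | h' | h' | h'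
        · by_contra hcon
          push Not at hcon
          have hp := kcr_pluecker κ v a u b w
          have : 0 < kcr κ v a b * kcr κ v u w := by
            have := mul_pos hBu hcon
            have := mul_pos hΔ hub
            linarith
          have := hcone b h' (pos_of_mul_pos_left this hΔ'.le)
          linarith
        · exact absurd (Prod.ext_iff.1 h').1 hne_va
        · exact absurd (Prod.ext_iff.1 h').1.symm huv
        · have : b = u := (Prod.ext_iff.1 h').2
          subst this; simp at hub
        · exact absurd (Prod.ext_iff.1 h').1.symm huv
      have hτt : ∀ z ∈ V, z ∈ ctri κ v u w → z ≠ v → z ≠ u →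
          τ' * kcr κ v u w ≤ τ' * kcr κ w v z + kcr κ v u z := by
        intro z hz hzt h1 h2
        have hza : z ≠ a := by rintro rfl; exact hanot hzt
        have hm := hmin z hz (hsubt z hzt) h1 hza
        have hid : kcr κ v a w * kcr κ a u z = kcr κ v a w * kcr κ v a u -
            (kcr κ v a u * kcr κ w v z + (kcr κ v a w - kcr κ w v u) * kcr κ v a z) := by
          simp only [kcr, cr]; ring
        have hid2 : kcr κ v a w * kcr κ v u z = kcr κ w v u * kcr κ v a z
            - kcr κ v a u * kcr κ w v z := by
          simp only [kcr, cr]; ring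
        have h3 : kcr κ v a w * kcr κ a u z ≤ 0 := mul_nonpos_of_nonneg_of_nonpos hΔ.le hm
        rw [hid] at h3
        rw [← hAw]
        have hAu0 : 0 < kcr κ w v u := by rw [hAw]; exact hΔ'
        have h4 := mul_nonneg hAu0.le (neg_nonneg.2 h3)
        have h5 : (kcr κ v a w - kcr κ w v u) * kcr κ v a w *
            (τ' * kcr κ w v z + kcr κ v u z - τ' * kcr κ w v u) =
            kcr κ v a w * (τ' * (kcr κ v a w - kcr κ w v u)) * (kcr κ w v z - kcr κ w v u)
            + (kcr κ v a w - kcr κ w v u) * (kcr κ v a w * kcr κ v u z) := by ring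
        rw [hτe, hid2] at h5
        have h6 : 0 ≤ (kcr κ v a w - kcr κ w v u) * kcr κ v a w *
            (τ' * kcr κ w v z + kcr κ v u z - τ' * kcr κ w v u) := by
          rw [h5]; linarith
        have := nonneg_of_mul_nonneg_right h6 (mul_pos hden hΔ)
        linarith
      have hcard : (V.filter fun z => z ∈ ctri κ v u w).card ≤ N := by
        have : (V.filter fun z => z ∈ ctri κ v u w) ⊂ V.filter fun z => z ∈ ctri κ v a w := by
          rw [Finset.ssubset_iff_of_subset]
          · refine ⟨a, ?_, ?_⟩
            · rw [mem_filter]; exact ⟨(h.verts _ hva).2, hat⟩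
            · rw [mem_filter]; exact fun hh => hanot hh.2
          · intro z hz
            rw [mem_filter] at hz ⊢
            exact ⟨hz.1, hsubt z hz.2⟩
        have := Finset.card_lt_card this
        omega
      obtain ⟨D2, T2, X2, h2, hcost2, hs2, hD2, hT2⟩ := ih D1 T1 X1 u τ' h1 hvu1 (hs1 hvw) hΔ'
        hcone' hτ'0 hτ'1 hτt hcard
      refine ⟨D2, T2, X2, h2, ?_, hs1.trans hs2, ?_, ?_⟩
      · have hw1 : w ≠ a := by rintro rfl; simp at hΔ
        have hwv : w ≠ v := (h.ne _ hvw).symm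
        have hkw : ∀ d, d = (w, v) ∨ d = (v, w) → (d ∈ T1 ↔ d ∈ T) := by
          rintro d (rfl | rfl)
          · apply hT1 _ (h.mem_swap hvw) <;> simp [hw1, hwv, Ne.symm huw', hne_va]
          · apply hT1 _ hvw <;> simp [hw1, hwv, Ne.symm huw', hne_va, huv.symm]
        have hchiw : chi O T1 (kd κ w v) = chi O T (kd κ w v) := by
          refine chi_congr (hkw _ (kd_cases κ w v)) (hkw _ ?_)
          rw [kd_swap]; exact (kd_cases κ v w).symm
        rw [hchi1 huw', hchiw, hcost1, if_neg huw'] at hcost2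
        have b1 : c a (ip v w τ') = c a u + c u (ip v w τ') := by
          apply hc.between
          refine mem_seg.2 ⟨(kcr κ v a w - kcr κ w v u) / kcr κ v a w, by positivity, ?_, ?_⟩
          · rw [div_le_one hΔ]; linarith [hut.2.2]
          · obtain ⟨b1, b2⟩ := bary κ v a w u
            have hs := kcr_sum κ v a w u
            have hne := hΔ.ne'
            have e1 : kcr κ a w u = kcr κ v a w - kcr κ v a u - kcr κ w v u := by linarith
            have hc' : (kcr κ v a w - kcr κ w v u) / kcr κ v a w * τ' =
                kcr κ v a u / kcr κ v a w := by
              rw [hτ']; field_simp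
            rw [e1] at b1 b2
            ext
            · have : (ip a (ip v w τ') ((kcr κ v a w - kcr κ w v u) / kcr κ v a w)).1 =
                  a.1 + (kcr κ v a w - kcr κ w v u) / kcr κ v a w * (v.1 - a.1) +
                  (kcr κ v a w - kcr κ w v u) / kcr κ v a w * τ' * (w.1 - v.1) := by
                simp only [ip]; ring
              rw [this, hc']
              field_simp
              linarith
            · have : (ip a (ip v w τ') ((kcr κ v a w - kcr κ w v u) / kcr κ v a w)).2 =
                  a.2 + (kcr κ v a w - kcr κ w v u) / kcr κ v a w * (v.2 - a.2) +
                  (kcr κ v a w - kcr κ w v u) / kcr κ v a w * τ' * (w.2 - v.2) := by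
                simp only [ip]; ring
              rw [this, hc']
              field_simp
              linarith
        have b2 := hc.tri a (ip v w τ) (ip v w τ')
        have b3 : c (ip v w τ) w = c (ip v w τ) (ip v w τ') + c (ip v w τ') w := by
          apply hc.between
          rcases hττ.eq_or_lt with e | hlt
          · rw [e]; exact left_mem_segment ℝ _ _
          · have : 0 < 1 - τ := by linarith
            refine mem_seg.2 ⟨(τ' - τ) / (1 - τ), div_nonneg (by linarith) this.le, ?_, ?_⟩
            · rw [div_le_one this]; linarith
            · rw [ip_ip_right, div_mul_cancel₀ _ this.ne']; congr 1; ring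
        linarith
      · intro d hd
        rcases hD2 d hd with h' | h'
        · exact hmem d h'
        · exact Or.inr ⟨hsubt _ h'.1, hsubt _ h'.2⟩
      · intro d hd hn
        rw [hT2 d (hs1 hd) fun hh => hn ⟨hsubt _ hh.1, hsubt _ hh.2⟩]
        exact hlab d hd hn

end St

lemma exists_pos_le_of_forall {α : Type*} (s : Finset α) (f : α → ℝ) (h : ∀ z ∈ s, 0 < f z) :
    ∃ ε : ℝ, 0 < ε ∧ ε ≤ 1 ∧ ∀ z ∈ s, ε ≤ f z := by
  induction s using Finset.induction_on with
  | empty => exact ⟨1, by simp⟩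
  | insert a s _ ih =>
    obtain ⟨ε, h0, h1, h2⟩ := ih fun z hz => h z (mem_insert_of_mem hz)
    refine ⟨min ε (f a), lt_min h0 (h a (mem_insert_self _ _)), (min_le_left _ _).trans h1, ?_⟩
    intro z hz
    rcases mem_insert.1 hz with rfl | hz
    · exact min_le_right _ _
    · exact (min_le_left _ _).trans (h2 z hz)

namespace St

variable {V : Finset Pt} {O D T : Finset (Pt × Pt)} {X : Set Pt} {c : Pt → Pt → ℝ}

/-- Filling an empty sector: the cost bound at a point of the side `v w` close to `v`. -/
lemma chain_small (h : St V O D T X) (hc : CostFn c) {κ : Bool} {v a w : Pt} (hva : (v, a) ∈ D)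
    (hvw : (v, w) ∈ D) (hΔ : 0 < kcr κ v a w)
    (hcone : ∀ b, (v, b) ∈ D → 0 < kcr κ v a b → kcr κ v b w ≤ 0) :
    ∃ τ, 0 < τ ∧ τ ≤ 1 ∧ ∃ D' T' X', St V O D' T' X' ∧
      cost c O D' T' ≤ cost c O D T + chi O T (kd κ v a) * c v a
        + chi O T (kd κ w v) * c w v + c a (ip v w τ) + c (ip v w τ) w ∧ D ⊆ D' ∧
      (∀ d ∈ D', d ∈ D ∨ (d.1 ∈ ctri κ v a w ∧ d.2 ∈ ctri κ v a w)) ∧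
      (∀ d ∈ D, ¬ (d.1 ∈ ctri κ v a w ∧ d.2 ∈ ctri κ v a w) → (d ∈ T' ↔ d ∈ T)) := by
  obtain ⟨ε, h0, h1, h2⟩ := exists_pos_le_of_forall
    (V.filter fun z => z ∈ ctri κ v a w ∧ z ≠ v ∧ z ≠ a) (fun z => kcr κ v a z / kcr κ v a w) (by
      intro z hz
      rw [mem_filter] at hz
      obtain ⟨hzV, hzt, hzv, hza⟩ := hz
      refine div_pos (hzt.1.lt_of_ne fun e => ?_) hΔ
      rcases h.vert_mem_seg hzV hva (mem_side hΔ e.symm hzt.2.1 hzt.2.2) with e | e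
      · exact hzv e
      · exact hza e)
  refine ⟨ε, h0, h1, chain hc _ D T X a ε h hva hvw hΔ hcone h0.le h1 ?_ le_rfl⟩
  intro z hz hzt hzv hza
  have := h2 z (by rw [mem_filter]; exact ⟨hz, hzt, hzv, hza⟩)
  rw [le_div_iff₀ hΔ] at this
  have := mul_nonneg h0.le hzt.2.2
  linarith

lemma exists_cost_lt (h : St V O D T X) (hc : CostFn c) {κ : Bool} {v a w : Pt} (hva : (v, a) ∈ D)
    (hvw : (v, w) ∈ D) (hΔ : 0 < kcr κ v a w)
    (hcone : ∀ b, (v, b) ∈ D → 0 < kcr κ v a b → kcr κ v b w ≤ 0)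
    (ha : chi O T (kd κ v a) = -1) (hw : chi O T (kd κ w v) = -1) :
    ∃ D' T' X', St V O D' T' X' ∧ cost c O D' T' < cost c O D T := by
  obtain ⟨τ, h0, h1, D', T', X', h', hcost, -⟩ := h.chain_small hc hva hvw hΔ hcone
  refine ⟨D', T', X', h', hcost.trans_lt ?_⟩
  rw [ha, hw]
  have b1 := hc.between v (ip v w τ) w (ip_mem_seg h0.le h1)
  have b2 := hc.strict a v (ip v w τ) (by
    have : kcr κ a v (ip v w τ) ≠ 0 := by
      rw [kcr_ip, kcr_right, kcr_swap]
      have := mul_pos h0 hΔ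
      linarith
    exact fun hh => this (kcr_eq_zero_iff.2 hh))
  have b3 := hc.symm v a
  have b4 := hc.symm v w
  linarith

lemma ray_unique (h : St V O D T X) {v a : Pt} {s : ℝ} (hs : 0 < s) (h1 : (v, a) ∈ D)
    (h2 : (v, ip v a s) ∈ D) : s = 1 := by
  have key : ∀ {v a : Pt} {s : ℝ}, 1 < s → (v, a) ∈ D → (v, ip v a s) ∈ D → False := by
    intro v a s hs h1 h2
    apply h.vert_notMem (h.verts _ h1).2 h2
    refine mem_oseg.2 ⟨s⁻¹, by positivity, inv_lt_one_of_one_lt₀ hs, ?_⟩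
    rw [ip_ip, inv_mul_cancel₀ (by positivity), ip_one]
  rcases lt_trichotomy s 1 with hlt | rfl | hlt
  · exfalso
    refine key (s := s⁻¹) ((one_lt_inv₀ hs).2 hlt) h2 ?_
    rw [ip_ip, inv_mul_cancel₀ hs.ne', ip_one]; exact h1
  · rfl
  · exact (key hlt h1 h2).elim

end St

/-- A drawing of minimal cost and, subject to that, with as few darts as possible. -/
structure MinSt (c : Pt → Pt → ℝ) (V : Finset Pt) (O D T : Finset (Pt × Pt)) (X : Set Pt) :
    Prop where
  st : St V O D T X
  cost_le : ∀ D' T' X', St V O D' T' X' → cost c O D T ≤ cost c O D' T'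
  card_le : ∀ D' T' X', St V O D' T' X' → cost c O D' T' = cost c O D T → D.card ≤ D'.card

lemma St.exists_minSt {V : Finset Pt} {O D T : Finset (Pt × Pt)} {X : Set Pt}
    (h : St V O D T X) (c : Pt → Pt → ℝ) :
    ∃ D' T' X', MinSt c V O D' T' X' ∧ cost c O D' T' ≤ cost c O D T := by
  let S := ((V ×ˢ V).powerset ×ˢ (V ×ˢ V).powerset).filter fun p => ∃ X', St V O p.1 p.2 X'
  have hS : ∀ D' T' X', St V O D' T' X' → (D', T') ∈ S := by
    intro D' T' X' h'
    have hD : D' ⊆ V ×ˢ V := fun d hd => mem_product.2 (h'.verts d hd)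
    rw [mem_filter, mem_product]
    exact ⟨⟨mem_powerset.2 hD, mem_powerset.2 (h'.tsub.trans hD)⟩, X', h'⟩
  obtain ⟨p, hp, hmin⟩ := S.exists_min_image (fun p => toLex (cost c O p.1 p.2, p.1.card))
    ⟨_, hS _ _ _ h⟩
  obtain ⟨X', hX'⟩ := (mem_filter.1 hp).2
  have hle : ∀ D' T' X', St V O D' T' X' → cost c O p.1 p.2 ≤ cost c O D' T' := by
    intro D' T' X' h'
    have := hmin _ (hS _ _ _ h')
    rw [Prod.Lex.toLex_le_toLex] at this
    rcases this with h1 | h1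
    · exact h1.le
    · exact h1.1.le
  refine ⟨p.1, p.2, X', ⟨hX', hle, ?_⟩, hle _ _ _ h⟩
  intro D' T' X' h' he
  have := hmin _ (hS _ _ _ h')
  rw [Prod.Lex.toLex_le_toLex] at this
  rcases this with h1 | h1
  · exact absurd he h1.ne'
  · exact h1.2

namespace MinSt

variable {V : Finset Pt} {O D T : Finset (Pt × Pt)} {X : Set Pt} {c : Pt → Pt → ℝ}

lemma jump (h : MinSt c V O D T X) {p q : Pt} (hd : (p, q) ∈ D) (h1 : (p, q) ∉ O)
    (h2 : (q, p) ∉ O) : ¬ ((p, q) ∈ T ↔ (q, p) ∈ T) := by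
  intro e
  obtain ⟨X', hX'⟩ := h.st.remove hd h1 h2 e
  have := h.card_le _ _ _ hX' (St.remove_cost h1 h2 e)
  refine absurd this (not_le.2 (Finset.card_lt_card ?_))
  rw [Finset.ssubset_iff_of_subset (filter_subset _ _)]
  exact ⟨(p, q), hd, by simp⟩

lemma chi_jump (h : MinSt c V O D T X) {p q : Pt} (κ : Bool) (hd : (p, q) ∈ D) (h1 : (p, q) ∉ O)
    (h2 : (q, p) ∉ O) : chi O T (kd κ p q) = -1 :=
  chi_eq_neg_one_of_not_iff (h.jump hd h1 h2) h1 h2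

lemma not_empty_sector (h : MinSt c V O D T X) (hc : CostFn c) {κ : Bool} {v a w : Pt}
    (hva : (v, a) ∈ D) (hvw : (v, w) ∈ D) (hΔ : 0 < kcr κ v a w)
    (hcone : ∀ b, (v, b) ∈ D → 0 < kcr κ v a b → kcr κ v b w ≤ 0)
    (ha : chi O T (kd κ v a) = -1) (hw : chi O T (kd κ w v) = -1) : False := by
  obtain ⟨D', T', X', h', hlt⟩ := h.st.exists_cost_lt hc hva hvw hΔ hcone ha hw
  exact absurd (h.cost_le _ _ _ h') (not_le.2 hlt)

lemma not_sector (h : MinSt c V O D T X) (hc : CostFn c) {κ : Bool} {v : Pt} (N : ℕ) :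
    ∀ a w, (v, a) ∈ D → (v, w) ∈ D → 0 < kcr κ v a w → (v, a) ∉ O → (a, v) ∉ O →
    (v, w) ∉ O → (w, v) ∉ O →
    (∀ b, (v, b) ∈ D → 0 < kcr κ v a b → 0 < kcr κ v b w → (v, b) ∉ O ∧ (b, v) ∉ O) →
    (V.filter fun b => (v, b) ∈ D ∧ 0 < kcr κ v a b ∧ 0 < kcr κ v b w).card ≤ N → False := by
  induction N with
  | zero =>
    intro a w ha hw hΔ a1 a2 w1 w2 hb hN
    refine h.not_empty_sector hc ha hw hΔ ?_ (h.chi_jump κ ha a1 a2)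
      (h.chi_jump κ (h.st.mem_swap hw) w2 w1)
    intro b hbD h1
    by_contra h2
    push Not at h2
    rw [Nat.le_zero, card_eq_zero] at hN
    have : b ∈ V.filter fun b => (v, b) ∈ D ∧ 0 < kcr κ v a b ∧ 0 < kcr κ v b w :=
      mem_filter.2 ⟨(h.st.verts _ hbD).2, hbD, h1, h2⟩
    rw [hN] at this; simp at this
  | succ N ih =>
    intro a w ha hw hΔ a1 a2 w1 w2 hb hN
    by_cases hcone : ∀ b, (v, b) ∈ D → 0 < kcr κ v a b → kcr κ v b w ≤ 0
    · exact h.not_empty_sector hc ha hw hΔ hcone (h.chi_jump κ ha a1 a2)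
        (h.chi_jump κ (h.st.mem_swap hw) w2 w1)
    · push Not at hcone
      obtain ⟨b, hbD, hab, hbw⟩ := hcone
      have htr : ∀ x, 0 < kcr κ v a x → 0 < kcr κ v x b → 0 < kcr κ v x w := by
        intro x h1 h2
        have hp := kcr_pluecker κ v a x b w
        have : 0 < kcr κ v a b * kcr κ v x w := by
          have := mul_pos h1 hbw
          have := mul_pos hΔ h2
          linarith
        exact pos_of_mul_pos_right this hab.le
      refine ih a b ha hbD hab a1 a2 (hb b hbD hab hbw).1 (hb b hbD hab hbw).2 ?_ ?_
      · intro x hx h1 h2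
        exact hb x hx h1 (htr x h1 h2)
      · have : (V.filter fun x => (v, x) ∈ D ∧ 0 < kcr κ v a x ∧ 0 < kcr κ v x b) ⊂
            V.filter fun x => (v, x) ∈ D ∧ 0 < kcr κ v a x ∧ 0 < kcr κ v x w := by
          rw [Finset.ssubset_iff_of_subset]
          · exact ⟨b, mem_filter.2 ⟨(h.st.verts _ hbD).2, hbD, hab, hbw⟩, by simp⟩
          · intro x hx
            rw [mem_filter] at hx ⊢
            exact ⟨hx.1, hx.2.1, hx.2.2.1, htr x hx.2.2.1 hx.2.2.2⟩
        have := Finset.card_lt_card this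
        omega

/-- If all darts on one side of the dart `(v, o)` are unoriented, there is at most one. -/
lemma side_unique (h : MinSt c V O D T X) (hc : CostFn c) {κ : Bool} {v o : Pt}
    (hO : ∀ b, (v, b) ∈ D → 0 < kcr κ v o b → (v, b) ∉ O ∧ (b, v) ∉ O) {a w : Pt}
    (ha : (v, a) ∈ D) (hw : (v, w) ∈ D) (hoa : 0 < kcr κ v o a) (how : 0 < kcr κ v o w) :
    a = w := by
  have key : ∀ a w, (v, a) ∈ D → (v, w) ∈ D → 0 < kcr κ v o a → 0 < kcr κ v o w →
      0 < kcr κ v a w → False := by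
    intro a w ha hw hoa how hΔ
    refine h.not_sector hc (κ := κ) _ a w ha hw hΔ (hO a ha hoa).1 (hO a ha hoa).2 (hO w hw how).1
      (hO w hw how).2 ?_ le_rfl
    intro b hb h1 h2
    refine hO b hb ?_
    have hp := kcr_pluecker κ v o a b w
    have : 0 < kcr κ v a w * kcr κ v o b := by
      have := mul_pos hoa h2
      have := mul_pos how h1
      linarith
    exact pos_of_mul_pos_right this hΔ.le
  rcases lt_trichotomy 0 (kcr κ v a w) with h1 | h1 | h1
  · exact (key a w ha hw hoa how h1).elim
  · obtain ⟨s, rfl⟩ := exists_ip_of_cr (h.st.ne _ ha) (kcr_eq_zero_iff.1 h1.symm)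
    have : 0 < s := by
      rw [kcr_ip, kcr_left] at how
      have : 0 < s * kcr κ v o a := by linarith
      exact pos_of_mul_pos_left this hoa.le
    rw [h.st.ray_unique this ha hw, ip_one]
  · refine (key w a hw ha how hoa ?_).elim
    rw [kcr_swap']; linarith

end MinSt

open Filter Topology in
lemma eventually_ip_mem {v p : Pt} {U : Set Pt} (hU : U ∈ 𝓝 v) :
    ∀ᶠ ε in 𝓝[>] (0 : ℝ), ip v p ε ∈ U := by
  have hc : Continuous fun ε : ℝ => ip v p ε := by unfold ip; fun_prop
  have := hc.tendsto 0
  rw [ip_zero] at this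
  exact (this.eventually hU).filter_mono nhdsWithin_le_nhds

lemma exists_kcr_pos (κ : Bool) {v a : Pt} (h : v ≠ a) : ∃ p, 0 < kcr κ v a p := by
  refine ⟨(v.1 - sg κ * (a.2 - v.2), v.2 + sg κ * (a.1 - v.1)), ?_⟩
  have e : kcr κ v a (v.1 - sg κ * (a.2 - v.2), v.2 + sg κ * (a.1 - v.1)) =
      (sg κ * sg κ) * ((a.1 - v.1) ^ 2 + (a.2 - v.2) ^ 2) := by simp only [kcr, cr]; ring
  rw [e, sg_sq, one_mul]
  by_contra hcon
  apply h
  have h1 : (a.1 - v.1) ^ 2 = 0 := by nlinarith [sq_nonneg (a.1 - v.1), sq_nonneg (a.2 - v.2)]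
  have h2 : (a.2 - v.2) ^ 2 = 0 := by nlinarith [sq_nonneg (a.1 - v.1), sq_nonneg (a.2 - v.2)]
  ext
  · linarith [pow_eq_zero_iff (two_ne_zero) |>.1 h1]
  · linarith [pow_eq_zero_iff (two_ne_zero) |>.1 h2]

namespace St

variable {V : Finset Pt} {O D T : Finset (Pt × Pt)} {X : Set Pt} {c : Pt → Pt → ℝ}

lemma exists_ball (h : St V O D T X) {v : Pt} (hv : v ∈ V) :
    ∃ r > 0, ∀ z ∈ Metric.ball v r, z ∈ carrier D → ∃ b, (v, b) ∈ D ∧ z ∈ segment ℝ v b := by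
  set E := D.filter fun d => d.1 ≠ v ∧ d.2 ≠ v with hE
  have hcl : IsClosed (carrier E) := by
    have : carrier E = ⋃ d ∈ E, segment ℝ d.1 d.2 := by
      ext z; simp [carrier]
    rw [this]
    refine E.finite_toSet.isClosed_biUnion fun d _ => ?_
    rw [← convexHull_pair]
    exact (Set.Finite.isCompact_convexHull (𝕜 := ℝ) (by simp)).isClosed
  have hvE : v ∉ carrier E := by
    rintro ⟨d, hd, hz⟩
    rw [hE, mem_filter] at hd
    rcases h.vert_mem_seg hv hd.1 hz with e | e
    · exact hd.2.1 e.symm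
    · exact hd.2.2 e.symm
  obtain ⟨r, hr, hsub⟩ := Metric.isOpen_iff.1 hcl.isOpen_compl v hvE
  refine ⟨r, hr, fun z hz ⟨d, hd, hzd⟩ => ?_⟩
  by_cases h1 : d.1 = v
  · refine ⟨d.2, ?_, ?_⟩ <;> rw [← h1] <;> assumption
  by_cases h2 : d.2 = v
  · refine ⟨d.1, ?_, ?_⟩
    · rw [← h2]; exact h.symm _ hd
    · rw [← h2, segment_symm]; exact hzd
  · exact absurd ⟨d, mem_filter.2 ⟨hd, h1, h2⟩, hzd⟩ (hsub hz)

lemma ball_convex {v x y : Pt} {r t : ℝ} (hx : x ∈ Metric.ball v r) (hy : y ∈ Metric.ball v r)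
    (h0 : 0 ≤ t) (h1 : t ≤ 1) : ip x y t ∈ Metric.ball v r :=
  (convex_ball v r).segment_subset hx hy (ip_mem_seg h0 h1)

open Filter Topology in
lemma germ_ray (h : St V O D T X) {κ : Bool} {v a p : Pt} (ha : (v, a) ∈ D)
    (hp : 0 < kcr κ v a p) (hb : ∀ b, (v, b) ∈ D → 0 < kcr κ v a b → kcr κ v b p < 0) :
    ∀ᶠ ε in 𝓝[>] (0 : ℝ), (ip v p ε ∈ X ↔ kd κ v a ∈ T) := by
  obtain ⟨r, hr, hball⟩ := h.exists_ball (h.verts _ ha).1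
  have hU := Metric.ball_mem_nhds v hr
  have e1 : ∀ᶠ ε in 𝓝[>] (0 : ℝ), ε < 1 :=
    (eventually_lt_nhds one_pos).filter_mono nhdsWithin_le_nhds
  obtain ⟨ε', ⟨h1, h2⟩, h3⟩ := ((e1.and (eventually_ip_mem (p := a) hU)).and
    self_mem_nhdsWithin).exists
  have h3 : 0 < ε' := h3
  filter_upwards [eventually_ip_mem (p := p) hU, self_mem_nhdsWithin] with ε hε hε0
  simp only [Set.mem_Ioi] at hε0
  refine h.kside ha (ip_mem_oseg h3 h1) ?_ ?_
  · rw [kcr_ip, kcr_left]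
    have := mul_pos hε0 hp
    linarith
  · intro t t0 t1 hz
    obtain ⟨b, hbD, hzb⟩ := hball _ (ball_convex h2 hε t0.le t1) hz
    obtain ⟨s, s0, s1, hs⟩ := mem_seg.1 hzb
    have k1 : kcr κ v a (ip v b s) = t * (ε * kcr κ v a p) := by
      rw [← hs, kcr_ip, kcr_ip, kcr_ip, kcr_left, kcr_right]; ring
    have k2 : kcr κ v (ip v b s) p = (1 - t) * (ε' * kcr κ v a p) := by
      rw [← hs]; simp only [kcr, cr, ip]; ring
    have k3 : kcr κ v (ip v b s) p = s * kcr κ v b p := by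
      simp only [kcr, cr, ip]; ring
    rw [kcr_ip, kcr_left, mul_zero, zero_add] at k1
    have q1 : 0 < s * kcr κ v a b := by rw [k1]; positivity
    have q2 : 0 < kcr κ v a b := pos_of_mul_pos_right q1 s0
    have q3 : 0 < s := pos_of_mul_pos_left q1 q2.le
    have q4 := hb b hbD q2
    have q5 : 0 ≤ s * kcr κ v b p := by
      rw [← k3, k2]
      have : 0 ≤ 1 - t := by linarith
      positivity
    nlinarith

open Filter Topology in
lemma germ_free (h : St V O D T X) {κ : Bool} {v p q : Pt} (hv : v ∈ V)
    (hpq : 0 < kcr κ v p q) (hb : ∀ b, (v, b) ∈ D → 0 ≤ kcr κ v p b → kcr κ v b q < 0) :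
    ∀ᶠ ε in 𝓝[>] (0 : ℝ), (ip v p ε ∈ X ↔ ip v q ε ∈ X) := by
  obtain ⟨r, hr, hball⟩ := h.exists_ball hv
  have hU := Metric.ball_mem_nhds v hr
  filter_upwards [eventually_ip_mem (p := p) hU, eventually_ip_mem (p := q) hU,
    self_mem_nhdsWithin] with ε h1 h2 h3
  simp only [Set.mem_Ioi] at h3
  refine h.face _ _ fun z hz hzc => ?_
  obtain ⟨t, t0, t1, rfl⟩ := mem_seg.1 hz
  obtain ⟨b, hbD, hzb⟩ := hball _ (ball_convex h1 h2 t0 t1) hzc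
  obtain ⟨s, s0, s1, hs⟩ := mem_seg.1 hzb
  have k1 : s * kcr κ v p b = t * (ε * kcr κ v p q) := by
    have : kcr κ v p (ip v b s) = t * (ε * kcr κ v p q) := by
      rw [← hs]; simp only [kcr, cr, ip]; ring
    rw [← this]; simp only [kcr, cr, ip]; ring
  have k2 : s * kcr κ v b q = (1 - t) * (ε * kcr κ v p q) := by
    have : kcr κ v (ip v b s) q = (1 - t) * (ε * kcr κ v p q) := by
      rw [← hs]; simp only [kcr, cr, ip]; ring
    rw [← this]; simp only [kcr, cr, ip]; ring
  have hpos : 0 < ε * kcr κ v p q := mul_pos h3 hpq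
  have hs0 : 0 < s := by
    refine s0.lt_of_ne fun e => ?_
    rw [← e] at k1 k2
    nlinarith
  have : 0 ≤ s * kcr κ v p b := by rw [k1]; positivity
  have := hb b hbD (nonneg_of_mul_nonneg_right this hs0)
  have : 0 ≤ s * kcr κ v b q := by
    rw [k2]
    have : 0 ≤ 1 - t := by linarith
    positivity
  nlinarith

lemma corner (h : St V O D T X) {κ : Bool} {v a w : Pt} (ha : (v, a) ∈ D) (hw : (v, w) ∈ D)
    (hΔ : 0 < kcr κ v a w) (hb : ∀ b, (v, b) ∈ D → 0 < kcr κ v a b → kcr κ v b w ≤ 0) :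
    kd κ v a ∈ T ↔ kd κ w v ∈ T := by
  set p : Pt := (a.1 + (w.1 - v.1), a.2 + (w.2 - v.2)) with hp
  have k1 : ∀ b, kcr κ v b p = - kcr κ v a b + kcr κ v b w := by
    intro b; simp only [kcr, cr, hp]; ring
  have e1 := h.germ_ray (p := p) ha (by rw [k1]; simpa using hΔ) (by
    intro b hbD hab
    rw [k1]; linarith [hb b hbD hab])
  have e2 := h.germ_ray (κ := !κ) (p := p) hw (by rw [kcr_not, k1]; simpa using hΔ) (by
    intro b hbD hab
    rw [kcr_not, kcr_swap'] at hab
    have hab' : 0 < kcr κ v b w := by linarith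
    rw [kcr_not, k1]
    have : ¬ 0 < kcr κ v a b := fun hh => absurd (hb b hbD hh) (not_le.2 hab')
    linarith)
  obtain ⟨ε, e1, e2⟩ := (e1.and e2).exists
  rw [← e1, e2, kd_not]

open Filter Topology in
/-- If the open half plane on one side of `v o` contains no dart at `v`. -/
lemma germ_flat (h : St V O D T X) {κ : Bool} {v o : Pt} (ho : (v, o) ∈ D)
    (hb : ∀ b, (v, b) ∈ D → kcr κ v o b ≤ 0) (hb0 : ∀ b, (v, b) ∈ D → cr v o b = 0 → b = o) :
    ∀ᶠ ε in 𝓝[>] (0 : ℝ), (ip v (ip v o (-1)) ε ∈ X ↔ kd κ v o ∈ T) := by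
  obtain ⟨p, hp⟩ := exists_kcr_pos κ (h.ne _ ho)
  have e1 := h.germ_ray ho hp (fun b hbD hh => absurd hh (not_lt.2 (hb b hbD)))
  have k : ∀ b, kcr κ v b (ip v o (-1)) = kcr κ v o b := by
    intro b; simp only [kcr, cr, ip]; ring
  have e2 := h.germ_free (κ := κ) (p := p) (q := ip v o (-1)) (h.verts _ ho).1 (by rwa [k]) (by
    intro b hbD hpb
    rw [k]
    refine (hb b hbD).lt_of_ne fun e => ?_
    have := hb0 b hbD (kcr_eq_zero_iff.1 e)
    subst this
    rw [kcr_swap'] at hpb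
    linarith)
  filter_upwards [e1, e2] with ε h1 h2
  rw [← h2, h1]

lemma straight (h : St V O D T X) (κ : Bool) {y s t : Pt} (ht : (y, t) ∈ D) (hs : (y, s) ∈ D)
    (hy : y ∈ openSegment ℝ s t) (hb : ∀ b, (y, b) ∈ D → b = s ∨ b = t) :
    kd κ y t ∈ T ↔ kd κ s y ∈ T := by
  obtain ⟨r, r0, r1, hr⟩ := mem_oseg.1 hy
  obtain ⟨p, hp⟩ := exists_kcr_pos κ (h.ne _ ht)
  have k0 : kcr κ y t s = 0 := by
    rw [kcr_rot]; simp only [kcr, cr, hr, ip]; ring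
  have k1 : r * kcr κ y t p = - ((1 - r) * kcr κ y s p) := by
    simp only [kcr, cr, hr, ip]; ring
  have e1 := h.germ_ray ht hp (by
    intro b hbD hh
    rcases hb b hbD with rfl | rfl
    · linarith
    · simp at hh)
  have e2 := h.germ_ray (κ := !κ) (p := p) hs (by
    rw [kcr_not]
    have : 0 < (1 - r) * (- kcr κ y s p) := by
      have := mul_pos r0 hp
      linarith
    exact pos_of_mul_pos_right this (by linarith)) (by
    intro b hbD hh
    rcases hb b hbD with rfl | rfl
    · simp at hh
    · rw [kcr_not, kcr_swap', k0] at hh; simp at hh)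
  obtain ⟨ε, e1, e2⟩ := (e1.and e2).exists
  rw [← e1, e2, kd_not]

end St

namespace MinSt

variable {V : Finset Pt} {O D T : Finset (Pt × Pt)} {X : Set Pt} {c : Pt → Pt → ℝ}

/-- At a vertex in the interior of a straight line of two oriented darts there are no other
darts in a minimal drawing. -/
lemma helper_rays (h : MinSt c V O D T X) (hc : CostFn c) {s y t : Pt} (hsy : (s, y) ∈ O)
    (hyt : (y, t) ∈ O) (hO : ∀ b, (y, b) ∈ O ∨ (b, y) ∈ O → b = s ∨ b = t)
    (hy : y ∈ openSegment ℝ s t) (hgen : ∀ b ∈ V, cr y t b = 0 → b = s ∨ b = t ∨ b = y) :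
    ∀ b, (y, b) ∈ D → b = s ∨ b = t := by
  intro a ha
  have hyt' := h.st.sub hyt
  have hys' := h.st.mem_swap (h.st.sub hsy)
  obtain ⟨r, r0, r1, hr⟩ := mem_oseg.1 hy
  have kst : ∀ κ x, r * kcr κ y t x = - ((1 - r) * kcr κ y s x) := by
    intro κ x; simp only [kcr, cr, hr, ip]; ring
  have k0 : ∀ κ, kcr κ y t s = 0 := by
    intro κ; rw [kcr_rot]; simp only [kcr, cr, hr, ip]; ring
  have hside : ∀ κ b, 0 < kcr κ y t b → (y, b) ∉ O ∧ (b, y) ∉ O := by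
    intro κ b hb
    constructor <;> intro hh
    · rcases hO b (Or.inl hh) with rfl | rfl
      · rw [k0] at hb; exact lt_irrefl _ hb
      · simp at hb
    · rcases hO b (Or.inr hh) with rfl | rfl
      · rw [k0] at hb; exact lt_irrefl _ hb
      · simp at hb
  have key : ∀ κ, ¬ 0 < kcr κ y t a := by
    intro κ hpos
    have huniq : ∀ b, (y, b) ∈ D → 0 < kcr κ y t b → b = a := fun b hb hb' =>
      h.side_unique hc (fun b _ hb => hside κ b hb) hb ha hb' hpos
    have hpos' : 0 < kcr κ y a s := by
      have : 0 < (1 - r) * kcr κ y a s := by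
        rw [kcr_swap']
        have := mul_pos r0 hpos
        linarith [kst κ a]
      exact pos_of_mul_pos_right this (by linarith)
    have hc1 : ∀ b, (y, b) ∈ D → 0 < kcr κ y t b → kcr κ y b a ≤ 0 := by
      intro b hb hb'
      rw [huniq b hb hb']; simp
    have hc2 : ∀ b, (y, b) ∈ D → 0 < kcr κ y a b → kcr κ y b s ≤ 0 := by
      intro b hb hb'
      by_contra hcon
      push Not at hcon
      have : 0 < r * kcr κ y t b := by
        rw [kst, kcr_swap']
        have : 0 < 1 - r := by linarith
        have := mul_pos this hcon
        linarith
      have := huniq b hb (pos_of_mul_pos_right this r0.le)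
      subst this
      simp at hb'
    have ho := hside κ a hpos
    have c1 := h.st.corner hyt' ha hpos hc1
    have c2 := h.st.corner ha hys' hpos' hc2
    have n1 : chi O T (kd κ y t) ≠ -1 := fun e =>
      h.not_empty_sector hc hyt' ha hpos hc1 e (h.chi_jump κ (h.st.mem_swap ha) ho.2 ho.1)
    have n2 : chi O T (kd κ s y) ≠ -1 := fun e =>
      h.not_empty_sector hc ha hys' hpos' hc2 (h.chi_jump κ ha ho.1 ho.2) e
    have hj := h.jump ha ho.1 ho.2
    have a1 := h.st.asym _ hyt
    have a2 := h.st.asym _ hsy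
    simp only [Prod.swap_prod_mk] at a1 a2
    rcases κ with _ | _
    · change chi O T (t, y) ≠ -1 at n1
      change chi O T (y, s) ≠ -1 at n2
      change (t, y) ∈ T ↔ (y, a) ∈ T at c1
      change (a, y) ∈ T ↔ (y, s) ∈ T at c2
      simp only [chi, Prod.swap_prod_mk, if_neg a1, if_pos hyt] at n1
      simp only [chi, Prod.swap_prod_mk, if_neg a2, if_pos hsy] at n2
      split_ifs at n1 n2 <;> tauto
    · change chi O T (y, t) ≠ -1 at n1
      change chi O T (s, y) ≠ -1 at n2
      change (y, t) ∈ T ↔ (a, y) ∈ T at c1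
      change (y, a) ∈ T ↔ (s, y) ∈ T at c2
      simp only [chi, if_pos hyt] at n1
      simp only [chi, if_pos hsy] at n2
      split_ifs at n1 n2 <;> tauto
  have hz : cr y t a = 0 := by
    have h1 := key true
    have h2 := key false
    rw [kcr_true] at h1
    rw [kcr_false] at h2
    linarith
  rcases hgen a (h.st.verts _ ha).2 hz with e | e | e
  · exact Or.inl e
  · exact Or.inr e
  · exact absurd e.symm (h.st.ne _ ha)

/-- The structure of a minimal drawing at an endpoint `v` of an oriented path. -/
lemma end_rays (h : MinSt c V O D T X) (hc : CostFn c) {v o : Pt}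
    (hvo : (v, o) ∈ O ∨ (o, v) ∈ O) (hO : ∀ b, (v, b) ∈ O ∨ (b, v) ∈ O → b = o)
    (hgen : ∀ b, (v, b) ∈ D → cr v o b = 0 → b = o) :
    ((∀ b, (v, b) ∈ D → b = o) ∧ ((v, o) ∈ T ↔ (o, v) ∈ T)) ∨
    ∃ a, a ≠ o ∧ (v, a) ∈ D ∧ (∀ b, (v, b) ∈ D → b = o ∨ b = a) ∧ ((a, v) ∈ T ↔ (v, o) ∈ T) ∧
      ((v, a) ∈ T ↔ (o, v) ∈ T) ∧ ¬ ((v, o) ∈ T ↔ (o, v) ∈ T) ∧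
      ∃ κ, chi O T (kd κ v o) ≠ -1 := by
  have ho : (v, o) ∈ D := by
    rcases hvo with h' | h'
    · exact h.st.sub h'
    · exact h.st.mem_swap (h.st.sub h')
  have hside : ∀ κ b, (v, b) ∈ D → 0 < kcr κ v o b → (v, b) ∉ O ∧ (b, v) ∉ O := by
    intro κ b _ hb
    constructor <;> intro hh
    · rw [hO b (Or.inl hh)] at hb; simp at hb
    · rw [hO b (Or.inr hh)] at hb; simp at hb
  have hone : ∀ κ a, (v, a) ∈ D → 0 < kcr κ v o a →
      (kd κ v o ∈ T ↔ kd κ a v ∈ T) ∧ chi O T (kd κ v o) ≠ -1 ∧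
      ∀ᶠ ε in nhdsWithin (0 : ℝ) (Set.Ioi 0), (ip v (ip v o (-1)) ε ∈ X ↔ kd κ v a ∈ T) := by
    intro κ a ha hpos
    have huniq : ∀ b, (v, b) ∈ D → 0 < kcr κ v o b → b = a := fun b hb hb' =>
      h.side_unique hc (hside κ) hb ha hb' hpos
    have hc1 : ∀ b, (v, b) ∈ D → 0 < kcr κ v o b → kcr κ v b a ≤ 0 := by
      intro b hb hb'
      rw [huniq b hb hb']; simp
    have hs := hside κ a ha hpos
    have k : ∀ b, kcr κ v b (ip v o (-1)) = kcr κ v o b := by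
      intro b; simp only [kcr, cr, ip]; ring
    refine ⟨h.st.corner ho ha hpos hc1, fun e => h.not_empty_sector hc ho ha hpos hc1 e
      (h.chi_jump κ (h.st.mem_swap ha) hs.2 hs.1), ?_⟩
    refine h.st.germ_ray ha (by rwa [k]) ?_
    intro b hb hb'
    rw [k]
    rcases lt_trichotomy (kcr κ v o b) 0 with h1 | h1 | h1
    · exact h1
    · exfalso
      rw [hgen b hb (kcr_eq_zero_iff.1 h1), kcr_swap'] at hb'
      linarith
    · rw [huniq b hb h1] at hb'
      simp at hb'
  have hnone : ∀ κ, (¬ ∃ a, (v, a) ∈ D ∧ 0 < kcr κ v o a) →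
      ∀ᶠ ε in nhdsWithin (0 : ℝ) (Set.Ioi 0), (ip v (ip v o (-1)) ε ∈ X ↔ kd κ v o ∈ T) := by
    intro κ hn
    refine h.st.germ_flat ho ?_ hgen
    intro b hb
    by_contra hcon
    exact hn ⟨b, hb, not_le.1 hcon⟩
  have hsgn : ∀ κ b, (v, b) ∈ D → b = o ∨ 0 < kcr κ v o b ∨ 0 < kcr (!κ) v o b := by
    intro κ b hb
    rw [kcr_not]
    rcases lt_trichotomy (kcr κ v o b) 0 with h1 | h1 | h1
    · right; right; linarith
    · exact Or.inl (hgen b hb (kcr_eq_zero_iff.1 h1))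
    · exact Or.inr (Or.inl h1)
  have hsingle : ∀ κ a, (v, a) ∈ D → 0 < kcr κ v o a →
      (¬ ∃ a, (v, a) ∈ D ∧ 0 < kcr (!κ) v o a) →
      ∃ a, a ≠ o ∧ (v, a) ∈ D ∧ (∀ b, (v, b) ∈ D → b = o ∨ b = a) ∧ ((a, v) ∈ T ↔ (v, o) ∈ T) ∧
      ((v, a) ∈ T ↔ (o, v) ∈ T) ∧ ¬ ((v, o) ∈ T ↔ (o, v) ∈ T) ∧
      ∃ κ, chi O T (kd κ v o) ≠ -1 := by
    intro κ a ha hpos hn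
    obtain ⟨e1, e2, e3⟩ := hone κ a ha hpos
    obtain ⟨ε, e3, e4⟩ := (e3.and (hnone _ hn)).exists
    have hs := hside κ a ha hpos
    have hj := h.jump ha hs.1 hs.2
    rw [e3, kd_not] at e4
    refine ⟨a, ?_, ha, ?_, ?_⟩
    · rintro rfl; simp at hpos
    · intro b hb
      rcases hsgn κ b hb with h1 | h1 | h1
      · exact Or.inl h1
      · exact Or.inr (h.side_unique hc (hside κ) hb ha h1 hpos)
      · exact absurd ⟨b, hb, h1⟩ hn
    · refine and_assoc.1 (and_assoc.1 ⟨?_, κ, e2⟩)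
      rcases κ with _ | _
      · change (o, v) ∈ T ↔ (v, a) ∈ T at e1
        change (a, v) ∈ T ↔ (v, o) ∈ T at e4
        tauto
      · change (v, o) ∈ T ↔ (a, v) ∈ T at e1
        change (v, a) ∈ T ↔ (o, v) ∈ T at e4
        tauto
  by_cases h1 : ∃ a, (v, a) ∈ D ∧ 0 < kcr true v o a
  · obtain ⟨a, ha, hpa⟩ := h1
    by_cases h2 : ∃ a, (v, a) ∈ D ∧ 0 < kcr false v o a
    · exfalso
      obtain ⟨a', ha', hpa'⟩ := h2
      obtain ⟨e1, e2, e3⟩ := hone _ a ha hpa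
      obtain ⟨f1, f2, f3⟩ := hone _ a' ha' hpa'
      obtain ⟨ε, e3, f3⟩ := (e3.and f3).exists
      have hs := hside _ a ha hpa
      have hj := h.jump ha hs.1 hs.2
      have hs' := hside _ a' ha' hpa'
      have hj' := h.jump ha' hs'.1 hs'.2
      rw [e3] at f3
      change (v, o) ∈ T ↔ (a, v) ∈ T at e1
      change (o, v) ∈ T ↔ (v, a') ∈ T at f1
      change (v, a) ∈ T ↔ (a', v) ∈ T at f3
      change chi O T (v, o) ≠ -1 at e2
      change chi O T (o, v) ≠ -1 at f2
      rcases hvo with h' | h'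
      · have as := h.st.asym _ h'
        simp only [Prod.swap_prod_mk] at as
        simp only [chi, if_pos h'] at e2
        simp only [chi, Prod.swap_prod_mk, if_neg as, if_pos h'] at f2
        split_ifs at e2 f2 <;> tauto
      · have as := h.st.asym _ h'
        simp only [Prod.swap_prod_mk] at as
        simp only [chi, if_pos h'] at f2
        simp only [chi, Prod.swap_prod_mk, if_neg as, if_pos h'] at e2
        split_ifs at e2 f2 <;> tauto
    · exact Or.inr (hsingle true a ha hpa h2)
  · by_cases h2 : ∃ a, (v, a) ∈ D ∧ 0 < kcr false v o a
    · obtain ⟨a, ha, hpa⟩ := h2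
      exact Or.inr (hsingle false a ha hpa h1)
    · left
      constructor
      · intro b hb
        rcases hsgn true b hb with e | e | e
        · exact e
        · exact absurd ⟨b, hb, e⟩ h1
        · exact absurd ⟨b, hb, e⟩ h2
      · obtain ⟨ε, e1, e2⟩ := ((hnone _ h1).and (hnone _ h2)).exists
        rw [e1] at e2
        exact e2

end MinSt

lemma IsBRMatching.inj_left {B R : Finset Pt} {M : Finset (Pt × Pt)} (h : IsBRMatching B R M)
    {e e' : Pt × Pt} (he : e ∈ M) (he' : e' ∈ M) (hh : e.1 = e'.1) : e = e' :=
  (h.2.1 e.1 (h.1 e he).1).unique ⟨he, rfl⟩ ⟨he', hh.symm⟩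

lemma IsBRMatching.inj_right {B R : Finset Pt} {M : Finset (Pt × Pt)} (h : IsBRMatching B R M)
    {e e' : Pt × Pt} (he : e ∈ M) (he' : e' ∈ M) (hh : e.2 = e'.2) : e = e' :=
  (h.2.2.1 e.2 (h.1 e he).2).unique ⟨he, rfl⟩ ⟨he', hh.symm⟩

/-- A plane bichromatic matching with a marked point `y e` in the interior of every edge `e`. -/
structure Marked (S H : Finset Pt) (M : Finset (Pt × Pt)) (y : Pt × Pt → Pt) : Prop where
  mat : IsBRMatching S H M
  disj : S ∩ H = ∅
  gen : ∀ p ∈ S ∪ H, ∀ e ∈ M, cr e.1 e.2 p = 0 → p = e.1 ∨ p = e.2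
  mem : ∀ e ∈ M, y e ∈ openSegment ℝ e.1 e.2
  off : ∀ e ∈ M, ∀ e' ∈ M, e' ≠ e → cr e'.1 e'.2 (y e) ≠ 0

noncomputable def vset (S H : Finset Pt) (M : Finset (Pt × Pt)) (y : Pt × Pt → Pt) : Finset Pt :=
  (S ∪ H) ∪ M.image y

noncomputable def oset (M : Finset (Pt × Pt)) (y : Pt × Pt → Pt) : Finset (Pt × Pt) :=
  M.image (fun e => (e.1, y e)) ∪ M.image (fun e => (y e, e.2))

lemma mem_oset {M : Finset (Pt × Pt)} {y : Pt × Pt → Pt} {d : Pt × Pt} :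
    d ∈ oset M y ↔ ∃ e ∈ M, d = (e.1, y e) ∨ d = (y e, e.2) := by
  simp only [oset, mem_union, mem_image]
  constructor
  · rintro (⟨e, he, rfl⟩ | ⟨e, he, rfl⟩)
    · exact ⟨e, he, Or.inl rfl⟩
    · exact ⟨e, he, Or.inr rfl⟩
  · rintro ⟨e, he, rfl | rfl⟩
    · exact Or.inl ⟨e, he, rfl⟩
    · exact Or.inr ⟨e, he, rfl⟩

lemma seg_split {x z w p : Pt} (h : z ∈ openSegment ℝ x w) (hp : p ∈ segment ℝ x w) :
    p ∈ segment ℝ x z ∨ p ∈ segment ℝ z w := by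
  obtain ⟨t, t0, t1, rfl⟩ := mem_oseg.1 h
  obtain ⟨s, s0, s1, rfl⟩ := mem_seg.1 hp
  rcases le_total s t with hst | hst
  · left
    refine mem_seg.2 ⟨s / t, by positivity, (div_le_one t0).2 hst, ?_⟩
    rw [ip_ip, div_mul_cancel₀ _ t0.ne']
  · right
    have h1 : 0 < 1 - t := by linarith
    refine mem_seg.2 ⟨(s - t) / (1 - t), div_nonneg (by linarith) h1.le,
      (div_le_one h1).2 (by linarith), ?_⟩
    rw [ip_ip_right, div_mul_cancel₀ _ h1.ne']; congr 1; ring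

lemma cr_of_mem_seg {p q z : Pt} (hz : z ∈ segment ℝ p q) : cr p q z = 0 :=
  kcr_eq_zero_iff.1 (seg_cr_zero (κ := true) hz)

namespace Marked

variable {S H : Finset Pt} {M : Finset (Pt × Pt)} {y : Pt × Pt → Pt}

lemma left_mem (h : Marked S H M y) {e : Pt × Pt} (he : e ∈ M) : e.1 ∈ S := (h.mat.1 e he).1

lemma right_mem (h : Marked S H M y) {e : Pt × Pt} (he : e ∈ M) : e.2 ∈ H := (h.mat.1 e he).2

lemma ne_of_mem (h : Marked S H M y) {s t : Pt} (hs : s ∈ S) (ht : t ∈ H) : s ≠ t := by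
  rintro rfl
  have : s ∈ S ∩ H := mem_inter.2 ⟨hs, ht⟩
  rw [h.disj] at this; simp at this

lemma mark_ne (h : Marked S H M y) {e : Pt × Pt} (he : e ∈ M) : y e ≠ e.1 ∧ y e ≠ e.2 := by
  have hne := h.ne_of_mem (h.left_mem he) (h.right_mem he)
  refine ⟨fun hh => left_notMem_oseg hne ?_, fun hh => right_notMem_oseg hne ?_⟩
  · have := h.mem e he; rwa [hh] at this
  · have := h.mem e he; rwa [hh] at this

lemma mark_notMem (h : Marked S H M y) {e : Pt × Pt} (he : e ∈ M) : y e ∉ S ∧ y e ∉ H := by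
  constructor <;> intro hy
  · obtain ⟨e', ⟨he', h1⟩, -⟩ := h.mat.2.1 _ hy
    by_cases hee : e' = e
    · subst hee; exact (h.mark_ne he).1 h1.symm
    · exact h.off e he e' he' hee (by rw [← h1]; exact cr_of_mem_seg (left_mem_segment ℝ _ _))
  · obtain ⟨e', ⟨he', h1⟩, -⟩ := h.mat.2.2.1 _ hy
    by_cases hee : e' = e
    · subst hee; exact (h.mark_ne he).2 h1.symm
    · exact h.off e he e' he' hee (by rw [← h1]; exact cr_of_mem_seg (right_mem_segment ℝ _ _))

lemma mark_ne_left (h : Marked S H M y) {e : Pt × Pt} (he : e ∈ M) {s : Pt} (hs : s ∈ S) :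
    y e ≠ s := fun hh => (h.mark_notMem he).1 (hh ▸ hs)

lemma mark_ne_right (h : Marked S H M y) {e : Pt × Pt} (he : e ∈ M) {t : Pt} (ht : t ∈ H) :
    y e ≠ t := fun hh => (h.mark_notMem he).2 (hh ▸ ht)

lemma mark_inj (h : Marked S H M y) {e e' : Pt × Pt} (he : e ∈ M) (he' : e' ∈ M)
    (hh : y e = y e') : e = e' := by
  by_contra hne
  apply h.off e he e' he' (Ne.symm hne)
  rw [hh]
  exact cr_of_mem_seg (openSegment_subset_segment _ _ _ (h.mem e' he'))

lemma nbr_left (h : Marked S H M y) {e : Pt × Pt} (he : e ∈ M) {b : Pt}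
    (hb : (e.1, b) ∈ oset M y ∨ (b, e.1) ∈ oset M y) : b = y e := by
  rcases hb with hb | hb <;> obtain ⟨e', he', hd | hd⟩ := mem_oset.1 hb <;>
    obtain ⟨h1, h2⟩ := Prod.ext_iff.1 hd <;> simp only at h1 h2
  · rw [h2, h.mat.inj_left he he' h1]
  · exact absurd h1.symm (h.mark_ne_left he' (h.left_mem he))
  · exact absurd h2.symm (h.mark_ne_left he' (h.left_mem he))
  · exact absurd h2 (h.ne_of_mem (h.left_mem he) (h.right_mem he'))

lemma nbr_right (h : Marked S H M y) {e : Pt × Pt} (he : e ∈ M) {b : Pt}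
    (hb : (e.2, b) ∈ oset M y ∨ (b, e.2) ∈ oset M y) : b = y e := by
  rcases hb with hb | hb <;> obtain ⟨e', he', hd | hd⟩ := mem_oset.1 hb <;>
    obtain ⟨h1, h2⟩ := Prod.ext_iff.1 hd <;> simp only at h1 h2
  · exact absurd h1.symm (h.ne_of_mem (h.left_mem he') (h.right_mem he))
  · exact absurd h1.symm (h.mark_ne_right he' (h.right_mem he))
  · exact absurd h2.symm (h.mark_ne_right he' (h.right_mem he))
  · rw [h1, h.mat.inj_right he he' h2]

lemma nbr_mark (h : Marked S H M y) {e : Pt × Pt} (he : e ∈ M) {b : Pt}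
    (hb : (y e, b) ∈ oset M y ∨ (b, y e) ∈ oset M y) : b = e.1 ∨ b = e.2 := by
  rcases hb with hb | hb <;> obtain ⟨e', he', hd | hd⟩ := mem_oset.1 hb <;>
    obtain ⟨h1, h2⟩ := Prod.ext_iff.1 hd <;> simp only at h1 h2
  · exact absurd h1 (h.mark_ne_left he (h.left_mem he'))
  · right; rw [h2, h.mark_inj he he' h1]
  · left; rw [h1, h.mark_inj he he' h2]
  · exact absurd h2 (h.mark_ne_right he (h.right_mem he'))

lemma left_mem_oset {e : Pt × Pt} (he : e ∈ M) : (e.1, y e) ∈ oset M y :=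
  mem_oset.2 ⟨e, he, Or.inl rfl⟩

lemma right_mem_oset {e : Pt × Pt} (he : e ∈ M) : (y e, e.2) ∈ oset M y :=
  mem_oset.2 ⟨e, he, Or.inr rfl⟩

/-- The vertices on the line spanned by an edge of the matching. -/
lemma on_line (h : Marked S H M y) {e : Pt × Pt} (he : e ∈ M) {b : Pt} (hb : b ∈ vset S H M y)
    (h0 : cr e.1 e.2 b = 0) : b = e.1 ∨ b = e.2 ∨ b = y e := by
  rcases mem_union.1 hb with hb | hb
  · rcases h.gen b hb e he h0 with h1 | h1
    · exact Or.inl h1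
    · exact Or.inr (Or.inl h1)
  · obtain ⟨e', he', rfl⟩ := mem_image.1 hb
    by_cases hee : e = e'
    · subst hee; exact Or.inr (Or.inr rfl)
    · exact absurd h0 (h.off e' he' e he hee)

variable {D T : Finset (Pt × Pt)} {X : Set Pt} {c : Pt → Pt → ℝ}

lemma on_left_half (h : Marked S H M y) {e : Pt × Pt} (he : e ∈ M) {b : Pt}
    (h0 : cr e.1 (y e) b = 0) : cr e.1 e.2 b = 0 := by
  obtain ⟨r, r0, r1, hr⟩ := mem_oseg.1 (h.mem e he)
  have : cr e.1 (y e) b = r * cr e.1 e.2 b := by rw [hr]; simp only [cr, ip]; ring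
  rw [this] at h0
  exact (mul_eq_zero.1 h0).resolve_left r0.ne'

lemma on_right_half (h : Marked S H M y) {e : Pt × Pt} (he : e ∈ M) {b : Pt}
    (h0 : cr e.2 (y e) b = 0) : cr e.1 e.2 b = 0 := by
  obtain ⟨r, r0, r1, hr⟩ := mem_oseg.1 (h.mem e he)
  have : cr e.2 (y e) b = (r - 1) * cr e.1 e.2 b := by rw [hr]; simp only [cr, ip]; ring
  rw [this] at h0
  exact (mul_eq_zero.1 h0).resolve_left (by linarith)

lemma mark_rays (h : Marked S H M y) (hm : MinSt c (vset S H M y) (oset M y) D T X)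
    (hc : CostFn c) {e : Pt × Pt} (he : e ∈ M) {b : Pt} (hb : (y e, b) ∈ D) :
    b = e.1 ∨ b = e.2 := by
  refine hm.helper_rays hc (left_mem_oset he) (right_mem_oset he) (fun b hb => h.nbr_mark he hb)
    (h.mem e he) ?_ b hb
  intro b hb h0
  refine h.on_line he hb (h.on_right_half he ?_)
  rw [← kcr_true] at h0 ⊢
  rw [kcr_swap, h0, neg_zero]

lemma mark_labels (h : Marked S H M y) (hm : MinSt c (vset S H M y) (oset M y) D T X)
    (hc : CostFn c) {e : Pt × Pt} (he : e ∈ M) :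
    ((y e, e.2) ∈ T ↔ (e.1, y e) ∈ T) ∧ ((e.2, y e) ∈ T ↔ (y e, e.1) ∈ T) := by
  have h1 := hm.st.sub (right_mem_oset (y := y) he)
  have h2 := hm.st.mem_swap (hm.st.sub (left_mem_oset (y := y) he))
  have h3 : ∀ b, (y e, b) ∈ D → b = e.1 ∨ b = e.2 := fun b hb => h.mark_rays hm hc he hb
  exact ⟨hm.st.straight true h1 h2 (h.mem e he) h3, hm.st.straight false h1 h2 (h.mem e he) h3⟩

/-- Rays at a start point. -/
lemma start_rays (h : Marked S H M y) (hm : MinSt c (vset S H M y) (oset M y) D T X)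
    (hc : CostFn c) {e : Pt × Pt} (he : e ∈ M) :
    ((∀ b, (e.1, b) ∈ D → b = y e) ∧ ((e.1, y e) ∈ T ↔ (y e, e.1) ∈ T)) ∨
    ∃ a, a ≠ y e ∧ (e.1, a) ∈ D ∧ (∀ b, (e.1, b) ∈ D → b = y e ∨ b = a) ∧
      (a, e.1) ∈ T ∧ (e.1, a) ∉ T ∧ (e.1, y e) ∈ T ∧ (y e, e.1) ∉ T := by
  have hO := left_mem_oset (y := y) he
  have hD := hm.st.sub hO
  rcases hm.end_rays hc (Or.inl hO) (fun b hb => h.nbr_left he hb) (by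
    intro b hb h0
    rcases h.on_line he (hm.st.verts _ hb).2 (h.on_left_half he h0) with h1 | h1 | h1
    · exact absurd h1.symm (hm.st.ne _ hb)
    · have h1 : b = e.2 := h1
      rw [h1] at hb
      exact absurd (h.mem e he) (hm.st.vert_notMem (hm.st.verts _ hD).2 hb)
    · exact h1) with h1 | ⟨a, h1, h2, h3, h4, h5, h6, κ, h7⟩
  · exact Or.inl h1
  · right
    have as := hm.st.asym _ hO
    simp only [Prod.swap_prod_mk] at as
    have hlab : (e.1, y e) ∈ T ∧ (y e, e.1) ∉ T := by
      rcases κ with _ | _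
      · change chi _ T (y e, e.1) ≠ -1 at h7
        simp only [chi, Prod.swap_prod_mk, if_neg as, if_pos hO] at h7
        split_ifs at h7 <;> tauto
      · change chi _ T (e.1, y e) ≠ -1 at h7
        simp only [chi, if_pos hO] at h7
        split_ifs at h7 <;> tauto
    exact ⟨a, h1, h2, h3, h4.2 hlab.1, fun hh => hlab.2 (h5.1 hh), hlab⟩

/-- Rays at a head point. -/
lemma head_rays (h : Marked S H M y) (hm : MinSt c (vset S H M y) (oset M y) D T X)
    (hc : CostFn c) {e : Pt × Pt} (he : e ∈ M) :
    ((∀ b, (e.2, b) ∈ D → b = y e) ∧ ((e.1, y e) ∈ T ↔ (y e, e.1) ∈ T)) ∨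
    ∃ a, a ≠ y e ∧ (e.2, a) ∈ D ∧ (∀ b, (e.2, b) ∈ D → b = y e ∨ b = a) ∧
      (a, e.2) ∉ T ∧ (e.2, a) ∈ T ∧ (e.1, y e) ∈ T ∧ (y e, e.1) ∉ T := by
  have hO := right_mem_oset (y := y) he
  have hD := hm.st.sub hO
  obtain ⟨m1, m2⟩ := h.mark_labels hm hc he
  rcases hm.end_rays hc (Or.inr hO) (fun b hb => h.nbr_right he hb) (by
    intro b hb h0
    rcases h.on_line he (hm.st.verts _ hb).2 (h.on_right_half he h0) with h1 | h1 | h1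
    · have h1 : b = e.1 := h1
      rw [h1] at hb
      have := hm.st.vert_notMem (hm.st.verts _ hD).1 hb
      rw [openSegment_symm] at this
      exact absurd (h.mem e he) this
    · exact absurd h1.symm (hm.st.ne _ hb)
    · exact h1) with h1 | ⟨a, h1, h2, h3, h4, h5, h6, κ, h7⟩
  · left
    refine ⟨h1.1, ?_⟩
    rw [← m1, ← m2]; exact h1.2.symm
  · right
    have as := hm.st.asym _ hO
    simp only [Prod.swap_prod_mk] at as
    have hlab : (y e, e.2) ∈ T ∧ (e.2, y e) ∉ T := by
      rcases κ with _ | _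
      · change chi _ T (y e, e.2) ≠ -1 at h7
        simp only [chi, if_pos hO] at h7
        split_ifs at h7 <;> tauto
      · change chi _ T (e.2, y e) ≠ -1 at h7
        simp only [chi, Prod.swap_prod_mk, if_neg as, if_pos hO] at h7
        split_ifs at h7 <;> tauto
    exact ⟨a, h1, h2, h3, fun hh => hlab.2 (h4.1 hh), h5.2 hlab.1, m1.1 hlab.1,
      fun hh => hlab.2 (m2.2 hh)⟩

lemma start_ray_mem (h : Marked S H M y) (hm : MinSt c (vset S H M y) (oset M y) D T X)
    (hc : CostFn c) {e : Pt × Pt} (he : e ∈ M) {a : Pt} (ha : (e.1, a) ∈ D) (hay : a ≠ y e)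
    (hT : (a, e.1) ∈ T) : a ∈ H := by
  rcases mem_union.1 (hm.st.verts _ ha).2 with h1 | h1
  · rcases mem_union.1 h1 with h2 | h2
    · exfalso
      obtain ⟨e', ⟨he', rfl⟩, -⟩ := h.mat.2.1 _ h2
      have ha' := hm.st.mem_swap ha
      have hne := (h.mark_ne_left he' (h.left_mem he)).symm
      rcases h.start_rays hm hc he' with ⟨h3, -⟩ | ⟨b, -, -, h3, -, h4, -⟩
      · exact hne (h3 _ ha')
      · rcases h3 _ ha' with h5 | h5
        · exact hne h5
        · rw [← h5] at h4; exact h4 hT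
    · exact h2
  · exfalso
    obtain ⟨e', he', rfl⟩ := mem_image.1 h1
    rcases h.mark_rays hm hc he' (hm.st.mem_swap ha) with h2 | h2
    · exact hay (by rw [h.mat.inj_left he' he h2.symm])
    · exact h.ne_of_mem (h.left_mem he) (h.right_mem he') h2

lemma head_ray_mem (h : Marked S H M y) (hm : MinSt c (vset S H M y) (oset M y) D T X)
    (hc : CostFn c) {e : Pt × Pt} (he : e ∈ M) {a : Pt} (ha : (e.2, a) ∈ D) (hay : a ≠ y e)
    (hT : (a, e.2) ∉ T) : a ∈ S := by
  rcases mem_union.1 (hm.st.verts _ ha).2 with h1 | h1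
  · rcases mem_union.1 h1 with h2 | h2
    · exact h2
    · exfalso
      obtain ⟨e', ⟨he', rfl⟩, -⟩ := h.mat.2.2.1 _ h2
      have ha' := hm.st.mem_swap ha
      have hne := (h.mark_ne_right he' (h.right_mem he)).symm
      rcases h.head_rays hm hc he' with ⟨h3, -⟩ | ⟨b, -, -, h3, -, h4, -⟩
      · exact hne (h3 _ ha')
      · rcases h3 _ ha' with h5 | h5
        · exact hne h5
        · rw [← h5] at h4; exact hT h4
  · exfalso
    obtain ⟨e', he', rfl⟩ := mem_image.1 h1
    rcases h.mark_rays hm hc he' (hm.st.mem_swap ha) with h2 | h2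
    · exact h.ne_of_mem (h.left_mem he') (h.right_mem he) h2.symm
    · exact hay (by rw [h.mat.inj_right he' he h2.symm])

end Marked

lemma St.meet {V : Finset Pt} {O D T : Finset (Pt × Pt)} {X : Set Pt} (h : St V O D T X)
    {d d' : Pt × Pt} (hd : d ∈ D) (hd' : d' ∈ D) {z : Pt} (hz : z ∈ segment ℝ d.1 d.2)
    (hz' : z ∈ segment ℝ d'.1 d'.2) :
    (d' = d ∨ d' = d.swap) ∨ ((z = d.1 ∨ z = d.2) ∧ (z = d'.1 ∨ z = d'.2)) := by
  by_cases h1 : d' = d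
  · exact Or.inl (Or.inl h1)
  by_cases h2 : d' = d.swap
  · exact Or.inl (Or.inr h2)
  right
  refine ⟨ends_of_mem_seg hz fun ho => h.plane d hd d' hd' h1 h2 z ho hz',
    ends_of_mem_seg hz' fun ho => h.plane d' hd' d hd (Ne.symm h1) ?_ z ho hz⟩
  intro h3; exact h2 (by rw [h3, Prod.swap_swap])

namespace Marked

variable {S H : Finset Pt} {M : Finset (Pt × Pt)} {y : Pt × Pt → Pt}
variable {D T : Finset (Pt × Pt)} {X : Set Pt} {c : Pt → Pt → ℝ}

lemma pieces (h : Marked S H M y) (hs : St (vset S H M y) (oset M y) D T X) {e : Pt × Pt}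
    (he : e ∈ M ∨ e ∈ D) {z : Pt} (hz : z ∈ segment ℝ e.1 e.2) :
    ∃ d ∈ D, z ∈ segment ℝ d.1 d.2 ∧
      (∀ x, x = d.1 ∨ x = d.2 → (x = e.1 ∨ x = e.2) ∨ (e ∈ M ∧ x = y e)) ∧
      (d.1 = e.1 ∨ d.2 = e.2) ∧ (e ∈ M → d.1 = y e ∨ d.2 = y e) := by
  by_cases heM : e ∈ M
  · rcases seg_split (h.mem e heM) hz with h1 | h1
    · refine ⟨(e.1, y e), hs.sub (left_mem_oset heM), h1, ?_, Or.inl rfl, fun _ => Or.inr rfl⟩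
      rintro x (rfl | rfl)
      · exact Or.inl (Or.inl rfl)
      · exact Or.inr ⟨heM, rfl⟩
    · refine ⟨(y e, e.2), hs.sub (right_mem_oset heM), h1, ?_, Or.inr rfl, fun _ => Or.inl rfl⟩
      rintro x (rfl | rfl)
      · exact Or.inr ⟨heM, rfl⟩
      · exact Or.inl (Or.inr rfl)
  · exact ⟨e, he.resolve_left heM, hz, fun x hx => Or.inl hx, Or.inl rfl, fun hh => absurd hh heM⟩

/-- The matching read off from a minimal drawing. -/
noncomputable def next (S H : Finset Pt) (M : Finset (Pt × Pt)) (y : Pt × Pt → Pt)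
    (D T : Finset (Pt × Pt)) : Finset (Pt × Pt) :=
  M.filter (fun e => (e.1, y e) ∈ T ↔ (y e, e.1) ∈ T) ∪ (S ×ˢ H).filter (fun e => e ∈ D)

lemma mem_next {e : Pt × Pt} : e ∈ next S H M y D T ↔
    (e ∈ M ∧ ((e.1, y e) ∈ T ↔ (y e, e.1) ∈ T)) ∨ ((e.1 ∈ S ∧ e.2 ∈ H) ∧ e ∈ D) := by
  simp only [next, mem_union, mem_filter, mem_product]

lemma next_mem (h : Marked S H M y) {e : Pt × Pt} (he : e ∈ next S H M y D T) :
    e.1 ∈ S ∧ e.2 ∈ H := by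
  rcases mem_next.1 he with h1 | h1
  · exact h.mat.1 e h1.1
  · exact h1.1

lemma next_cov (he : e ∈ next S H M y D T) : e ∈ M ∨ e ∈ D := by
  rcases mem_next.1 he with h1 | h1
  · exact Or.inl h1.1
  · exact Or.inr h1.2

lemma next_left (h : Marked S H M y) (hm : MinSt c (vset S H M y) (oset M y) D T X)
    (hc : CostFn c) {s : Pt} (hs : s ∈ S) : ∃! e, e ∈ next S H M y D T ∧ e.1 = s := by
  obtain ⟨e, ⟨he, rfl⟩, -⟩ := h.mat.2.1 s hs
  rcases h.start_rays hm hc he with ⟨h1, h2⟩ | ⟨a, h1, h2, h3, h4, h5, h6, h7⟩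
  · refine ⟨e, ⟨mem_next.2 (Or.inl ⟨he, h2⟩), rfl⟩, ?_⟩
    rintro ⟨e1, e2⟩ ⟨he', rfl : e1 = e.1⟩
    rcases mem_next.1 he' with h3 | h3
    · exact h.mat.inj_left h3.1 he rfl
    · exact absurd (h1 _ h3.2).symm (h.mark_ne_right he h3.1.2)
  · refine ⟨(e.1, a), ⟨mem_next.2 (Or.inr ⟨⟨hs, h.start_ray_mem hm hc he h2 h1 h4⟩, h2⟩), rfl⟩, ?_⟩
    rintro ⟨e1, e2⟩ ⟨he', rfl : e1 = e.1⟩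
    rcases mem_next.1 he' with h8 | h8
    · have := h.mat.inj_left h8.1 he rfl
      rw [this] at h8
      exact absurd (h8.2.1 h6) h7
    · rcases h3 _ h8.2 with h9 | h9
      · exact absurd h9.symm (h.mark_ne_right he h8.1.2)
      · rw [h9]

lemma next_right (h : Marked S H M y) (hm : MinSt c (vset S H M y) (oset M y) D T X)
    (hc : CostFn c) {s : Pt} (hs : s ∈ H) : ∃! e, e ∈ next S H M y D T ∧ e.2 = s := by
  obtain ⟨e, ⟨he, rfl⟩, -⟩ := h.mat.2.2.1 s hs
  rcases h.head_rays hm hc he with ⟨h1, h2⟩ | ⟨a, h1, h2, h3, h4, h5, h6, h7⟩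
  · refine ⟨e, ⟨mem_next.2 (Or.inl ⟨he, h2⟩), rfl⟩, ?_⟩
    rintro ⟨e1, e2⟩ ⟨he', rfl : e2 = e.2⟩
    rcases mem_next.1 he' with h3 | h3
    · exact h.mat.inj_right h3.1 he rfl
    · exact absurd (h1 _ (hm.st.mem_swap h3.2)).symm (h.mark_ne_left he h3.1.1)
  · refine ⟨(a, e.2), ⟨mem_next.2 (Or.inr ⟨⟨h.head_ray_mem hm hc he h2 h1 h4, hs⟩,
      hm.st.mem_swap h2⟩), rfl⟩, ?_⟩
    rintro ⟨e1, e2⟩ ⟨he', rfl : e2 = e.2⟩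
    rcases mem_next.1 he' with h8 | h8
    · have := h.mat.inj_right h8.1 he rfl
      rw [this] at h8
      exact absurd (h8.2.1 h6) h7
    · rcases h3 _ (hm.st.mem_swap h8.2) with h9 | h9
      · exact absurd h9.symm (h.mark_ne_left he h8.1.1)
      · rw [h9]

lemma next_matching (h : Marked S H M y) (hm : MinSt c (vset S H M y) (oset M y) D T X)
    (hc : CostFn c) : IsBRMatching S H (next S H M y D T) := by
  refine ⟨fun e he => h.next_mem he, fun s hs => h.next_left hm hc hs,
    fun s hs => h.next_right hm hc hs, ?_⟩
  intro e he e' he' hne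
  obtain ⟨m1, m2⟩ := h.next_mem he
  obtain ⟨m3, m4⟩ := h.next_mem he'
  refine Set.eq_empty_iff_forall_notMem.2 fun z hz => hne ?_
  obtain ⟨d, hd, hzd, q1, -⟩ := h.pieces hm.st (next_cov he) hz.1
  obtain ⟨d', hd', hzd', q1', -⟩ := h.pieces hm.st (next_cov he') hz.2
  have hx : ∃ x, (x = d.1 ∨ x = d.2) ∧ (x = d'.1 ∨ x = d'.2) := by
    rcases hm.st.meet hd hd' hzd hzd' with (rfl | rfl) | h1
    · exact ⟨_, Or.inl rfl, Or.inl rfl⟩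
    · exact ⟨d.1, Or.inl rfl, Or.inr rfl⟩
    · exact ⟨z, h1⟩
  obtain ⟨x, hx, hx'⟩ := hx
  rcases q1 x hx with (r | r) | ⟨r0, r⟩ <;> rcases q1' x hx' with (r' | r') | ⟨r0', r'⟩
  · exact (h.next_left hm hc m1).unique ⟨he, rfl⟩ ⟨he', r'.symm.trans r⟩
  · exact absurd (r.symm.trans r') (h.ne_of_mem m1 m4)
  · exact absurd (r'.symm.trans r) (h.mark_ne_left r0' m1)
  · exact absurd (r'.symm.trans r) (h.ne_of_mem m3 m2)
  · exact (h.next_right hm hc m2).unique ⟨he, rfl⟩ ⟨he', r'.symm.trans r⟩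
  · exact absurd (r'.symm.trans r) (h.mark_ne_right r0' m2)
  · exact absurd (r.symm.trans r') (h.mark_ne_left r0 m3)
  · exact absurd (r.symm.trans r') (h.mark_ne_right r0 m4)
  · exact h.mark_inj r0 r0' (r.symm.trans r')

lemma next_compatible (h : Marked S H M y) (hm : MinSt c (vset S H M y) (oset M y) D T X) :
    Compatible M (next S H M y D T) := by
  intro e he e' he'
  by_cases hne : e = e'
  · exact Or.inl hne
  right
  rintro z ⟨hz, hz'⟩
  have m1 := h.left_mem he
  have m2 := h.right_mem he
  obtain ⟨m3, m4⟩ := h.next_mem he'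
  obtain ⟨d, hd, hzd, q1, -, q3⟩ := h.pieces hm.st (Or.inl he) hz
  obtain ⟨d', hd', hzd', q1', -⟩ := h.pieces hm.st (next_cov he') hz'
  have hno : ¬ (y e = d'.1 ∨ y e = d'.2) := by
    intro hx'
    rcases q1' _ hx' with (r' | r') | ⟨r0', r'⟩
    · exact h.mark_ne_left he m3 r'
    · exact h.mark_ne_right he m4 r'
    · exact hne (h.mark_inj he r0' r')
  rcases hm.st.meet hd hd' hzd hzd' with (rfl | rfl) | ⟨h1, h2⟩
  · exact absurd ((q3 he).imp Eq.symm Eq.symm) hno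
  · exact absurd ((q3 he).symm.imp Eq.symm Eq.symm) hno
  · have h3 : z = e.1 ∨ z = e.2 := by
      rcases q1 z h1 with r | ⟨-, rfl⟩
      · exact r
      · exact absurd h2 hno
    refine ⟨h3, ?_⟩
    rcases q1' z h2 with r | ⟨r0, r⟩
    · exact r
    · rcases h3 with h3 | h3
      · exact absurd (r.symm.trans h3) (h.mark_ne_left r0 m1)
      · exact absurd (r.symm.trans h3) (h.mark_ne_right r0 m2)

lemma sum_next_le (h : Marked S H M y) (hm : MinSt c (vset S H M y) (oset M y) D T X)
    (hc : CostFn c) : ∑ e ∈ next S H M y D T, c e.1 e.2 ≤ cost c (oset M y) D T := by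
  set K := M.filter (fun e => (e.1, y e) ∈ T ↔ (y e, e.1) ∈ T) with hK
  set R := (S ×ˢ H).filter (fun e => e ∈ D) with hR
  have hKM : ∀ e ∈ K, e ∈ M := fun e he => (mem_filter.1 he).1
  have hRm : ∀ e ∈ R, (e.1 ∈ S ∧ e.2 ∈ H) ∧ e ∈ D := fun e he => by
    simpa [hR, mem_filter, mem_product] using he
  have as : ∀ d ∈ oset M y, d.swap ∉ oset M y := hm.st.asym
  have w1 : ∀ e ∈ K, wt (oset M y) T (e.1, y e) = 1 := by
    intro e he
    have hl := (mem_filter.1 he).2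
    simp only [wt, if_pos (left_mem_oset (y := y) (hKM e he)), Prod.swap_prod_mk]
    simp only [hl]; ring
  have w2 : ∀ e ∈ K, wt (oset M y) T (y e, e.2) = 1 := by
    intro e he
    have hl := (mem_filter.1 he).2
    obtain ⟨l1, l2⟩ := h.mark_labels hm hc (hKM e he)
    simp only [wt, if_pos (right_mem_oset (y := y) (hKM e he)), Prod.swap_prod_mk]
    simp only [l1, l2, hl]; ring
  have w3 : ∀ e ∈ R, wt (oset M y) T e.swap = 1 := by
    intro e he
    obtain ⟨⟨m1, m2⟩, m3⟩ := hRm e he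
    obtain ⟨e', ⟨he', h1⟩, -⟩ := h.mat.2.1 _ m1
    have hne : e.2 ≠ y e' := (h.mark_ne_right he' m2).symm
    have n1 : e ∉ oset M y := fun hh => hne (h.nbr_left he' (Or.inl (by rw [h1]; exact hh)))
    have n2 : e.swap ∉ oset M y := fun hh => hne (h.nbr_left he' (Or.inr (by rw [h1]; exact hh)))
    have m3' : (e'.1, e.2) ∈ D := by rw [h1]; exact m3
    have hl : e.swap ∈ T ∧ e ∉ T := by
      rcases h.start_rays hm hc he' with ⟨h2, -⟩ | ⟨a, -, -, h3, h4, h5, -⟩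
      · exact absurd (h2 _ m3') hne
      · have := (h3 _ m3').resolve_left hne
        rw [← this, h1] at h4 h5
        exact ⟨h4, h5⟩
    simp only [wt, if_neg n1, if_neg n2, Prod.swap_swap, if_pos hl.1, if_neg hl.2]; ring
  set A1 := K.image fun e => (e.1, y e)
  set A2 := K.image fun e => (y e, e.2)
  set A3 := R.image Prod.swap
  have s1 : ∑ d ∈ A1, c d.1 d.2 * wt (oset M y) T d = ∑ e ∈ K, c e.1 (y e) := by
    rw [Finset.sum_image (g := fun e => (e.1, y e)) fun a ha b hb hab =>
      h.mat.inj_left (hKM a ha) (hKM b hb) (Prod.ext_iff.1 hab).1]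
    exact Finset.sum_congr rfl fun e he => by rw [w1 e he, mul_one]
  have s2 : ∑ d ∈ A2, c d.1 d.2 * wt (oset M y) T d = ∑ e ∈ K, c (y e) e.2 := by
    rw [Finset.sum_image (g := fun e => (y e, e.2)) fun a ha b hb hab =>
      h.mat.inj_right (hKM a ha) (hKM b hb) (Prod.ext_iff.1 hab).2]
    exact Finset.sum_congr rfl fun e he => by rw [w2 e he, mul_one]
  have s3 : ∑ d ∈ A3, c d.1 d.2 * wt (oset M y) T d = ∑ e ∈ R, c e.1 e.2 := by
    rw [Finset.sum_image fun a _ b _ hab => Prod.swap_injective hab]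
    exact Finset.sum_congr rfl fun e he => by
      rw [w3 e he, mul_one, Prod.fst_swap, Prod.snd_swap, hc.symm]
  have d12 : Disjoint A1 A2 := by
    rw [Finset.disjoint_left]
    intro d h1 h2
    obtain ⟨e, he, rfl⟩ := mem_image.1 h1
    obtain ⟨e', he', h3⟩ := mem_image.1 h2
    exact h.mark_ne_left (hKM e' he') (h.left_mem (hKM e he)) (Prod.ext_iff.1 h3).1
  have d3 : Disjoint (A1 ∪ A2) A3 := by
    rw [Finset.disjoint_left]
    intro d h1 h2
    obtain ⟨e, he, rfl⟩ := mem_image.1 h2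
    have m := (hRm e he).1
    rcases mem_union.1 h1 with h1 | h1 <;> obtain ⟨e', he', h3⟩ := mem_image.1 h1
    · exact h.ne_of_mem (h.left_mem (hKM e' he')) m.2 (Prod.ext_iff.1 h3).1
    · exact h.mark_ne_right (hKM e' he') m.2 (Prod.ext_iff.1 h3).1
  have hsub : A1 ∪ A2 ∪ A3 ⊆ D := by
    intro d hd
    rcases mem_union.1 hd with hd | hd
    · rcases mem_union.1 hd with hd | hd <;> obtain ⟨e, he, rfl⟩ := mem_image.1 hd
      · exact hm.st.sub (left_mem_oset (hKM e he))
      · exact hm.st.sub (right_mem_oset (hKM e he))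
    · obtain ⟨e, he, rfl⟩ := mem_image.1 hd
      exact hm.st.symm _ (hRm e he).2
  have hsum : ∑ e ∈ K, c e.1 e.2 = ∑ e ∈ K, c e.1 (y e) + ∑ e ∈ K, c (y e) e.2 := by
    rw [← Finset.sum_add_distrib]
    exact Finset.sum_congr rfl fun e he => hc.between _ _ _
      (openSegment_subset_segment _ _ _ (h.mem e (hKM e he)))
  calc ∑ e ∈ next S H M y D T, c e.1 e.2
      ≤ ∑ e ∈ K, c e.1 e.2 + ∑ e ∈ R, c e.1 e.2 := by
        have := Finset.sum_union_inter (s₁ := K) (s₂ := R) (f := fun e => c e.1 e.2)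
        have h0 : 0 ≤ ∑ e ∈ K ∩ R, c e.1 e.2 := Finset.sum_nonneg fun e _ => hc.nonneg _ _
        have h1 : next S H M y D T = K ∪ R := rfl
        rw [h1]; linarith
    _ = ∑ d ∈ A1 ∪ A2 ∪ A3, c d.1 d.2 * wt (oset M y) T d := by
        rw [Finset.sum_union d3, Finset.sum_union d12, s1, s2, s3, hsum]
    _ ≤ cost c (oset M y) D T :=
        Finset.sum_le_sum_of_subset_of_nonneg hsub fun d _ _ =>
          mul_nonneg (hc.nonneg _ _) (wt_nonneg _ _ _)

end Marked

/-- The linear functional `p ↦ a * p.1 + b * p.2`. -/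
def ln (a b : ℝ) (p : Pt) : ℝ := a * p.1 + b * p.2

lemma ln_ip (a b : ℝ) (p q : Pt) (t : ℝ) :
    ln a b (ip p q t) = (1 - t) * ln a b p + t * ln a b q := by
  simp only [ln, ip]; ring

/-- The Euclidean distance. -/
noncomputable def ed (p q : Pt) : ℝ := dist (⟨p.1, p.2⟩ : ℂ) ⟨q.1, q.2⟩

lemma ed_nonneg (p q : Pt) : 0 ≤ ed p q := dist_nonneg

lemma ed_comm (p q : Pt) : ed p q = ed q p := dist_comm _ _

lemma ed_tri (p q r : Pt) : ed p r ≤ ed p q + ed q r := dist_triangle _ _ _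

lemma ed_between {p q r : Pt} : ed p q + ed q r = ed p r ↔ q ∈ segment ℝ p r := by
  unfold ed
  rw [dist_add_dist_eq_iff, ← mem_segment_iff_wbtw, segment_eq_image', mem_seg]
  constructor
  · rintro ⟨t, ⟨h0, h1⟩, h2⟩
    refine ⟨t, h0, h1, ?_⟩
    have e1 := congrArg Complex.re h2
    have e2 := congrArg Complex.im h2
    simp at e1 e2
    ext <;> simp [ip] <;> linarith
  · rintro ⟨t, h0, h1, rfl⟩
    refine ⟨t, ⟨h0, h1⟩, ?_⟩
    apply Complex.ext <;> simp [ip]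

/-- The step function of the line `{p | ln a b p = c}`. -/
noncomputable def stp (a b c : ℝ) (p : Pt) : ℝ :=
  if ln a b p < c then 0 else if ln a b p = c then 1 / 2 else 1

lemma stp_mono {a b c : ℝ} {p q : Pt} (h : ln a b p ≤ ln a b q) : stp a b c p ≤ stp a b c q := by
  unfold stp
  split_ifs <;> first | (norm_num; done) | (exfalso; linarith) | skip
  all_goals exact absurd (le_antisymm (by linarith) (by linarith)) ‹¬ ln a b p = c›

/-- A cost dominated by the number of crossings with a line. -/
noncomputable def lcost (K a b c : ℝ) (p q : Pt) : ℝ := K * |stp a b c p - stp a b c q| + ed p q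

lemma lcost_costFn {K a b c : ℝ} (hK : 0 ≤ K) : CostFn (lcost K a b c) where
  symm p q := by unfold lcost; rw [abs_sub_comm, ed_comm]
  nonneg p q := by unfold lcost; have := ed_nonneg p q; positivity
  tri p q r := by
    have h1 := ed_tri p q r
    have h2 := mul_le_mul_of_nonneg_left (abs_sub_le (stp a b c p) (stp a b c q) (stp a b c r)) hK
    unfold lcost; linarith
  strict p q r h := by
    have h1 : ed p r < ed p q + ed q r := by
      refine (ed_tri p q r).lt_of_ne fun e => h ?_
      have h2 := cr_of_mem_seg (ed_between.1 e.symm)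
      rw [← kcr_true, kcr_swap', kcr_true, h2, neg_zero]
    have h2 := mul_le_mul_of_nonneg_left (abs_sub_le (stp a b c p) (stp a b c q) (stp a b c r)) hK
    unfold lcost; linarith
  between p q r h := by
    have h1 := ed_between.2 h
    obtain ⟨t, t0, t1, rfl⟩ := mem_seg.1 h
    have hl := ln_ip a b p r t
    have h2 : |stp a b c p - stp a b c r| = |stp a b c p - stp a b c (ip p r t)|
        + |stp a b c (ip p r t) - stp a b c r| := by
      rcases le_total (ln a b p) (ln a b r) with h3 | h3
      · have m1 : ln a b p ≤ ln a b (ip p r t) := by rw [hl]; nlinarith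
        have m2 : ln a b (ip p r t) ≤ ln a b r := by rw [hl]; nlinarith
        have n1 := stp_mono (c := c) m1
        have n2 := stp_mono (c := c) m2
        rw [abs_of_nonpos (by linarith), abs_of_nonpos (by linarith), abs_of_nonpos (by linarith)]
        ring
      · have m1 : ln a b (ip p r t) ≤ ln a b p := by rw [hl]; nlinarith
        have m2 : ln a b r ≤ ln a b (ip p r t) := by rw [hl]; nlinarith
        have n1 := stp_mono (c := c) m1
        have n2 := stp_mono (c := c) m2
        rw [abs_of_nonneg (by linarith), abs_of_nonneg (by linarith), abs_of_nonneg (by linarith)]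
        ring
    unfold lcost
    rw [h2, ← h1]; ring

lemma stp_lt {a b c : ℝ} {p : Pt} (h : ln a b p < c) : stp a b c p = 0 := if_pos h

lemma stp_eq {a b c : ℝ} {p : Pt} (h : ln a b p = c) : stp a b c p = 1 / 2 := by
  unfold stp; rw [if_neg (by linarith), if_pos h]

lemma stp_gt {a b c : ℝ} {p : Pt} (h : c < ln a b p) : stp a b c p = 1 := by
  unfold stp; rw [if_neg (by linarith), if_neg (by linarith)]

lemma halves_disj {x z w p : Pt} (hne : x ≠ w) (h : z ∈ openSegment ℝ x w)
    (hp : p ∈ segment ℝ x z) (hp' : p ∈ segment ℝ z w) : p = z := by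
  obtain ⟨t, t0, t1, rfl⟩ := mem_oseg.1 h
  obtain ⟨r, r0, r1, rfl⟩ := mem_seg.1 hp
  obtain ⟨s, s0, s1, h1⟩ := mem_seg.1 hp'
  rw [ip_ip, ip_ip_right] at h1
  have h2 := ip_inj hne h1
  have h3 : r = 1 := by
    by_contra h4
    have : r < 1 := lt_of_le_of_ne r1 h4
    nlinarith [mul_nonneg s0 (by linarith : (0:ℝ) ≤ 1 - t)]
  rw [h3, ip_one]

namespace Marked

variable {S H : Finset Pt} {M : Finset (Pt × Pt)} {y : Pt × Pt → Pt}

lemma start_cases (d : Pt × Pt) (hd : d ∈ oset M y ∪ (oset M y).image Prod.swap) :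
    d ∈ oset M y ∨ d.swap ∈ oset M y := by
  rcases mem_union.1 hd with h1 | h1
  · exact Or.inl h1
  · obtain ⟨e, he, rfl⟩ := mem_image.1 h1
    exact Or.inr (by rwa [Prod.swap_swap])

lemma start_mem {d : Pt × Pt} (hd : d ∈ oset M y ∨ d.swap ∈ oset M y) :
    d ∈ oset M y ∪ (oset M y).image Prod.swap := by
  rcases hd with h1 | h1
  · exact mem_union_left _ h1
  · exact mem_union_right _ (mem_image.2 ⟨_, h1, Prod.swap_swap d⟩)

lemma oset_asym (h : Marked S H M y) {d : Pt × Pt} (hd : d ∈ oset M y) : d.swap ∉ oset M y := by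
  intro h2
  obtain ⟨e, he, rfl | rfl⟩ := mem_oset.1 hd <;> obtain ⟨e', he', h3 | h3⟩ := mem_oset.1 h2 <;>
    obtain ⟨h4, h5⟩ := Prod.ext_iff.1 h3 <;> simp only [Prod.swap_prod_mk] at h4 h5
  · exact h.mark_ne_left he (h.left_mem he') h4
  · exact h.ne_of_mem (h.left_mem he) (h.right_mem he') h5
  · exact h.ne_of_mem (h.left_mem he') (h.right_mem he) h4.symm
  · exact h.mark_ne_right he (h.right_mem he') h5

lemma plane_oset (h : Marked S H M y) {d d' : Pt × Pt} (hd : d ∈ oset M y) (hd' : d' ∈ oset M y)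
    (hne : d' ≠ d) {z : Pt} (hz : z ∈ openSegment ℝ d.1 d.2) : z ∉ segment ℝ d'.1 d'.2 := by
  intro hz'
  have key : ∀ {d : Pt × Pt} {e : Pt × Pt}, e ∈ M → (d = (e.1, y e) ∨ d = (y e, e.2)) →
      ∀ z ∈ segment ℝ d.1 d.2, z ∈ segment ℝ e.1 e.2 := by
    intro d e he hde z hz
    have hs := openSegment_subset_segment ℝ _ _ (h.mem e he)
    rcases hde with rfl | rfl
    · exact (convex_segment _ _).segment_subset (left_mem_segment ℝ _ _) hs hz
    · exact (convex_segment _ _).segment_subset hs (right_mem_segment ℝ _ _) hz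
  obtain ⟨e, he, h1⟩ := mem_oset.1 hd
  obtain ⟨e', he', h2⟩ := mem_oset.1 hd'
  by_cases hee : e = e'
  · subst hee
    have hee := h.ne_of_mem (h.left_mem he) (h.right_mem he)
    have hy := h.mark_ne he
    rcases h1 with rfl | rfl <;> rcases h2 with rfl | rfl
    · exact hne rfl
    · have := halves_disj hee (h.mem e he) (openSegment_subset_segment ℝ _ _ hz) hz'
      rw [this] at hz
      exact right_notMem_oseg hy.1.symm hz
    · have := halves_disj hee (h.mem e he) hz' (openSegment_subset_segment ℝ _ _ hz)
      rw [this] at hz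
      exact left_notMem_oseg hy.2 hz
    · exact hne rfl
  · have := h.mat.2.2.2 e he e' he' hee
    exact Set.eq_empty_iff_forall_notMem.1 this z
      ⟨key he h1 z (openSegment_subset_segment ℝ _ _ hz), key he' h2 z hz'⟩

lemma oset_verts {d : Pt × Pt} (h : Marked S H M y) (hd : d ∈ oset M y) :
    d.1 ∈ vset S H M y ∧ d.2 ∈ vset S H M y := by
  obtain ⟨e, he, rfl | rfl⟩ := mem_oset.1 hd
  · exact ⟨mem_union_left _ (mem_union_left _ (h.mat.1 _ he).1),
      mem_union_right _ (mem_image_of_mem _ he)⟩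
  · exact ⟨mem_union_right _ (mem_image_of_mem _ he),
      mem_union_left _ (mem_union_right _ (h.mat.1 _ he).2)⟩

lemma start_st (h : Marked S H M y) :
    St (vset S H M y) (oset M y) (oset M y ∪ (oset M y).image Prod.swap) ∅ ∅ where
  verts d hd := by
    rcases start_cases d hd with h1 | h1
    · exact h.oset_verts h1
    · exact (h.oset_verts h1).symm
  symm d hd := start_mem (by rw [Prod.swap_swap]; exact (start_cases d hd).symm)
  ne d hd := by
    have key : ∀ d ∈ oset M y, d.1 ≠ d.2 := by
      intro d hd
      obtain ⟨e, he, rfl | rfl⟩ := mem_oset.1 hd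
      · exact (h.mark_ne he).1.symm
      · exact (h.mark_ne he).2
    rcases start_cases d hd with h1 | h1
    · exact key d h1
    · exact (key _ h1).symm
  sub := subset_union_left
  asym _ hd := h.oset_asym hd
  cov v hv := by
    rcases mem_union.1 hv with hv | hv
    · rcases mem_union.1 hv with hv | hv
      · obtain ⟨e, ⟨he, rfl⟩, -⟩ := h.mat.2.1 v hv
        exact ⟨_, Or.inl (left_mem_oset he)⟩
      · obtain ⟨e, ⟨he, rfl⟩, -⟩ := h.mat.2.2.1 v hv
        exact ⟨_, Or.inr (right_mem_oset he)⟩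
    · obtain ⟨e, he, rfl⟩ := mem_image.1 hv
      exact ⟨_, Or.inl (right_mem_oset he)⟩
  tsub := empty_subset _
  plane d hd e he h1 h2 z hz := by
    rcases start_cases d hd with hd | hd <;> rcases start_cases e he with he | he
    · exact h.plane_oset hd he h1 hz
    · have := h.plane_oset hd he (fun hh => h2 (by rw [← hh, Prod.swap_swap])) hz
      rwa [Prod.fst_swap, Prod.snd_swap, segment_symm] at this
    · refine h.plane_oset hd he h2 (z := z) ?_
      rwa [Prod.fst_swap, Prod.snd_swap, openSegment_symm]
    · have := h.plane_oset hd he (fun hh => h1 (Prod.swap_injective hh)) (z := z) (by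
        rwa [Prod.fst_swap, Prod.snd_swap, openSegment_symm])
      rwa [Prod.fst_swap, Prod.snd_swap, segment_symm] at this
  face _ _ _ := by simp
  side _ _ _ _ _ _ _ := by simp

lemma start_cost (h : Marked S H M y) {c : Pt → Pt → ℝ} (hc : CostFn c) :
    cost c (oset M y) (oset M y ∪ (oset M y).image Prod.swap) ∅ = ∑ e ∈ M, c e.1 e.2 := by
  have h1 : cost c (oset M y) (oset M y ∪ (oset M y).image Prod.swap) ∅
      = ∑ d ∈ oset M y, c d.1 d.2 := by
    unfold cost
    symm
    apply Finset.sum_subset_zero_on_sdiff subset_union_left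
    · intro d hd
      obtain ⟨-, h2⟩ := mem_sdiff.1 hd
      simp [wt, h2]
    · intro d hd
      simp [wt, hd]
  rw [h1, oset, Finset.sum_union, Finset.sum_image, Finset.sum_image, ← Finset.sum_add_distrib]
  · exact Finset.sum_congr rfl fun e he => (hc.between _ _ _
      (openSegment_subset_segment _ _ _ (h.mem e he))).symm
  · exact fun a ha b hb hab => h.mat.inj_right ha hb (Prod.ext_iff.1 hab).2
  · exact fun a ha b hb hab => h.mat.inj_left ha hb (Prod.ext_iff.1 hab).1
  · rw [Finset.disjoint_left]
    intro d h1 h2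
    obtain ⟨e, he, rfl⟩ := mem_image.1 h1
    obtain ⟨e', he', h3⟩ := mem_image.1 h2
    exact h.mark_ne_left he' (h.left_mem he) (Prod.ext_iff.1 h3).1

end Marked

/-- Points on a line through `v` and `a` at a common level are separated by the level. -/
lemma level_side {α β c : ℝ} {κ : Bool} {v a p w : Pt} (hv : ln α β v = c) (ha : ln α β a = c) :
    (ln α β p - c) * kcr κ v a w = (ln α β w - c) * kcr κ v a p := by
  subst hv
  simp only [kcr, cr, ln] at *
  linear_combination (sg κ * ((p.1 - v.1) * (w.2 - v.2) - (p.2 - v.2) * (w.1 - v.1))) * ha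

lemma level_neg {α β c : ℝ} {κ : Bool} {v a p w : Pt} (hv : ln α β v = c) (ha : ln α β a = c)
    (hw : ln α β w < c) (hw' : 0 < kcr κ v a w) : 0 < kcr κ v a p ↔ ln α β p < c := by
  have := level_side (κ := κ) (p := p) (w := w) hv ha
  constructor
  · intro h; by_contra h1; push Not at h1
    nlinarith [mul_nonneg (sub_nonneg.2 h1) hw'.le, mul_pos (sub_pos.2 hw) h]
  · intro h; by_contra h1; push Not at h1
    nlinarith [mul_pos (sub_pos.2 h) hw', mul_nonneg (sub_nonneg.2 hw.le) (neg_nonneg.2 h1)]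

lemma ctri_level {α β c : ℝ} {κ : Bool} {v a u x : Pt} (hΔ : 0 < kcr κ v a u)
    (hx : x ∈ ctri κ v a u) (hv : ln α β v = c) (ha : ln α β a < c) (hu : ln α β u < c)
    (hxc : c ≤ ln α β x) : x = v := by
  obtain ⟨b1, b2⟩ := bary κ v a u x
  have hs := kcr_sum κ v a u x
  obtain ⟨h1, h2, h3⟩ := hx
  have e : kcr κ v a u * ln α β x = kcr κ a u x * ln α β v + kcr κ u v x * ln α β a
      + kcr κ v a x * ln α β u := by
    simp only [ln]; linear_combination α * b1 + β * b2
  have key : kcr κ v a u * (ln α β x - c)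
      = kcr κ u v x * (ln α β a - c) + kcr κ v a x * (ln α β u - c) := by
    linear_combination e + kcr κ a u x * hv + c * hs
  have h4 := mul_nonneg hΔ.le (sub_nonneg.2 hxc)
  have z1 : kcr κ u v x = 0 := by
    by_contra hne
    have := lt_of_le_of_ne h3 (Ne.symm hne)
    linarith [mul_pos this (sub_pos.2 ha), mul_nonneg h1 (sub_nonneg.2 hu.le)]
  have z2 : kcr κ v a x = 0 := by
    by_contra hne
    have := lt_of_le_of_ne h1 (Ne.symm hne)
    linarith [mul_pos this (sub_pos.2 hu), mul_nonneg h3 (sub_nonneg.2 ha.le)]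
  rw [z1, z2] at b1 b2
  have z3 : kcr κ a u x = kcr κ v a u := by linarith
  rw [z3] at b1 b2
  ext
  · exact mul_left_cancel₀ hΔ.ne' (by linarith)
  · exact mul_left_cancel₀ hΔ.ne' (by linarith)

namespace Marked

variable {S H : Finset Pt} {M : Finset (Pt × Pt)} {y : Pt × Pt → Pt}

lemma uncross (h : Marked S H M y) {a b c K : ℝ} (hK : 0 ≤ K) {e1 e2 : Pt × Pt} (he1 : e1 ∈ M)
    (he2 : e2 ∈ M) (hy1 : ln a b (y e1) = c) (hy2 : ln a b (y e2) = c) (hh1 : ln a b e1.2 < c)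
    (hs1 : c < ln a b e1.1) (hs2 : ln a b e2.1 < c) (hh2 : c < ln a b e2.2)
    (hcr : 0 < cr e1.1 e1.2 (y e2))
    (hfree : ∀ z ∈ openSegment ℝ (y e1) (y e2),
      z ∉ carrier (oset M y ∪ (oset M y).image Prod.swap)) :
    ∃ D T X, St (vset S H M y) (oset M y) D T X ∧ ∃ u ∈ vset S H M y,
      cost (lcost K a b c) (oset M y) D T ≤ ∑ e ∈ M, lcost K a b c e.1 e.2 - K
        + ed (y e1) (y e2) + ed u (y e1) + ed u (y e2) := by
  have hc := lcost_costFn (a := a) (b := b) (c := c) hK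
  have h0 := h.start_st
  have hcost0 := h.start_cost hc
  set D0 := oset M y ∪ (oset M y).image Prod.swap with hD0
  set V := vset S H M y
  set O := oset M y
  set cc := lcost K a b c
  have hyV : ∀ e ∈ M, y e ∈ V := fun e he => mem_union_right _ (mem_image_of_mem _ he)
  have hne12 : e1 ≠ e2 := by rintro rfl; linarith
  have hyne : y e1 ≠ y e2 := fun hh => hne12 (h.mark_inj he1 he2 hh)
  have nbr0 : ∀ e ∈ M, ∀ b, (y e, b) ∈ D0 → b = e.1 ∨ b = e.2 := fun e he b hb =>
    h.nbr_mark he (start_cases _ hb)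
  have hn12 : (y e1, y e2) ∉ D0 := by
    intro hh
    rcases nbr0 e1 he1 _ hh with r | r
    · exact h.mark_ne_left he2 (h.left_mem he1) r
    · exact h.mark_ne_right he2 (h.right_mem he1) r
  obtain ⟨T1, st1, hT1, hT1'⟩ := h0.add (hyV _ he1) (hyV _ he2) hyne hn12 hfree
  have hc1 := h0.add_cost (c := cc) hn12 hT1 hT1'
  set D1 := insert (y e1, y e2) (insert (y e2, y e1) D0) with hD1
  have D01 : D0 ⊆ D1 := fun d hd => mem_insert_of_mem (mem_insert_of_mem hd)
  have lab1 : ∀ d ∈ D0, d ∉ T1 := fun d hd hh => absurd ((hT1 d hd).1 hh) (notMem_empty d)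
  have m12 : (y e1, y e2) ∈ D1 := mem_insert_self _ _
  have o1 : (y e1, e1.2) ∈ O := right_mem_oset he1
  have o2 : (e2.1, y e2) ∈ O := left_mem_oset he2
  have i1 : (y e1, e1.2) ∈ D0 := mem_union_left _ o1
  have i2 : (e2.1, y e2) ∈ D0 := mem_union_left _ o2
  have nbr1 : ∀ b, (y e1, b) ∈ D1 → b = e1.1 ∨ b = e1.2 ∨ b = y e2 := by
    intro b hb
    rcases mem_insert.1 hb with hb | hb
    · exact Or.inr (Or.inr (Prod.ext_iff.1 hb).2)
    rcases mem_insert.1 hb with hb | hb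
    · exact absurd (Prod.ext_iff.1 hb).1 hyne
    · exact (nbr0 e1 he1 b hb).imp id Or.inl
  have nbr2 : ∀ b, (y e2, b) ∈ D1 → b = e2.1 ∨ b = e2.2 ∨ b = y e1 := by
    intro b hb
    rcases mem_insert.1 hb with hb | hb
    · exact absurd (Prod.ext_iff.1 hb).1.symm hyne
    rcases mem_insert.1 hb with hb | hb
    · exact Or.inr (Or.inr (Prod.ext_iff.1 hb).2)
    · exact (nbr0 e2 he2 b hb).imp id Or.inl
  obtain ⟨r1, r10, r11, hr1⟩ := mem_oseg.1 (h.mem e1 he1)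
  obtain ⟨r2, r20, r21, hr2⟩ := mem_oseg.1 (h.mem e2 he2)
  -- the position of the heads with respect to the new edge
  have hΔ : 0 < kcr false (y e1) (y e2) e1.2 := by
    have : kcr false (y e1) (y e2) e1.2 = (1 - r1) * cr e1.1 e1.2 (y e2) := by
      rw [hr1]; simp only [kcr_false, cr, ip]; ring
    rw [this]; exact mul_pos (by linarith) hcr
  have side : ∀ p, 0 < kcr false (y e1) (y e2) p ↔ ln a b p < c := fun p =>
    level_neg hy1 hy2 hh1 hΔ
  have opp1 : ∀ q, kcr false (y e1) q e1.1 * (1 - r1) = - (r1 * kcr false (y e1) q e1.2) := by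
    intro q; rw [hr1]; simp only [kcr_false, cr, ip]; ring
  obtain ⟨u, huV, hut, hua, huv, hBu, -, -, huw, hufree, D2, T2, X2, st2, D12, hvu2, hua2, hD2,
    hT2, hchi2, hchi2', hc2⟩ := st1.step (κ := false) hc m12 (D01 i1) hΔ (by
      intro b hb hb0
      rcases nbr1 b hb with rfl | rfl | rfl
      · have := (side _).1 hb0; linarith
      · simp
      · simp at hb0)
  have huL : ln a b u < c := (side u).1 hBu
  have m21 : (y e2, u) ∈ D2 := st2.mem_swap hua2
  have j2 : (y e2, e2.1) ∈ D1 := st1.mem_swap (D01 i2)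
  -- the rays at the two marks after the first step
  have nbr1' : ∀ b, (y e1, b) ∈ D2 → b = e1.1 ∨ b = e1.2 ∨ b = y e2 ∨ b = u := by
    intro b hb
    rcases hD2 _ hb with r | r | r | r | r
    · rcases nbr1 b r with r | r | r <;> simp [r]
    · exact absurd (Prod.ext_iff.1 r).1 hyne
    · exact absurd (Prod.ext_iff.1 r).1.symm huv
    · exact Or.inr (Or.inr (Or.inr (Prod.ext_iff.1 r).2))
    · exact absurd (Prod.ext_iff.1 r).1.symm huv
  have nbr2' : ∀ b, (y e2, b) ∈ D2 → b = e2.1 ∨ b = e2.2 ∨ b = y e1 ∨ b = u := by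
    intro b hb
    rcases hD2 _ hb with r | r | r | r | r
    · rcases nbr2 b r with r | r | r <;> simp [r]
    · exact Or.inr (Or.inr (Or.inr (Prod.ext_iff.1 r).2))
    · exact absurd (Prod.ext_iff.1 r).1.symm hua
    · exact absurd (Prod.ext_iff.1 r).1.symm hyne
    · exact absurd (Prod.ext_iff.1 r).1.symm hua
  have cr2 : u ≠ e2.1 → 0 < kcr true (y e2) u e2.1 := by
    intro hus
    by_contra hneg
    have hs2p := (side e2.1).2 hs2
    rcases (not_lt.1 hneg).lt_or_eq with hlt | heq
    · obtain ⟨t, t0, t1, ht⟩ : ∃ t : ℝ, 0 < t ∧ t ≤ 1 ∧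
          0 < (1 - t) * kcr false u (y e1) (y e2) + t * kcr false u (y e1) e2.1 := by
        have hp : 0 < kcr false u (y e1) (y e2) := by rw [← kcr_rot]; exact hBu
        rcases le_or_gt 0 (kcr false u (y e1) e2.1) with h5 | h5
        · exact ⟨1 / 2, by norm_num, by norm_num, by nlinarith⟩
        · set A := kcr false u (y e1) (y e2)
          set B := kcr false u (y e1) e2.1
          refine ⟨A / (2 * (A - B)), by apply div_pos hp; linarith, ?_, ?_⟩
          · rw [div_le_one (by linarith)]; linarith
          · have : (1 - A / (2 * (A - B))) * A + A / (2 * (A - B)) * B = A / 2 := by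
              have : A - B ≠ 0 := by linarith
              field_simp; ring
            rw [this]; linarith
      refine hufree (ip (y e2) e2.1 t) ⟨?_, ?_, ?_⟩ ⟨_, j2, ip_mem_seg t0.le t1⟩
      · rw [kcr_ip, kcr_right]
        have := mul_pos t0 hs2p; linarith
      · rw [kcr_ip, kcr_left]
        have h6 : 0 < kcr false (y e2) u e2.1 := by
          rw [kcr_false]; rw [kcr_true] at hlt; linarith
        have := mul_pos t0 h6; linarith
      · rw [kcr_ip]; exact ht
    · obtain ⟨r, hr⟩ := exists_ip_of_cr (Ne.symm hua) (kcr_eq_zero_iff.1 heq)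
      have hl := ln_ip a b (y e2) u r
      rw [← hr, hy2] at hl
      have r0 : 0 < r := by
        by_contra hr0; push Not at hr0
        nlinarith [mul_nonneg (neg_nonneg.2 hr0) (sub_nonneg.2 huL.le)]
      rcases lt_trichotomy r 1 with h5 | h5 | h5
      · refine st2.vert_notMem ((st1.verts _ j2).2) m21 ?_
        simp only [hr]; exact ip_mem_oseg r0 h5
      · rw [h5, ip_one] at hr; exact hus hr.symm
      · refine st1.vert_notMem huV j2 (mem_oseg.2 ⟨1 / r, by positivity, ?_, ?_⟩)
        · rw [div_lt_one r0]; exact h5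
        · rw [hr, ip_ip, one_div_mul_cancel r0.ne', ip_one]
  -- costs of the edges involved
  have k12 : cc (y e1) (y e2) = ed (y e1) (y e2) := by
    simp only [cc, lcost]; rw [stp_eq hy1, stp_eq hy2]; simp
  have klow : ∀ p q, ln a b p < c → ln a b q < c → cc p q = ed p q := by
    intro p q hp hq; simp only [cc, lcost]; rw [stp_lt hp, stp_lt hq]; simp
  have khalf : ∀ p q, ln a b p = c → ln a b q < c → cc p q = K / 2 + ed p q := by
    intro p q hp hq; simp only [cc, lcost]; rw [stp_eq hp, stp_lt hq]
    rw [sub_zero, abs_of_pos (by norm_num)]; ring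
  have chi12 : chi O T1 (kd false (y e1) (y e2)) = 1 := by
    refine chi_eq_one_of_iff hT1' (fun hh => hn12 (mem_union_left _ hh)) fun hh => hn12 ?_
    exact h0.mem_swap (mem_union_left _ hh)
  have chi_neg : ∀ {T : Finset (Pt × Pt)} {d : Pt × Pt}, d ∈ O → d ∉ T → chi O T d = -1 := by
    intro T d h1 h2; simp [chi, h1, h2]
  have hau : (y e2, u) ∈ D1 → u = e2.1 := by
    intro hh
    rcases nbr2 u hh with r | r | r
    · exact r
    · rw [r] at huL; linarith
    · exact absurd r huv
  have hauD : (y e2, u) ∈ D1 ↔ u = e2.1 := ⟨hau, fun hh => by rw [hh]; exact j2⟩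
  rw [chi12, k12, hc1, hcost0, one_mul] at hc2
  have e1ne : e1.2 ≠ e2.1 := (h.ne_of_mem (h.left_mem he2) (h.right_mem he1)).symm
  have l1 : u ≠ e1.2 → (y e1, e1.2) ∉ T2 := by
    intro hne hh
    refine lab1 _ i1 ((hT2 _ (D01 i1) ?_ ?_ ?_ ?_ ?_ ?_).1 hh) <;> intro r <;>
      obtain ⟨ra, rb⟩ := Prod.ext_iff.1 r <;> simp only at ra rb
    · exact h.mark_ne_right he2 (h.right_mem he1) rb.symm
    · exact hyne ra
    · exact hyne ra
    · exact huv ra.symm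
    · exact hne rb.symm
    · exact huv ra.symm
  have l2 : u ≠ e2.1 → (e2.1, y e2) ∉ T2 := by
    intro hne hh
    refine lab1 _ i2 ((hT2 _ (D01 i2) ?_ ?_ ?_ ?_ ?_ ?_).1 hh) <;> intro r <;>
      obtain ⟨ra, rb⟩ := Prod.ext_iff.1 r <;> simp only at ra rb
    · exact h.mark_ne_left he1 (h.left_mem he2) ra.symm
    · exact h.mark_ne_left he2 (h.left_mem he2) ra.symm
    · exact h.mark_ne_left he2 (h.left_mem he2) ra.symm
    · exact hne ra.symm
    · exact h.mark_ne_left he1 (h.left_mem he2) ra.symm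
    · exact hne ra.symm
  have smallb : ∀ {e : Pt} {v : Pt} {τ : ℝ}, ln a b v = c → ln a b e < c → 0 < τ → τ ≤ 1 →
      cc u (ip v e τ) + cc (ip v e τ) e ≤ ed u v + ed v e := by
    intro e v τ hv he t0 t1
    have hx : ln a b (ip v e τ) < c := by rw [ln_ip, hv]; nlinarith
    rw [klow _ _ huL hx, klow _ _ hx he]
    have := ed_between.2 (ip_mem_seg (x := v) (y := e) t0.le t1)
    have := ed_tri u v (ip v e τ)
    linarith
  have n1 : ed u (y e1) = ed (y e1) u := ed_comm _ _
  have n2 : ed u (y e2) = ed (y e2) u := ed_comm _ _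
  have p1 := ed_nonneg u (y e1)
  have p2 := ed_nonneg u (y e2)
  -- cutting off the head of the first edge
  obtain ⟨D3, T3, X3, st3, D23, hD3, hT3, hc3⟩ : ∃ D3 T3 X3, St V O D3 T3 X3 ∧ D2 ⊆ D3 ∧
      (∀ b, (y e2, b) ∈ D3 → (y e2, b) ∈ D2) ∧
      (∀ d ∈ D2, d.1 = y e2 ∨ d.2 = y e2 → (d ∈ T3 ↔ d ∈ T2)) ∧
      cost cc O D3 T3 ≤ ∑ e ∈ M, cc e.1 e.2 + ed (y e1) (y e2)
        + (if (y e2, u) ∈ D1 then chi O T1 (kd false (y e2) u) else 1) * cc (y e2) u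
        - K / 2 + ed u (y e1) := by
    by_cases hu1 : u = e1.2
    · refine ⟨D2, T2, X2, st2, Subset.refl _, fun _ hb => hb, fun _ _ _ => Iff.rfl, ?_⟩
      have hk : chi O T1 (kd false e1.2 (y e1)) = -1 := chi_neg o1 (lab1 _ i1)
      rw [if_pos hu1, hk, khalf _ _ hy1 huL] at hc2
      linarith
    · rw [if_neg hu1] at hc2
      have hΔ' := huw.resolve_left hu1
      have i1' := D12 (D01 i1)
      obtain ⟨τ, t0, t1, D3, T3, X3, st3, hc3, D23, hD3, hT3⟩ :=
        st2.chain_small (κ := false) hc hvu2 i1' hΔ' (by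
          intro b hb hb0
          rcases nbr1' b hb with rfl | rfl | rfl | rfl
          · exfalso
            have := opp1 u
            rw [kcr_swap'] at hΔ'
            have h6 : kcr false (y e1) u e1.2 = - kcr false (y e1) e1.2 u := kcr_swap' _ _ _ _
            nlinarith [mul_pos hb0 (by linarith : (0:ℝ) < 1 - r1), mul_pos r10 hΔ']
          · simp
          · exfalso
            rw [kcr_swap'] at hb0
            linarith
          · simp at hb0)
      have nin : y e2 ∉ ctri false (y e1) u e1.2 := fun hin =>
        hyne (ctri_level hΔ' hin hy1 huL hh1 hy2.ge).symm
      have hk1 := hchi2 hu1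
      have hk2 : chi O T2 (kd false e1.2 (y e1)) = -1 := chi_neg o1 (l1 hu1)
      have sm := smallb hy1 hh1 t0 t1
      rw [hk1, hk2, hc.symm e1.2, khalf _ _ hy1 hh1] at hc3
      refine ⟨D3, T3, X3, st3, D23, ?_, ?_, by linarith⟩
      · intro b hb
        exact (hD3 _ hb).resolve_right fun hh => nin hh.1
      · intro d hd hd'
        refine hT3 d hd fun hh => nin ?_
        rcases hd' with r | r
        · rw [← r]; exact hh.1
        · rw [← r]; exact hh.2
  by_cases hu2 : u = e2.1
  · refine ⟨D3, T3, X3, st3, u, huV, ?_⟩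
    have hk : chi O T1 (kd false (y e2) u) = -1 := chi_neg (by rw [hu2]; exact o2)
      (by rw [hu2]; exact lab1 _ i2)
    rw [if_pos (hauD.2 hu2), hk, khalf _ _ hy2 huL] at hc3
    linarith
  · rw [if_neg fun hh => hu2 (hauD.1 hh)] at hc3
    have hΔ' := cr2 hu2
    obtain ⟨τ, t0, t1, D4, T4, X4, st4, hc4, -⟩ :=
      st3.chain_small (κ := true) hc (D23 m21) (D23 (D12 j2)) hΔ' (by
        intro b hb hb0
        rcases nbr2' b (hD3 b hb) with rfl | rfl | rfl | rfl
        · simp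
        · have : kcr true (y e2) e2.2 e2.1 = 0 := by
            rw [hr2]; simp only [kcr_true, cr, ip]; ring
          exact this.le
        · exfalso
          have h6 : kcr true (y e2) u (y e1) = - kcr false (y e1) (y e2) u := by
            simp only [kcr_true, kcr_false, cr]; ring
          linarith
        · simp at hb0)
    have hk1 : chi O T3 (kd true (y e2) u) = -1 := by
      have h7 := hchi2' fun hh => hu2 (hauD.1 hh)
      rw [← h7]
      exact chi_congr (hT3 _ m21 (Or.inl rfl)) (hT3 _ hua2 (Or.inr rfl))
    have hk2 : chi O T3 (kd true e2.1 (y e2)) = -1 :=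
      chi_neg o2 fun hh => l2 hu2 ((hT3 _ (D12 (D01 i2)) (Or.inr rfl)).1 hh)
    have sm := smallb hy2 hs2 t0 t1
    rw [hk1, hk2, hc.symm e2.1, khalf _ _ hy2 hs2] at hc4
    exact ⟨D4, T4, X4, st4, u, huV, by linarith⟩

end Marked

/-- The edge has its endpoints on different sides of a line. -/
def Xes (a b c : ℝ) (e : Pt × Pt) : Prop :=
  (ln a b e.1 < c ∧ c < ln a b e.2) ∨ (ln a b e.2 < c ∧ c < ln a b e.1)

/-- The number of edges crossing a line. -/
noncomputable def xc (a b c : ℝ) (M : Finset (Pt × Pt)) : ℕ := (M.filter (Xes a b c)).card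

lemma Xes_swap {a b c : ℝ} {e : Pt × Pt} : Xes a b c e.swap ↔ Xes a b c e := by
  unfold Xes; rw [Prod.fst_swap, Prod.snd_swap]; exact or_comm

lemma xc_swap {a b c : ℝ} (M : Finset (Pt × Pt)) : xc a b c (M.image Prod.swap) = xc a b c M := by
  unfold xc
  rw [Finset.filter_image, Finset.card_image_of_injective _ Prod.swap_injective]
  congr 1
  exact Finset.filter_congr fun e _ => Xes_swap

lemma image_swap_swap (M : Finset (Pt × Pt)) : (M.image Prod.swap).image Prod.swap = M := by
  rw [Finset.image_image, Prod.swap_swap_eq, Finset.image_id]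

lemma mem_image_swap {M : Finset (Pt × Pt)} {e : Pt × Pt} :
    e ∈ M.image Prod.swap ↔ e.swap ∈ M := by
  constructor
  · intro h; obtain ⟨e, he, rfl⟩ := mem_image.1 h; rwa [Prod.swap_swap]
  · intro h; exact mem_image.2 ⟨_, h, Prod.swap_swap e⟩

lemma IsBRMatching.swap {B R : Finset Pt} {M : Finset (Pt × Pt)} (h : IsBRMatching B R M) :
    IsBRMatching R B (M.image Prod.swap) := by
  refine ⟨fun e he => (h.1 _ (mem_image_swap.1 he)).symm, fun r hr => ?_, fun r hr => ?_, ?_⟩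
  · obtain ⟨e, ⟨he, h1⟩, h2⟩ := h.2.2.1 r hr
    refine ⟨e.swap, ⟨mem_image_of_mem _ he, h1⟩, fun e' ⟨he', h1'⟩ => ?_⟩
    rw [← h2 e'.swap ⟨mem_image_swap.1 he', h1'⟩, Prod.swap_swap]
  · obtain ⟨e, ⟨he, h1⟩, h2⟩ := h.2.1 r hr
    refine ⟨e.swap, ⟨mem_image_of_mem _ he, h1⟩, fun e' ⟨he', h1'⟩ => ?_⟩
    rw [← h2 e'.swap ⟨mem_image_swap.1 he', h1'⟩, Prod.swap_swap]
  · intro e he e' he' hne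
    have := h.2.2.2 _ (mem_image_swap.1 he) _ (mem_image_swap.1 he')
      fun hh => hne (Prod.swap_injective hh)
    rwa [Prod.fst_swap, Prod.snd_swap, Prod.fst_swap, Prod.snd_swap, segment_symm,
      segment_symm ℝ e'.2] at this

lemma Compatible.swap {M M' : Finset (Pt × Pt)} (h : Compatible M M') :
    Compatible (M.image Prod.swap) (M'.image Prod.swap) := by
  intro e he e' he'
  rcases h _ (mem_image_swap.1 he) _ (mem_image_swap.1 he') with h1 | h1
  · exact Or.inl (Prod.swap_injective h1)
  · right
    rw [Prod.fst_swap, Prod.snd_swap, Prod.fst_swap, Prod.snd_swap, segment_symm,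
      segment_symm ℝ e'.2] at h1
    exact fun z hz => ⟨(h1 hz).1.symm, (h1 hz).2.symm⟩

lemma lcost_Xes {K a b c : ℝ} {e : Pt × Pt} (he : Xes a b c e) :
    lcost K a b c e.1 e.2 = K + ed e.1 e.2 := by
  unfold lcost
  rcases he with ⟨h1, h2⟩ | ⟨h1, h2⟩ <;> rw [stp_lt h1, stp_gt h2] <;> simp

lemma lcost_not_Xes {K a b c : ℝ} {e : Pt × Pt} (he : ¬ Xes a b c e) (h1 : ln a b e.1 ≠ c)
    (h2 : ln a b e.2 ≠ c) : lcost K a b c e.1 e.2 = ed e.1 e.2 := by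
  unfold lcost
  rcases lt_or_gt_of_ne h1 with h1 | h1 <;> rcases lt_or_gt_of_ne h2 with h2 | h2
  · rw [stp_lt h1, stp_lt h2]; simp
  · exact absurd (Or.inl ⟨h1, h2⟩) he
  · exact absurd (Or.inr ⟨h2, h1⟩) he
  · rw [stp_gt h1, stp_gt h2]; simp

lemma sum_lcost {K a b c : ℝ} {M : Finset (Pt × Pt)}
    (h : ∀ e ∈ M, ln a b e.1 ≠ c ∧ ln a b e.2 ≠ c) :
    ∑ e ∈ M, lcost K a b c e.1 e.2 = K * xc a b c M + ∑ e ∈ M, ed e.1 e.2 := by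
  have : ∀ e ∈ M, lcost K a b c e.1 e.2 = (if Xes a b c e then K else 0) + ed e.1 e.2 := by
    intro e he
    split_ifs with hx
    · exact lcost_Xes hx
    · rw [lcost_not_Xes hx (h e he).1 (h e he).2, zero_add]
  rw [Finset.sum_congr rfl this, Finset.sum_add_distrib, ← Finset.sum_filter, Finset.sum_const,
    nsmul_eq_mul, xc, mul_comm]

lemma Marked.swap {S H : Finset Pt} {M : Finset (Pt × Pt)} {y : Pt × Pt → Pt}
    (h : Marked S H M y) : Marked H S (M.image Prod.swap) (fun e => y e.swap) where
  mat := h.mat.swap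
  disj := by rw [inter_comm]; exact h.disj
  gen p hp e he h0 := by
    refine (h.gen p (by rwa [union_comm]) _ (mem_image_swap.1 he) ?_).symm
    rw [← kcr_true] at h0 ⊢
    rw [Prod.fst_swap, Prod.snd_swap, kcr_swap, h0, neg_zero]
  mem e he := by
    have := h.mem _ (mem_image_swap.1 he)
    rwa [Prod.fst_swap, Prod.snd_swap, openSegment_symm] at this
  off e he e' he' hne h0 := by
    refine h.off _ (mem_image_swap.1 he) _ (mem_image_swap.1 he')
      (fun hh => hne (Prod.swap_injective hh)) ?_
    rw [← kcr_true] at h0 ⊢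
    rw [Prod.fst_swap, Prod.snd_swap, kcr_swap, h0, neg_zero]

lemma Marked.reduce_of_pos {S H : Finset Pt} {M : Finset (Pt × Pt)} {y : Pt × Pt → Pt}
    (h : Marked S H M y) {a b c : ℝ} (hlev : ∀ p ∈ S ∪ H, ln a b p ≠ c) {e1 e2 : Pt × Pt}
    (he1 : e1 ∈ M) (he2 : e2 ∈ M) (hy1 : ln a b (y e1) = c) (hy2 : ln a b (y e2) = c)
    (hh1 : ln a b e1.2 < c) (hs1 : c < ln a b e1.1) (hs2 : ln a b e2.1 < c)
    (hh2 : c < ln a b e2.2) (hcr : 0 < cr e1.1 e1.2 (y e2))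
    (hfree : ∀ z ∈ openSegment ℝ (y e1) (y e2), ∀ e ∈ M, z ∉ segment ℝ e.1 e.2) :
    ∃ M', IsBRMatching S H M' ∧ Compatible M M' ∧ xc a b c M' < xc a b c M := by
  set V := vset S H M y with hV
  set W := ∑ p ∈ V ×ˢ V, ed p.1 p.2 with hW
  have hWle : ∀ p ∈ V, ∀ q ∈ V, ed p q ≤ W := fun p hp q hq =>
    Finset.single_le_sum (f := fun r : Pt × Pt => ed r.1 r.2) (fun r _ => ed_nonneg r.1 r.2)
      (mem_product.2 ⟨hp, hq⟩ : (p, q) ∈ V ×ˢ V)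
  set K := 1 + 3 * W + ∑ e ∈ M, ed e.1 e.2 with hK
  have hW0 : 0 ≤ W := Finset.sum_nonneg fun r _ => ed_nonneg _ _
  have hl0 : 0 ≤ ∑ e ∈ M, ed e.1 e.2 := Finset.sum_nonneg fun r _ => ed_nonneg _ _
  have hK0 : 0 < K := by positivity
  have hyV : ∀ e ∈ M, y e ∈ V := fun e he => mem_union_right _ (mem_image_of_mem _ he)
  have hc := lcost_costFn (a := a) (b := b) (c := c) hK0.le
  have hsub : ∀ d ∈ oset M y, ∃ e ∈ M, segment ℝ d.1 d.2 ⊆ segment ℝ e.1 e.2 := by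
    intro d hd
    obtain ⟨e, he, hde⟩ := mem_oset.1 hd
    refine ⟨e, he, ?_⟩
    have hs := openSegment_subset_segment ℝ _ _ (h.mem e he)
    rcases hde with rfl | rfl
    · exact (convex_segment _ _).segment_subset (left_mem_segment ℝ _ _) hs
    · exact (convex_segment _ _).segment_subset hs (right_mem_segment ℝ _ _)
  obtain ⟨D, T, X, hst, u, hu, hcost⟩ := h.uncross hK0.le he1 he2 hy1 hy2 hh1 hs1 hs2 hh2 hcr (by
    rintro z hz ⟨d, hd, hzd⟩
    rcases Marked.start_cases d hd with hd | hd <;> obtain ⟨e, he, hes⟩ := hsub _ hd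
    · exact hfree z hz e he (hes hzd)
    · rw [Prod.fst_swap, Prod.snd_swap, segment_symm] at hes
      exact hfree z hz e he (hes hzd))
  obtain ⟨D', T', X', hm, hle⟩ := hst.exists_minSt (lcost K a b c)
  refine ⟨_, h.next_matching hm hc, h.next_compatible hm, ?_⟩
  have h1 := h.sum_next_le hm hc
  have hmem : ∀ {M' : Finset (Pt × Pt)}, IsBRMatching S H M' →
      ∀ e ∈ M', ln a b e.1 ≠ c ∧ ln a b e.2 ≠ c := fun hM' e he =>
    ⟨hlev _ (mem_union_left _ (hM'.1 e he).1), hlev _ (mem_union_right _ (hM'.1 e he).2)⟩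
  rw [sum_lcost (hmem (h.next_matching hm hc))] at h1
  rw [sum_lcost (hmem h.mat)] at hcost
  have h2 : 0 ≤ ∑ e ∈ Marked.next S H M y D' T', ed e.1 e.2 :=
    Finset.sum_nonneg fun r _ => ed_nonneg _ _
  have b1 := hWle _ (hyV e1 he1) _ (hyV e2 he2)
  have b2 := hWle _ hu _ (hyV e1 he1)
  have b3 := hWle _ hu _ (hyV e2 he2)
  have h3 : K * (xc a b c (Marked.next S H M y D' T') : ℝ) < K * (xc a b c M : ℝ) := by linarith
  exact_mod_cast lt_of_mul_lt_mul_left h3 hK0.le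

lemma Marked.reduce {S H : Finset Pt} {M : Finset (Pt × Pt)} {y : Pt × Pt → Pt}
    (h : Marked S H M y) {a b c : ℝ} (hlev : ∀ p ∈ S ∪ H, ln a b p ≠ c)
    (hy : ∀ e ∈ M, Xes a b c e → ln a b (y e) = c)
    (hA : ∃ e ∈ M, ln a b e.2 < c ∧ c < ln a b e.1)
    (hB : ∃ e ∈ M, ln a b e.1 < c ∧ c < ln a b e.2) :
    ∃ M', IsBRMatching S H M' ∧ Compatible M M' ∧ xc a b c M' < xc a b c M := by
  set A := M.filter fun e => ln a b e.2 < c ∧ c < ln a b e.1 with hAd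
  set B := M.filter fun e => ln a b e.1 < c ∧ c < ln a b e.2 with hBd
  have hne : (A ×ˢ B).Nonempty := by
    obtain ⟨e, he, h1⟩ := hA
    obtain ⟨e', he', h1'⟩ := hB
    exact ⟨(e, e'), mem_product.2 ⟨mem_filter.2 ⟨he, h1⟩, mem_filter.2 ⟨he', h1'⟩⟩⟩
  obtain ⟨⟨e1, e2⟩, hmem, hmin⟩ :=
    Finset.exists_min_image (A ×ˢ B) (fun p => ed (y p.1) (y p.2)) hne
  obtain ⟨hm1, hm2⟩ := mem_product.1 hmem
  obtain ⟨he1, hh1, hs1⟩ := mem_filter.1 hm1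
  obtain ⟨he2, hs2, hh2⟩ := mem_filter.1 hm2
  have hy1 := hy e1 he1 (Or.inr ⟨hh1, hs1⟩)
  have hy2 := hy e2 he2 (Or.inl ⟨hs2, hh2⟩)
  have hne12 : e1 ≠ e2 := by rintro rfl; exact absurd hh1 (by simpa using hh2.le)
  have hyne : y e1 ≠ y e2 := fun hh => hne12 (h.mark_inj he1 he2 hh)
  have edpos : ∀ {p q : Pt}, p ≠ q → 0 < ed p q := by
    intro p q hpq
    refine dist_pos.2 fun hh => hpq ?_
    exact Prod.ext (congrArg Complex.re hh) (congrArg Complex.im hh)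
  have hfree : ∀ z ∈ openSegment ℝ (y e1) (y e2), ∀ e ∈ M, z ∉ segment ℝ e.1 e.2 := by
    intro z hz e he hze
    have hzc : ln a b z = c := by
      obtain ⟨t, -, -, rfl⟩ := mem_oseg.1 hz
      rw [ln_ip, hy1, hy2]; ring
    have hz1 : z ≠ y e1 := by rintro rfl; exact left_notMem_oseg hyne hz
    have hz2 : z ≠ y e2 := by rintro rfl; exact right_notMem_oseg hyne hz
    have hb := ed_between.2 (openSegment_subset_segment ℝ _ _ hz)
    have n1 := hlev _ (mem_union_left _ (h.left_mem he))
    have n2 := hlev _ (mem_union_right _ (h.right_mem he))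
    obtain ⟨t, t0, t1, hzt⟩ := mem_seg.1 hze
    have hl := ln_ip a b e.1 e.2 t
    rw [← hzt, hzc] at hl
    have hX : Xes a b c e := by
      rcases lt_or_gt_of_ne n1 with n1 | n1 <;> rcases lt_or_gt_of_ne n2 with n2 | n2
      · rcases t0.eq_or_lt with rfl | t0
        · linarith
        · nlinarith [mul_pos t0 (sub_pos.2 n2), mul_nonneg (sub_nonneg.2 t1) (sub_pos.2 n1).le]
      · exact Or.inl ⟨n1, n2⟩
      · exact Or.inr ⟨n2, n1⟩
      · rcases t0.eq_or_lt with rfl | t0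
        · linarith
        · nlinarith [mul_pos t0 (sub_pos.2 n2), mul_nonneg (sub_nonneg.2 t1) (sub_pos.2 n1).le]
    have hzy : z = y e := by
      obtain ⟨s, -, -, hs⟩ := mem_oseg.1 (h.mem e he)
      have hl' := ln_ip a b e.1 e.2 s
      rw [← hs, hy e he hX] at hl'
      have : (t - s) * (ln a b e.2 - ln a b e.1) = 0 := by linarith
      rcases mul_eq_zero.1 this with h5 | h5
      · rw [hzt, hs, sub_eq_zero.1 h5]
      · rcases hX with h6 | h6 <;> linarith
    rcases hX with hX | hX
    · have := hmin (e1, e) (mem_product.2 ⟨hm1, mem_filter.2 ⟨he, hX⟩⟩)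
      simp only [← hzy] at this
      have := edpos hz2
      linarith
    · have := hmin (e, e2) (mem_product.2 ⟨mem_filter.2 ⟨he, hX⟩, hm2⟩)
      simp only [← hzy] at this
      have := edpos hz1.symm
      linarith
  rcases lt_or_gt_of_ne (h.off e2 he2 e1 he1 hne12) with hcr | hcr
  · have hcr' : 0 < cr e2.2 e2.1 (y e1) := by
      obtain ⟨r1, -, -, hr1⟩ := mem_oseg.1 (h.mem e1 he1)
      obtain ⟨r2, -, -, hr2⟩ := mem_oseg.1 (h.mem e2 he2)
      have q1 : cr e1.1 e1.2 (y e2) = (e1.2.1 - e1.1.1) * ((y e2).2 - (y e1).2)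
          - (e1.2.2 - e1.1.2) * ((y e2).1 - (y e1).1) := by
        rw [hr1]; simp only [cr, ip]; ring
      have q2 : cr e2.2 e2.1 (y e1) = - ((e2.1.1 - e2.2.1) * ((y e2).2 - (y e1).2)
          - (e2.1.2 - e2.2.2) * ((y e2).1 - (y e1).1)) := by
        rw [hr2]; simp only [cr, ip]; ring
      have key : cr e2.2 e2.1 (y e1) * (ln a b e1.1 - ln a b e1.2)
          = - cr e1.1 e1.2 (y e2) * (ln a b e2.2 - ln a b e2.1) := by
        have hd : ln a b (y e1) = ln a b (y e2) := hy1.trans hy2.symm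
        rw [q1, q2]; simp only [ln] at hd ⊢
        linear_combination ((e1.2.1 - e1.1.1) * (e2.1.2 - e2.2.2)
          - (e1.2.2 - e1.1.2) * (e2.1.1 - e2.2.1)) * hd
      have p1 : 0 < ln a b e1.1 - ln a b e1.2 := by linarith
      have p2 : 0 < ln a b e2.2 - ln a b e2.1 := by linarith
      by_contra hneg
      push Not at hneg
      nlinarith [mul_pos (neg_pos.2 hcr) p2, mul_nonneg (neg_nonneg.2 hneg) p1.le]
    obtain ⟨M', m1, m2, m3⟩ := h.swap.reduce_of_pos (a := a) (b := b) (c := c)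
      (fun p hp => hlev p (by rwa [union_comm])) (e1 := e2.swap) (e2 := e1.swap)
      (mem_image_of_mem _ he2) (mem_image_of_mem _ he1) hy2 hy1 hs2 hh2 hh1 hs1 hcr' (by
        intro z hz e he hze
        simp only [Prod.swap_swap] at hz
        rw [openSegment_symm] at hz
        refine hfree z hz _ (mem_image_swap.1 he) ?_
        rwa [Prod.fst_swap, Prod.snd_swap, segment_symm])
    refine ⟨M'.image Prod.swap, m1.swap, ?_, ?_⟩
    · have := m2.swap
      rwa [image_swap_swap] at this
    · rwa [xc_swap, ← xc_swap M]
  · exact h.reduce_of_pos hlev he1 he2 hy1 hy2 hh1 hs1 hs2 hh2 hcr hfree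

lemma cr_ne_zero_of_genPos {S : Finset Pt} (hg : GenPos S) {p q r : Pt} (hp : p ∈ S) (hq : q ∈ S)
    (hr : r ∈ S) (hpq : p ≠ q) (hpr : p ≠ r) (hqr : q ≠ r) : cr p q r ≠ 0 := by
  intro h0
  apply hg p hp q hq r hr hpq hpr hqr
  obtain ⟨t, rfl⟩ := exists_ip_of_cr hpq h0
  rw [collinear_iff_of_mem (Set.mem_insert p _)]
  refine ⟨q - p, ?_⟩
  intro z hz
  simp only [Set.mem_insert_iff, Set.mem_singleton_iff] at hz
  rcases hz with rfl | rfl | rfl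
  · exact ⟨0, by simp⟩
  · exact ⟨1, by simp⟩
  · exact ⟨t, by ext <;> simp [ip] <;> ring⟩

/-- A level can be perturbed so as to avoid finitely many bad values. -/
lemma exists_level (L Bad : Finset ℝ) {c : ℝ} (hc : c ∉ L) :
    ∃ c', c' ∉ Bad ∧ ∀ l ∈ L, (l < c ↔ l < c') ∧ (c < l ↔ c' < l) := by
  have h : ∀ᶠ c' in nhds c, ∀ l ∈ L, (l < c ↔ l < c') ∧ (c < l ↔ c' < l) := by
    rw [Filter.eventually_all_finset]
    intro l hl
    have hne : l ≠ c := fun hh => hc (hh ▸ hl)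
    rcases lt_or_gt_of_ne hne with h1 | h1
    · filter_upwards [lt_mem_nhds h1] with x hx
      exact ⟨iff_of_true h1 hx, iff_of_false h1.not_gt hx.not_gt⟩
    · filter_upwards [gt_mem_nhds h1] with x hx
      exact ⟨iff_of_false h1.not_gt hx.not_gt, iff_of_true h1 hx⟩
  have hinf := infinite_of_mem_nhds c h
  obtain ⟨c', h1, h2⟩ := hinf.exists_notMem_finset Bad
  exact ⟨c', h2, h1⟩

section
variable {S H : Finset Pt} {M : Finset (Pt × Pt)}

lemma IsBRMatching.ends_ne (h : IsBRMatching S H M) (hd : S ∩ H = ∅) {e e' : Pt × Pt}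
    (he : e ∈ M) (he' : e' ∈ M) : e.1 ≠ e'.2 := by
  intro hh
  have : e.1 ∈ S ∩ H := mem_inter.2 ⟨(h.1 e he).1, hh ▸ (h.1 e' he').2⟩
  rw [hd] at this; simp at this

lemma IsBRMatching.gen (h : IsBRMatching S H M) (hd : S ∩ H = ∅) (hg : GenPos (S ∪ H))
    {p : Pt} (hp : p ∈ S ∪ H) {e : Pt × Pt} (he : e ∈ M) (h0 : cr e.1 e.2 p = 0) :
    p = e.1 ∨ p = e.2 := by
  by_contra hcon
  push Not at hcon
  exact cr_ne_zero_of_genPos hg (mem_union_left _ (h.1 e he).1) (mem_union_right _ (h.1 e he).2)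
    hp (h.ends_ne hd he he) hcon.1.symm hcon.2.symm h0

lemma IsBRMatching.ratio (h : IsBRMatching S H M) (hd : S ∩ H = ∅) (hg : GenPos (S ∪ H))
    {e e' : Pt × Pt} (he : e ∈ M) (he' : e' ∈ M) (hne : e' ≠ e) {t : ℝ}
    (h0 : cr e'.1 e'.2 (ip e.1 e.2 t) = 0) :
    t = cr e'.1 e'.2 e.1 / (cr e'.1 e'.2 e.1 - cr e'.1 e'.2 e.2) := by
  have hA : cr e'.1 e'.2 e.1 ≠ 0 := by
    intro hA
    rcases h.gen hd hg (mem_union_left _ (h.1 e he).1) he' hA with h1 | h1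
    · exact hne (h.inj_left he' he h1.symm)
    · exact h.ends_ne hd he he' h1
  rw [cr_ip] at h0
  have h1 : cr e'.1 e'.2 e.1 = t * (cr e'.1 e'.2 e.1 - cr e'.1 e'.2 e.2) := by linarith
  have h2 : cr e'.1 e'.2 e.1 - cr e'.1 e'.2 e.2 ≠ 0 := by
    intro h2; rw [h2, mul_zero] at h1; exact hA h1
  rw [eq_div_iff h2]; exact h1.symm

lemma IsBRMatching.exists_mark (h : IsBRMatching S H M) (hd : S ∩ H = ∅) (hg : GenPos (S ∪ H))
    {a b c : ℝ} (hlev : ∀ p ∈ S ∪ H, ln a b p ≠ c) :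
    ∃ c', (∀ p ∈ S ∪ H, (ln a b p < c ↔ ln a b p < c') ∧ (c < ln a b p ↔ c' < ln a b p)) ∧
      ∃ y, Marked S H M y ∧ ∀ e ∈ M, Xes a b c' e → ln a b (y e) = c' := by
  set Bad : Finset ℝ := (M ×ˢ M).image fun q => ln a b (ip q.1.1 q.1.2
    (cr q.2.1 q.2.2 q.1.1 / (cr q.2.1 q.2.2 q.1.1 - cr q.2.1 q.2.2 q.1.2))) with hBad
  obtain ⟨c', hc', hL⟩ := exists_level ((S ∪ H).image (ln a b)) Bad (c := c) (by
    intro hc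
    obtain ⟨p, hp, h1⟩ := mem_image.1 hc
    exact hlev p hp h1)
  refine ⟨c', fun p hp => hL _ (mem_image_of_mem _ hp), ?_⟩
  have key : ∀ e : Pt × Pt, ∃ z : Pt, e ∈ M → z ∈ openSegment ℝ e.1 e.2 ∧
      (Xes a b c' e → ln a b z = c') ∧ ∀ e' ∈ M, e' ≠ e → cr e'.1 e'.2 z ≠ 0 := by
    intro e
    by_cases he : e ∈ M
    swap
    · exact ⟨0, fun h => absurd h he⟩
    by_cases hX : Xes a b c' e
    · have hz : ∃ t : ℝ, 0 < t ∧ t < 1 ∧ ln a b (ip e.1 e.2 t) = c' := by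
        have hne : ln a b e.2 - ln a b e.1 ≠ 0 := by
          rcases hX with hX | hX
          · exact (sub_pos.2 (hX.1.trans hX.2)).ne'
          · exact (sub_neg.2 (hX.1.trans hX.2)).ne
        have heq : ln a b (ip e.1 e.2 ((c' - ln a b e.1) / (ln a b e.2 - ln a b e.1))) = c' := by
          rw [ln_ip]; field_simp; ring
        refine ⟨_, ?_, ?_, heq⟩
        · rcases hX with hX | hX
          · exact div_pos (by linarith) (by linarith)
          · exact div_pos_of_neg_of_neg (by linarith) (by linarith)
        · rcases hX with hX | hX
          · rw [div_lt_one (by linarith)]; linarith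
          · rw [div_lt_one_of_neg (by linarith)]; linarith
      obtain ⟨t, t0, t1, ht⟩ := hz
      refine ⟨ip e.1 e.2 t, fun _ => ⟨ip_mem_oseg t0 t1, fun _ => ht, fun e' he' hne h0 => ?_⟩⟩
      apply hc'
      rw [hBad]
      refine mem_image.2 ⟨(e, e'), mem_product.2 ⟨he, he'⟩, ?_⟩
      simp only
      rw [← h.ratio hd hg he he' hne h0, ht]
    · obtain ⟨t, ⟨t0, t1⟩, ht⟩ := (Set.Ioo_infinite (zero_lt_one (α := ℝ))).exists_notMem_finset
        (M.image fun e' => cr e'.1 e'.2 e.1 / (cr e'.1 e'.2 e.1 - cr e'.1 e'.2 e.2))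
      refine ⟨ip e.1 e.2 t, fun _ => ⟨ip_mem_oseg t0 t1, fun h => absurd h hX,
        fun e' he' hne h0 => ht ?_⟩⟩
      exact mem_image.2 ⟨e', he', (h.ratio hd hg he he' hne h0).symm⟩
  choose y hy using key
  exact ⟨y, ⟨h, hd, fun p hp e he h0 => h.gen hd hg hp he h0, fun e he => (hy e he).1,
    fun e he => (hy e he).2.2⟩, fun e he => (hy e he).2.1⟩

lemma IsBRMatching.card_left (h : IsBRMatching S H M) (P : Pt → Prop) :
    (M.filter fun e => P e.1).card = (S.filter P).card := by
  refine Finset.card_nbij Prod.fst ?_ ?_ ?_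
  · intro e he
    have := mem_filter.1 he
    exact mem_filter.2 ⟨(h.1 e this.1).1, this.2⟩
  · intro e he e' he' hh
    exact h.inj_left (mem_filter.1 he).1 (mem_filter.1 he').1 hh
  · intro s hs
    obtain ⟨hs, hP⟩ := mem_filter.1 hs
    obtain ⟨e, ⟨he, rfl⟩, -⟩ := h.2.1 s hs
    exact ⟨e, mem_filter.2 ⟨he, hP⟩, rfl⟩

lemma IsBRMatching.card_right (h : IsBRMatching S H M) (P : Pt → Prop) :
    (M.filter fun e => P e.2).card = (H.filter P).card := by
  refine Finset.card_nbij Prod.snd ?_ ?_ ?_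
  · intro e he
    have := mem_filter.1 he
    exact mem_filter.2 ⟨(h.1 e this.1).2, this.2⟩
  · intro e he e' he' hh
    exact h.inj_right (mem_filter.1 he).1 (mem_filter.1 he').1 hh
  · intro s hs
    obtain ⟨hs, hP⟩ := mem_filter.1 hs
    obtain ⟨e, ⟨he, rfl⟩, -⟩ := h.2.2.1 s hs
    exact ⟨e, mem_filter.2 ⟨he, hP⟩, rfl⟩

/-- For a balanced line, the edges crossing it in the two directions are equally many. -/
lemma IsBRMatching.crossings (h : IsBRMatching S H M) {a b c : ℝ} {k : ℕ}
    (hlev : ∀ p ∈ S ∪ H, ln a b p ≠ c)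
    (hS : (S.filter fun p => ln a b p < c).card = k)
    (hH : (H.filter fun p => ln a b p < c).card = k) :
    ∃ j ≤ k, xc a b c M = 2 * j ∧ (M.filter fun e => ln a b e.1 < c ∧ c < ln a b e.2).card = j ∧
      (M.filter fun e => ln a b e.2 < c ∧ c < ln a b e.1).card = j := by
  set A := M.filter fun e => ln a b e.1 < c with hA
  set B := M.filter fun e => ln a b e.2 < c with hB
  have cA : A.card = k := by rw [← hS]; convert h.card_left fun p => ln a b p < c
  have cB : B.card = k := by rw [← hH]; convert h.card_right fun p => ln a b p < c
  have hlt1 : ∀ e ∈ M, (c < ln a b e.1 ↔ ¬ ln a b e.1 < c) := fun e he =>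
    ⟨fun h => h.not_gt, fun h' => lt_of_le_of_ne (not_lt.1 h')
      (hlev _ (mem_union_left _ (h.1 e he).1)).symm⟩
  have hlt2 : ∀ e ∈ M, (c < ln a b e.2 ↔ ¬ ln a b e.2 < c) := fun e he =>
    ⟨fun h => h.not_gt, fun h' => lt_of_le_of_ne (not_lt.1 h')
      (hlev _ (mem_union_right _ (h.1 e he).2)).symm⟩
  have e1 : (M.filter fun e => ln a b e.1 < c ∧ c < ln a b e.2) = A \ B := by
    ext e
    simp only [hA, hB, mem_filter, mem_sdiff, not_and]
    constructor
    · rintro ⟨he, h1, h2⟩; exact ⟨⟨he, h1⟩, fun _ => (hlt2 e he).1 h2⟩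
    · rintro ⟨⟨he, h1⟩, h2⟩; exact ⟨he, h1, (hlt2 e he).2 (h2 he)⟩
  have e2 : (M.filter fun e => ln a b e.2 < c ∧ c < ln a b e.1) = B \ A := by
    ext e
    simp only [hA, hB, mem_filter, mem_sdiff, not_and]
    constructor
    · rintro ⟨he, h1, h2⟩; exact ⟨⟨he, h1⟩, fun _ => (hlt1 e he).1 h2⟩
    · rintro ⟨⟨he, h1⟩, h2⟩; exact ⟨he, h1, (hlt1 e he).2 (h2 he)⟩
  have c1 := Finset.card_sdiff_add_card_inter A B
  have c2 := Finset.card_sdiff_add_card_inter B A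
  rw [inter_comm] at c2
  have c3 : xc a b c M = (A \ B).card + (B \ A).card := by
    rw [← Finset.card_union_of_disjoint disjoint_sdiff_sdiff, ← e1, ← e2]
    unfold xc
    congr 1
    ext e
    simp only [mem_filter, mem_union, Xes, and_or_left]
  exact ⟨(A \ B).card, by omega, by omega, by rw [e1], by rw [e2]; omega⟩

/-- The number of edges crossing a balanced line can be decreased by a compatible matching. -/
lemma IsBRMatching.exists_fewer (h : IsBRMatching S H M) (hd : S ∩ H = ∅) (hg : GenPos (S ∪ H))
    {a b c : ℝ} {k : ℕ} (hlev : ∀ p ∈ S ∪ H, ln a b p ≠ c)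
    (hS : (S.filter fun p => ln a b p < c).card = k)
    (hH : (H.filter fun p => ln a b p < c).card = k) (hx : 0 < xc a b c M) :
    ∃ M', IsBRMatching S H M' ∧ Compatible M M' ∧ xc a b c M' < xc a b c M := by
  obtain ⟨j, -, hj, hj1, hj2⟩ := h.crossings hlev hS hH
  obtain ⟨c', hc', y, hy, hyl⟩ := h.exists_mark hd hg hlev
  have hX : ∀ {M'}, IsBRMatching S H M' → xc a b c' M' = xc a b c M' := by
    intro M' hM'
    unfold xc
    congr 1
    refine Finset.filter_congr fun e he => ?_
    have q1 := hc' _ (mem_union_left _ (hM'.1 e he).1)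
    have q2 := hc' _ (mem_union_right _ (hM'.1 e he).2)
    unfold Xes
    rw [q1.1, q1.2, q2.1, q2.2]
  have hne : ∀ p ∈ S ∪ H, ln a b p ≠ c' := by
    intro p hp hh
    rcases lt_or_gt_of_ne (hlev p hp) with h1 | h1
    · exact absurd ((hc' p hp).1.1 h1) (by simp [hh])
    · exact absurd ((hc' p hp).2.1 h1) (by simp [hh])
  have p1 : 0 < j := by omega
  obtain ⟨e1, he1⟩ := card_pos.1 (hj1 ▸ p1)
  obtain ⟨e2, he2⟩ := card_pos.1 (hj2 ▸ p1)
  rw [mem_filter] at he1 he2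
  have l1 := fun e (he : e ∈ M) => hc' _ (mem_union_left _ (h.1 e he).1)
  have l2 := fun e (he : e ∈ M) => hc' _ (mem_union_right _ (h.1 e he).2)
  obtain ⟨M', m1, m2, m3⟩ := hy.reduce hne hyl
    ⟨e2, he2.1, (l2 e2 he2.1).1.1 he2.2.1, (l1 e2 he2.1).2.1 he2.2.2⟩
    ⟨e1, he1.1, (l1 e1 he1.1).1.1 he1.2.1, (l2 e1 he1.1).2.1 he1.2.2⟩
  rw [hX m1, hX h] at m3
  exact ⟨M', m1, m2, m3⟩

end

lemma exists_cut_le (L : Finset ℝ) (c₀ : ℝ) : ∃ c ∉ L, ∀ l ∈ L, l < c ↔ l ≤ c₀ := by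
  have h : ∀ᶠ c in nhdsWithin c₀ (Set.Ioi c₀), ∀ l ∈ L, l ≠ c ∧ (l < c ↔ l ≤ c₀) := by
    rw [Filter.eventually_all_finset]
    intro l _
    rcases le_or_gt l c₀ with h1 | h1
    · filter_upwards [self_mem_nhdsWithin] with x hx
      have : l < x := lt_of_le_of_lt h1 hx
      exact ⟨this.ne, iff_of_true this h1⟩
    · filter_upwards [nhdsWithin_le_nhds (gt_mem_nhds h1)] with x hx
      exact ⟨hx.ne', iff_of_false hx.not_gt h1.not_ge⟩
  obtain ⟨c, hc⟩ := h.exists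
  exact ⟨c, fun hh => (hc c hh).1 rfl, fun l hl => (hc l hl).2⟩

lemma exists_cut_lt (L : Finset ℝ) (c₀ : ℝ) : ∃ c ∉ L, ∀ l ∈ L, l < c ↔ l < c₀ := by
  have h : ∀ᶠ c in nhdsWithin c₀ (Set.Iio c₀), ∀ l ∈ L, l ≠ c ∧ (l < c ↔ l < c₀) := by
    rw [Filter.eventually_all_finset]
    intro l _
    rcases lt_or_ge l c₀ with h1 | h1
    · filter_upwards [nhdsWithin_le_nhds (lt_mem_nhds h1)] with x hx
      exact ⟨hx.ne, iff_of_true hx h1⟩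
    · filter_upwards [self_mem_nhdsWithin] with x hx
      have : x < l := lt_of_lt_of_le hx h1
      exact ⟨this.ne', iff_of_false this.not_gt h1.not_gt⟩
  obtain ⟨c, hc⟩ := h.exists
  exact ⟨c, fun hh => (hc c hh).1 rfl, fun l hl => (hc l hl).2⟩

lemma exists_balanced_of_min {S H : Finset Pt} {m : ℕ} (hd : S ∩ H = ∅) (hg : GenPos (S ∪ H))
    (hS : S.card = m) (hH : H.card = m) (hm : 2 ≤ m) {δ : ℝ} {p : Pt} (hp : p ∈ S)
    (hmin : ∀ q ∈ S ∪ H, q ≠ p → ln 1 δ p < ln 1 δ q) :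
    ∃ a b c : ℝ, ∃ k : ℕ, 1 ≤ k ∧ k < m ∧ (∀ q ∈ S ∪ H, ln a b q ≠ c) ∧
      (S.filter fun q => ln a b q < c).card = k ∧ (H.filter fun q => ln a b q < c).card = k := by
  have hpH : p ∉ H := fun h => by
    have : p ∈ S ∩ H := mem_inter.2 ⟨hp, h⟩
    rw [hd] at this; simp at this
  set σ : Pt → ℝ := fun q => (q.2 - p.2) / (ln 1 δ q - ln 1 δ p) with hσ
  have hF : ∀ q ∈ S ∪ H, q ≠ p → ∀ s,
      ln (-s) (1 - s * δ) q - ln (-s) (1 - s * δ) p = (ln 1 δ q - ln 1 δ p) * (σ q - s) := by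
    intro q hq hqp s
    have := sub_pos.2 (hmin q hq hqp)
    have h1 : (ln 1 δ q - ln 1 δ p) * σ q = q.2 - p.2 := mul_div_cancel₀ _ this.ne'
    rw [mul_sub, h1]; simp only [ln]; ring
  have hFlt : ∀ q ∈ S ∪ H, q ≠ p → ∀ s,
      (ln (-s) (1 - s * δ) q < ln (-s) (1 - s * δ) p ↔ σ q < s) := by
    intro q hq hqp s
    have h0 := sub_pos.2 (hmin q hq hqp)
    rw [← sub_neg, hF q hq hqp, mul_neg_iff]
    constructor
    · rintro (⟨-, h⟩ | ⟨h, -⟩) <;> linarith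
    · intro h; left; exact ⟨h0, by linarith⟩
  have hFle : ∀ q ∈ S ∪ H, q ≠ p → ∀ s,
      (ln (-s) (1 - s * δ) q ≤ ln (-s) (1 - s * δ) p ↔ σ q ≤ s) := by
    intro q hq hqp s
    have h0 := sub_pos.2 (hmin q hq hqp)
    rw [← sub_nonpos, hF q hq hqp, mul_nonpos_iff]
    constructor
    · rintro (⟨-, h⟩ | ⟨h, -⟩) <;> linarith
    · intro h; left; exact ⟨h0.le, by linarith⟩
  have hinj : ∀ q ∈ S ∪ H, q ≠ p → ∀ r ∈ S ∪ H, r ≠ p → σ q = σ r → q = r := by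
    intro q hq hqp r hr hrp hh
    by_contra hqr
    apply cr_ne_zero_of_genPos hg (mem_union_left _ hp) hq hr hqp.symm hrp.symm hqr
    have h1 := sub_pos.2 (hmin q hq hqp)
    have h2 := sub_pos.2 (hmin r hr hrp)
    simp only [hσ] at hh
    rw [div_eq_div_iff h1.ne' h2.ne'] at hh
    simp only [ln, cr] at hh ⊢
    linarith
  set Q := (S ∪ H).erase p with hQ
  have hQm : ∀ {q}, q ∈ Q → q ∈ S ∪ H ∧ q ≠ p := fun h => ⟨mem_of_mem_erase h, ne_of_mem_erase h⟩
  set rd : Pt → Finset Pt := fun q => H.filter fun r => σ r ≤ σ q with hrd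
  set bl : Pt → Finset Pt := fun q => (S.erase p).filter fun r => σ r ≤ σ q with hbl
  have HQ : ∀ {q}, q ∈ H → q ∈ Q := fun {q} h =>
    mem_erase.2 ⟨fun hh => hpH (hh ▸ h), mem_union_right _ h⟩
  have SQ : ∀ {q}, q ∈ S.erase p → q ∈ Q := fun {q} h =>
    mem_erase.2 ⟨ne_of_mem_erase h, mem_union_left _ (mem_of_mem_erase h)⟩
  have hcS : (S.erase p).card = m - 1 := by rw [card_erase_of_mem hp, hS]
  have hQne : Q.Nonempty := by
    obtain ⟨q, hq⟩ := card_pos.1 (by omega : 0 < H.card)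
    exact ⟨q, HQ hq⟩
  have hTne : (Q.filter fun q => (bl q).card ≤ (rd q).card).Nonempty := by
    obtain ⟨q, hq, hmax⟩ := Finset.exists_max_image Q σ hQne
    refine ⟨q, mem_filter.2 ⟨hq, ?_⟩⟩
    have : rd q = H := Finset.filter_true_of_mem fun r hr => hmax r (HQ hr)
    rw [this, hH]
    have := (card_filter_le (S.erase p) fun r => σ r ≤ σ q)
    simp only [hbl]; omega
  obtain ⟨q, hqT, hqmin⟩ := Finset.exists_min_image _ σ hTne
  obtain ⟨hqQ, hqle⟩ := mem_filter.1 hqT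
  have huniq : ∀ r ∈ Q, σ r ≤ σ q → ¬ σ r < σ q → r = q := fun r hr h1 h2 =>
    hinj r (hQm hr).1 (hQm hr).2 q (hQm hqQ).1 (hQm hqQ).2 (le_antisymm h1 (not_lt.1 h2))
  by_cases hlo : (Q.filter fun r => σ r < σ q) = ∅
  · have hno : ∀ r ∈ Q, ¬ σ r < σ q := fun r hr hlt => by
      have : r ∈ Q.filter fun r => σ r < σ q := mem_filter.2 ⟨hr, hlt⟩
      rw [hlo] at this; simp at this
    have hqH : q ∈ H := by
      by_contra hqH
      have h1 : rd q = ∅ := by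
        refine Finset.filter_false_of_mem fun r hr hle => hqH ?_
        rwa [← huniq r (HQ hr) hle (hno r (HQ hr))]
      have h2 : q ∈ bl q := mem_filter.2 ⟨mem_erase.2 ⟨(hQm hqQ).2,
        (mem_union.1 (hQm hqQ).1).resolve_right hqH⟩, le_rfl⟩
      have := card_pos.2 ⟨q, h2⟩
      rw [h1, card_empty] at hqle; omega
    have hqS : q ∉ S := fun h => by
      have : q ∈ S ∩ H := mem_inter.2 ⟨h, hqH⟩
      rw [hd] at this; simp at this
    set a := -σ q
    set b := 1 - σ q * δ
    obtain ⟨c, hc, hcl⟩ := exists_cut_le ((S ∪ H).image (ln a b)) (ln a b p)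
    have hcl' : ∀ r ∈ S ∪ H, (ln a b r < c ↔ ln a b r ≤ ln a b p) := fun r hr =>
      hcl _ (mem_image_of_mem _ hr)
    refine ⟨a, b, c, 1, le_rfl, by omega, fun r hr hh => hc (hh ▸ mem_image_of_mem _ hr), ?_, ?_⟩
    · rw [card_eq_one]
      refine ⟨p, ?_⟩
      ext r
      rw [mem_filter, mem_singleton]
      constructor
      · rintro ⟨hr, hlt⟩
        by_contra hrp
        have hr' := mem_union_left H hr
        rw [hcl' r hr', hFle r hr' hrp] at hlt
        have hrQ := SQ (mem_erase.2 ⟨hrp, hr⟩)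
        exact hqS (huniq r hrQ hlt (hno r hrQ) ▸ hr)
      · rintro rfl
        exact ⟨hp, (hcl' r (mem_union_left _ hp)).2 le_rfl⟩
    · rw [card_eq_one]
      refine ⟨q, ?_⟩
      ext r
      rw [mem_filter, mem_singleton]
      constructor
      · rintro ⟨hr, hlt⟩
        have hr' := mem_union_right S hr
        rw [hcl' r hr', hFle r hr' (hQm (HQ hr)).2] at hlt
        exact huniq r (HQ hr) hlt (hno r (HQ hr))
      · rintro rfl
        exact ⟨hqH, (hcl' r (hQm hqQ).1).2 ((hFle r (hQm hqQ).1 (hQm hqQ).2 _).2 le_rfl)⟩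
  · obtain ⟨q', hq', hmax⟩ := Finset.exists_max_image _ σ (Finset.nonempty_iff_ne_empty.2 hlo)
    obtain ⟨hq'Q, hq'lt⟩ := mem_filter.1 hq'
    have hlt : (rd q').card < (bl q').card := by
      by_contra hcon
      have := hqmin q' (mem_filter.2 ⟨hq'Q, not_lt.1 hcon⟩)
      linarith
    have hstep : ∀ r ∈ Q, σ r ≤ σ q → r = q ∨ σ r ≤ σ q' := by
      intro r hr hle
      by_cases hrl : σ r < σ q
      · exact Or.inr (hmax r (mem_filter.2 ⟨hr, hrl⟩))
      · exact Or.inl (huniq r hr hle hrl)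
    have hb : (bl q').card ≤ (bl q).card :=
      card_le_card fun r hr => mem_filter.2 ⟨(mem_filter.1 hr).1,
        (mem_filter.1 hr).2.trans hq'lt.le⟩
    have hr1 : (rd q).card ≤ (rd q').card + 1 := by
      refine (card_le_card (t := insert q (rd q')) fun r hr => ?_).trans (card_insert_le _ _)
      obtain ⟨h1, h2⟩ := mem_filter.1 hr
      rcases hstep r (HQ h1) h2 with h3 | h3
      · rw [h3]; exact mem_insert_self _ _
      · exact mem_insert_of_mem (mem_filter.2 ⟨h1, h3⟩)
    have heq : (rd q).card = (bl q).card := by omega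
    have hb1 : (bl q).card ≤ m - 1 := hcS ▸ card_filter_le _ _
    obtain ⟨s, -, hs⟩ := exists_cut_le (Q.image σ) (σ q)
    have hs' : ∀ r ∈ Q, (σ r < s ↔ σ r ≤ σ q) := fun r hr => hs _ (mem_image_of_mem _ hr)
    set a := -s
    set b := 1 - s * δ
    obtain ⟨c, hc, hcl⟩ := exists_cut_lt ((S ∪ H).image (ln a b)) (ln a b p)
    have hcl' : ∀ r ∈ S ∪ H, (ln a b r < c ↔ ln a b r < ln a b p) := fun r hr =>
      hcl _ (mem_image_of_mem _ hr)
    have hfin : ∀ r ∈ Q, (ln a b r < c ↔ σ r ≤ σ q) := fun r hr => by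
      rw [hcl' r (hQm hr).1, hFlt r (hQm hr).1 (hQm hr).2, hs' r hr]
    refine ⟨a, b, c, (bl q).card, by omega, by omega,
      fun r hr hh => hc (hh ▸ mem_image_of_mem _ hr), ?_, ?_⟩
    · congr 1
      ext r
      simp only [hbl, mem_filter]
      constructor
      · rintro ⟨hr, hl⟩
        have hrp : r ≠ p := by
          rintro rfl
          exact lt_irrefl _ ((hcl' r (mem_union_left _ hr)).1 hl)
        have hre := mem_erase.2 ⟨hrp, hr⟩
        exact ⟨hre, (hfin r (SQ hre)).1 hl⟩
      · rintro ⟨hr, hl⟩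
        exact ⟨mem_of_mem_erase hr, (hfin r (SQ hr)).2 hl⟩
    · rw [← heq]
      congr 1
      ext r
      simp only [hrd, mem_filter]
      constructor
      · rintro ⟨hr, hl⟩; exact ⟨hr, (hfin r (HQ hr)).1 hl⟩
      · rintro ⟨hr, hl⟩; exact ⟨hr, (hfin r (HQ hr)).2 hl⟩

lemma exists_ln_inj (P : Finset Pt) : ∃ δ : ℝ, ∀ p ∈ P, ∀ q ∈ P, ln 1 δ p = ln 1 δ q → p = q := by
  obtain ⟨δ, hδ⟩ := Infinite.exists_notMem_finset
    ((P ×ˢ P).image fun z : Pt × Pt => -((z.1.1 - z.2.1) / (z.1.2 - z.2.2)))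
  refine ⟨δ, fun p hp q hq h => ?_⟩
  simp only [ln] at h
  by_cases h2 : p.2 = q.2
  · exact Prod.ext (by rw [h2] at h; linarith) h2
  · refine absurd (mem_image.2 ⟨(p, q), mem_product.2 ⟨hp, hq⟩, ?_⟩) hδ
    have := sub_ne_zero.2 h2
    simp only
    rw [neg_eq_iff_eq_neg, div_eq_iff this]; linarith

lemma card_filter_neg {S : Finset Pt} {a b c : ℝ} (h : ∀ q ∈ S, ln a b q ≠ c) :
    (S.filter fun q => ln (-a) (-b) q < -c).card = S.card - (S.filter fun q => ln a b q < c).card := by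
  have h1 := Finset.card_filter_add_card_filter_not (s := S) (fun q => ln a b q < c)
  have h2 : (S.filter fun q => ln (-a) (-b) q < -c) = S.filter fun q => ¬ ln a b q < c := by
    refine Finset.filter_congr fun q hq => ?_
    have e : ln (-a) (-b) q = - ln a b q := by simp only [ln]; ring
    rw [e, neg_lt_neg_iff, not_lt]
    exact ⟨le_of_lt, fun h' => lt_of_le_of_ne h' (h q hq).symm⟩
  rw [h2]; omega

/-- A balanced line with at least one point of each color on either side. -/
lemma exists_balanced {S H : Finset Pt} {m : ℕ} (hd : S ∩ H = ∅) (hg : GenPos (S ∪ H))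
    (hS : S.card = m) (hH : H.card = m) (hm : 2 ≤ m) :
    ∃ a b c : ℝ, ∃ k : ℕ, 1 ≤ k ∧ 2 * k ≤ m ∧ (∀ q ∈ S ∪ H, ln a b q ≠ c) ∧
      (S.filter fun q => ln a b q < c).card = k ∧ (H.filter fun q => ln a b q < c).card = k := by
  have key : ∃ a b c : ℝ, ∃ k : ℕ, 1 ≤ k ∧ k < m ∧ (∀ q ∈ S ∪ H, ln a b q ≠ c) ∧
      (S.filter fun q => ln a b q < c).card = k ∧
      (H.filter fun q => ln a b q < c).card = k := by
    obtain ⟨δ, hδ⟩ := exists_ln_inj (S ∪ H)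
    have hne : (S ∪ H).Nonempty := by
      obtain ⟨q, hq⟩ := card_pos.1 (by omega : 0 < S.card)
      exact ⟨q, mem_union_left _ hq⟩
    obtain ⟨p, hp, hmin⟩ := Finset.exists_min_image _ (ln 1 δ) hne
    have hmin' : ∀ q ∈ S ∪ H, q ≠ p → ln 1 δ p < ln 1 δ q := fun q hq hqp =>
      lt_of_le_of_ne (hmin q hq) fun hh => hqp (hδ p hp q hq hh).symm
    rcases mem_union.1 hp with h | h
    · exact exists_balanced_of_min hd hg hS hH hm h hmin'
    · rw [union_comm] at hg hmin' ⊢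
      rw [inter_comm] at hd
      obtain ⟨a, b, c, k, h1, h2, h3, h4, h5⟩ := exists_balanced_of_min hd hg hH hS hm h hmin'
      exact ⟨a, b, c, k, h1, h2, h3, h5, h4⟩
  obtain ⟨a, b, c, k, h1, h2, h3, h4, h5⟩ := key
  by_cases hk : 2 * k ≤ m
  · exact ⟨a, b, c, k, h1, hk, h3, h4, h5⟩
  · refine ⟨-a, -b, -c, m - k, by omega, by omega, fun q hq hh => h3 q hq ?_, ?_, ?_⟩
    · simp only [ln] at hh ⊢; linarith
    · rw [card_filter_neg fun q hq => h3 q (mem_union_left _ hq), hS, h4]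
    · rw [card_filter_neg fun q hq => h3 q (mem_union_right _ hq), hH, h5]

section
variable {S H : Finset Pt} {M N : Finset (Pt × Pt)}

lemma IsBRMatching.compatible_self (h : IsBRMatching S H M) : Compatible M M := by
  intro e he e' he'
  by_cases hee : e = e'
  · exact Or.inl hee
  · right; rw [h.2.2.2 e he e' he' hee]; exact Set.empty_subset _

lemma Compatible.symm (h : Compatible M N) : Compatible N M := by
  intro e he e' he'
  rcases h e' he' e he with h1 | h1
  · exact Or.inl h1.symm
  · right; rw [Set.inter_comm]; exact fun z hz => ⟨(h1 hz).2, (h1 hz).1⟩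

/-- A transformation of length at most `t` may be padded to have length exactly `t`. -/
lemma TCompatible.exact {t : ℕ} (h : TCompatible S H t M N) : ∃ f : ℕ → Finset (Pt × Pt),
    f 0 = M ∧ f t = N ∧ (∀ i, IsBRMatching S H (f i)) ∧ ∀ i, Compatible (f i) (f (i + 1)) := by
  obtain ⟨k, hk, f, h0, h1, h2, h3⟩ := h
  refine ⟨fun i => f (min i k), by simpa using h0, by simp only [min_eq_right hk, h1],
    fun i => h2 _ (min_le_right _ _), fun i => ?_⟩
  rcases lt_or_ge i k with hi | hi
  · simp only [min_eq_left hi.le, min_eq_left (Nat.succ_le_of_lt hi)]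
    exact h3 i hi
  · simp only [min_eq_right hi, min_eq_right (hi.trans (Nat.le_succ i))]
    exact (h2 k le_rfl).compatible_self

lemma TCompatible.mono {s t : ℕ} (h : TCompatible S H s M N) (hst : s ≤ t) :
    TCompatible S H t M N := by
  obtain ⟨k, hk, h⟩ := h
  exact ⟨k, hk.trans hst, h⟩

lemma IsBRMatching.tCompatible_self (h : IsBRMatching S H M) (t : ℕ) : TCompatible S H t M M :=
  ⟨0, t.zero_le, fun _ => M, rfl, rfl, fun _ _ => h, fun i hi => absurd hi i.not_lt_zero⟩

lemma TCompatible.symm {t : ℕ} (h : TCompatible S H t M N) : TCompatible S H t N M := by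
  obtain ⟨k, hk, f, h0, h1, h2, h3⟩ := h
  refine ⟨k, hk, fun i => f (k - i), by simpa using h1, by simpa using h0,
    fun i _ => h2 _ (Nat.sub_le k i), fun i hi => ?_⟩
  have := h3 (k - (i + 1)) (by omega)
  rw [show k - (i + 1) + 1 = k - i by omega] at this
  exact this.symm

lemma TCompatible.trans {s t : ℕ} {L : Finset (Pt × Pt)} (h : TCompatible S H s L M)
    (h' : TCompatible S H t M N) : TCompatible S H (s + t) L N := by
  obtain ⟨f, f0, f1, f2, f3⟩ := h.exact
  obtain ⟨g, g0, g1, g2, g3⟩ := h'.exact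
  refine ⟨s + t, le_rfl, fun i => if i ≤ s then f i else g (i - s), by simpa using f0, ?_, ?_, ?_⟩
  · by_cases ht : t = 0
    · subst ht
      simp only [add_zero, le_refl, if_true]
      rw [f1, ← g0, g1]
    · simp only [show ¬ s + t ≤ s by omega, if_false, Nat.add_sub_cancel_left, g1]
  · intro i _
    simp only
    split_ifs
    · exact f2 i
    · exact g2 _
  · intro i _
    simp only
    rcases lt_trichotomy i s with hi | rfl | hi
    · rw [if_pos hi.le, if_pos (Nat.succ_le_of_lt hi)]; exact f3 i
    · rw [if_pos le_rfl, if_neg (by omega), f1, ← g0, Nat.add_sub_cancel_left]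
      exact g3 0
    · rw [if_neg (by omega), if_neg (by omega), show i + 1 - s = i - s + 1 by omega]
      exact g3 _

lemma Compatible.tCompatible (h : Compatible M N) (hM : IsBRMatching S H M)
    (hN : IsBRMatching S H N) : TCompatible S H 1 M N := by
  refine ⟨1, le_rfl, fun i => if i = 0 then M else N, by simp, by simp, fun i _ => ?_,
    fun i hi => ?_⟩
  · simp only; split_ifs
    · exact hM
    · exact hN
  · obtain rfl : i = 0 := by omega
    simpa using h

/-- A matching can be transformed into one that does not cross a given balanced line. -/
lemma IsBRMatching.exists_uncrossed (hd : S ∩ H = ∅) (hg : GenPos (S ∪ H))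
    {a b c : ℝ} {k : ℕ} (hlev : ∀ p ∈ S ∪ H, ln a b p ≠ c)
    (hS : (S.filter fun p => ln a b p < c).card = k)
    (hH : (H.filter fun p => ln a b p < c).card = k) (j : ℕ) :
    ∀ {M}, IsBRMatching S H M → xc a b c M ≤ 2 * j →
      ∃ N, IsBRMatching S H N ∧ xc a b c N = 0 ∧ TCompatible S H j M N := by
  induction j with
  | zero => exact fun {M} h hx => ⟨M, h, by omega, h.tCompatible_self 0⟩
  | succ j ih =>
    intro M h hx
    by_cases h0 : xc a b c M = 0
    · exact ⟨M, h, h0, h.tCompatible_self _⟩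
    obtain ⟨M', h1, h2, h3⟩ := h.exists_fewer hd hg hlev hS hH (Nat.pos_of_ne_zero h0)
    obtain ⟨i, -, hi, -⟩ := h.crossings hlev hS hH
    obtain ⟨i', -, hi', -⟩ := h1.crossings hlev hS hH
    obtain ⟨N, n1, n2, n3⟩ := ih h1 (by omega)
    refine ⟨N, n1, n2, ?_⟩
    rw [add_comm]
    exact (h2.tCompatible h h1).trans n3

lemma IsBRMatching.restrict (h : IsBRMatching S H M) (P : Pt → Prop)
    (hP : ∀ e ∈ M, P e.1 ↔ P e.2) :
    IsBRMatching (S.filter P) (H.filter P) (M.filter fun e => P e.1) := by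
  refine ⟨fun e he => ?_, fun s hs => ?_, fun s hs => ?_, fun e he e' he' =>
    h.2.2.2 e (mem_filter.1 he).1 e' (mem_filter.1 he').1⟩
  · obtain ⟨he, h1⟩ := mem_filter.1 he
    exact ⟨mem_filter.2 ⟨(h.1 e he).1, h1⟩, mem_filter.2 ⟨(h.1 e he).2, (hP e he).1 h1⟩⟩
  · obtain ⟨hs, h1⟩ := mem_filter.1 hs
    obtain ⟨e, ⟨he, rfl⟩, hu⟩ := h.2.1 s hs
    exact ⟨e, ⟨mem_filter.2 ⟨he, h1⟩, rfl⟩, fun e' he' => hu e' ⟨(mem_filter.1 he'.1).1, he'.2⟩⟩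
  · obtain ⟨hs, h1⟩ := mem_filter.1 hs
    obtain ⟨e, ⟨he, rfl⟩, hu⟩ := h.2.2.1 s hs
    exact ⟨e, ⟨mem_filter.2 ⟨he, (hP e he).2 h1⟩, rfl⟩,
      fun e' he' => hu e' ⟨(mem_filter.1 he'.1).1, he'.2⟩⟩

lemma ln_lt_of_seg {a b c : ℝ} {p q z : Pt} (hp : ln a b p < c) (hq : ln a b q < c)
    (hz : z ∈ segment ℝ p q) : ln a b z < c := by
  obtain ⟨t, t0, t1, rfl⟩ := mem_seg.1 hz
  rw [ln_ip]
  rcases t0.eq_or_lt with rfl | t0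
  · linarith
  · nlinarith [mul_pos t0 (sub_pos.2 hq), mul_nonneg (sub_nonneg.2 t1) (sub_pos.2 hp).le]

lemma le_ln_of_seg {a b c : ℝ} {p q z : Pt} (hp : ¬ ln a b p < c) (hq : ¬ ln a b q < c)
    (hz : z ∈ segment ℝ p q) : ¬ ln a b z < c := by
  obtain ⟨t, t0, t1, rfl⟩ := mem_seg.1 hz
  rw [ln_ip]
  push Not at hp hq ⊢
  nlinarith [mul_nonneg t0 (sub_nonneg.2 hq), mul_nonneg (sub_nonneg.2 t1) (sub_nonneg.2 hp)]

/-- Segments on either side of a line are disjoint. -/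
lemma seg_inter_of_sides {a b c : ℝ} {S₁ H₁ S₂ H₂ : Finset Pt} {M₁ M₂ : Finset (Pt × Pt)}
    (h₁ : IsBRMatching S₁ H₁ M₁) (h₂ : IsBRMatching S₂ H₂ M₂)
    (l₁ : ∀ p ∈ S₁ ∪ H₁, ln a b p < c) (l₂ : ∀ p ∈ S₂ ∪ H₂, ¬ ln a b p < c)
    {e e' : Pt × Pt} (he : e ∈ M₁) (he' : e' ∈ M₂) :
    segment ℝ e.1 e.2 ∩ segment ℝ e'.1 e'.2 = ∅ := by
  rw [Set.eq_empty_iff_forall_notMem]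
  rintro z ⟨hz, hz'⟩
  exact le_ln_of_seg (l₂ _ (mem_union_left _ (h₂.1 e' he').1))
    (l₂ _ (mem_union_right _ (h₂.1 e' he').2)) hz'
    (ln_lt_of_seg (l₁ _ (mem_union_left _ (h₁.1 e he).1))
    (l₁ _ (mem_union_right _ (h₁.1 e he).2)) hz)

lemma IsBRMatching.union {a b c : ℝ} {S₁ H₁ S₂ H₂ : Finset Pt} {M₁ M₂ : Finset (Pt × Pt)}
    (h₁ : IsBRMatching S₁ H₁ M₁) (h₂ : IsBRMatching S₂ H₂ M₂)
    (l₁ : ∀ p ∈ S₁ ∪ H₁, ln a b p < c) (l₂ : ∀ p ∈ S₂ ∪ H₂, ¬ ln a b p < c) :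
    IsBRMatching (S₁ ∪ S₂) (H₁ ∪ H₂) (M₁ ∪ M₂) := by
  refine ⟨fun e he => ?_, fun s hs => ?_, fun s hs => ?_, fun e he e' he' hne => ?_⟩
  · rcases mem_union.1 he with he | he
    · exact ⟨mem_union_left _ (h₁.1 e he).1, mem_union_left _ (h₁.1 e he).2⟩
    · exact ⟨mem_union_right _ (h₂.1 e he).1, mem_union_right _ (h₂.1 e he).2⟩
  · rcases mem_union.1 hs with hs | hs
    · obtain ⟨e, ⟨he, h1⟩, hu⟩ := h₁.2.1 s hs
      refine ⟨e, ⟨mem_union_left _ he, h1⟩, fun e' ⟨he', h1'⟩ => ?_⟩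
      rcases mem_union.1 he' with he' | he'
      · exact hu e' ⟨he', h1'⟩
      · exact absurd (l₁ s (mem_union_left _ hs))
          (h1' ▸ l₂ _ (mem_union_left _ (h₂.1 e' he').1))
    · obtain ⟨e, ⟨he, h1⟩, hu⟩ := h₂.2.1 s hs
      refine ⟨e, ⟨mem_union_right _ he, h1⟩, fun e' ⟨he', h1'⟩ => ?_⟩
      rcases mem_union.1 he' with he' | he'
      · exact absurd (h1' ▸ l₁ _ (mem_union_left _ (h₁.1 e' he').1))
          (l₂ s (mem_union_left _ hs))
      · exact hu e' ⟨he', h1'⟩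
  · rcases mem_union.1 hs with hs | hs
    · obtain ⟨e, ⟨he, h1⟩, hu⟩ := h₁.2.2.1 s hs
      refine ⟨e, ⟨mem_union_left _ he, h1⟩, fun e' ⟨he', h1'⟩ => ?_⟩
      rcases mem_union.1 he' with he' | he'
      · exact hu e' ⟨he', h1'⟩
      · exact absurd (l₁ s (mem_union_right _ hs))
          (h1' ▸ l₂ _ (mem_union_right _ (h₂.1 e' he').2))
    · obtain ⟨e, ⟨he, h1⟩, hu⟩ := h₂.2.2.1 s hs
      refine ⟨e, ⟨mem_union_right _ he, h1⟩, fun e' ⟨he', h1'⟩ => ?_⟩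
      rcases mem_union.1 he' with he' | he'
      · exact absurd (h1' ▸ l₁ _ (mem_union_right _ (h₁.1 e' he').2))
          (l₂ s (mem_union_right _ hs))
      · exact hu e' ⟨he', h1'⟩
  · rcases mem_union.1 he with he | he <;> rcases mem_union.1 he' with he' | he'
    · exact h₁.2.2.2 e he e' he' hne
    · exact seg_inter_of_sides h₁ h₂ l₁ l₂ he he'
    · rw [Set.inter_comm]; exact seg_inter_of_sides h₁ h₂ l₁ l₂ he' he
    · exact h₂.2.2.2 e he e' he' hne

/-- Transformations on either side of a line can be carried out in parallel. -/
lemma TCompatible.union {a b c : ℝ} {S₁ H₁ S₂ H₂ : Finset Pt} {M₁ M₂ N₁ N₂ : Finset (Pt × Pt)}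
    {t : ℕ} (h₁ : TCompatible S₁ H₁ t M₁ N₁) (h₂ : TCompatible S₂ H₂ t M₂ N₂)
    (l₁ : ∀ p ∈ S₁ ∪ H₁, ln a b p < c) (l₂ : ∀ p ∈ S₂ ∪ H₂, ¬ ln a b p < c) :
    TCompatible (S₁ ∪ S₂) (H₁ ∪ H₂) t (M₁ ∪ M₂) (N₁ ∪ N₂) := by
  obtain ⟨f, f0, f1, f2, f3⟩ := h₁.exact
  obtain ⟨g, g0, g1, g2, g3⟩ := h₂.exact
  refine ⟨t, le_rfl, fun i => f i ∪ g i, by simp only [f0, g0], by simp only [f1, g1],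
    fun i _ => (f2 i).union (g2 i) l₁ l₂, fun i _ e he e' he' => ?_⟩
  rcases mem_union.1 he with he | he <;> rcases mem_union.1 he' with he' | he'
  · exact f3 i e he e' he'
  · right; rw [seg_inter_of_sides (f2 i) (g2 (i + 1)) l₁ l₂ he he']; exact Set.empty_subset _
  · right
    rw [Set.inter_comm, seg_inter_of_sides (f2 (i + 1)) (g2 i) l₁ l₂ he' he]
    exact Set.empty_subset _
  · exact g3 i e he e' he'

lemma IsBRMatching.eq_of_card_le_one (hM : IsBRMatching S H M) (hN : IsBRMatching S H N)
    (hH : H.card ≤ 1) : M = N := by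
  rw [card_le_one] at hH
  have key : ∀ {M N : Finset (Pt × Pt)}, IsBRMatching S H M → IsBRMatching S H N → M ⊆ N := by
    intro M N h h' e he
    obtain ⟨e', ⟨he', h1⟩, -⟩ := h'.2.1 e.1 (h.1 e he).1
    have : e' = e := Prod.ext h1 (hH _ (h'.1 e' he').2 _ (h.1 e he).2)
    rwa [← this]
  exact (key hM hN).antisymm (key hN hM)

/-- Some matching is within distance `m` of all others, for `m` points of each color. -/
lemma exists_hub (m : ℕ) : ∀ S H : Finset Pt, S ∩ H = ∅ → S.card = m → H.card = m →
    GenPos (S ∪ H) → ∃ N, ∀ M, IsBRMatching S H M → TCompatible S H m M N := by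
  induction m using Nat.strong_induction_on with
  | _ m ih =>
  intro S H hd hS hH hg
  rcases lt_or_ge m 2 with hm | hm
  · by_cases hex : ∃ N, IsBRMatching S H N
    · obtain ⟨N, hN⟩ := hex
      refine ⟨N, fun M hM => ?_⟩
      rw [hM.eq_of_card_le_one hN (by omega)]
      exact hN.tCompatible_self m
    · exact ⟨∅, fun M hM => absurd ⟨M, hM⟩ hex⟩
  obtain ⟨a, b, c, k, hk1, hk2, hlev, cS, cH⟩ := exists_balanced hd hg hS hH hm
  set P : Pt → Prop := fun p => ln a b p < c with hP
  have sub : ∀ Q : Pt → Prop, S.filter Q ∪ H.filter Q ⊆ S ∪ H := fun Q =>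
    union_subset_union (filter_subset _ _) (filter_subset _ _)
  have gsub : ∀ Q : Pt → Prop, GenPos (S.filter Q ∪ H.filter Q) := fun Q p hp q hq r hr =>
    hg p (sub Q hp) q (sub Q hq) r (sub Q hr)
  have dsub : ∀ Q : Pt → Prop, S.filter Q ∩ H.filter Q = ∅ := fun Q => by
    rw [← subset_empty, ← hd]
    exact inter_subset_inter (filter_subset _ _) (filter_subset _ _)
  obtain ⟨P', hP'⟩ : ∃ P' : Pt → Prop, ∀ p, P' p ↔ ¬ P p := ⟨_, fun _ => Iff.rfl⟩
  have un : ∀ T : Finset Pt, T.filter P ∪ T.filter P' = T := fun T => by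
    ext p; simp only [mem_union, mem_filter, hP']; tauto
  have dis : ∀ T : Finset Pt, Disjoint (T.filter P) (T.filter P') := fun T =>
    disjoint_filter.2 fun p _ h h' => (hP' p).1 h' h
  have cS' : (S.filter P).card = k := by rw [← cS]
  have cH' : (H.filter P).card = k := by rw [← cH]
  have cS'' : (S.filter P').card = m - k := by
    have := card_union_of_disjoint (dis S)
    rw [un, cS', hS] at this; omega
  have cH'' : (H.filter P').card = m - k := by
    have := card_union_of_disjoint (dis H)
    rw [un, cH', hH] at this; omega
  obtain ⟨N₁, hN₁⟩ := ih k (by omega) (S.filter P) (H.filter P) (dsub P) cS' cH' (gsub P)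
  obtain ⟨N₂, hN₂⟩ := ih (m - k) (by omega) (S.filter P') (H.filter P')
    (dsub P') cS'' cH'' (gsub P')
  refine ⟨N₁ ∪ N₂, fun M hM => ?_⟩
  obtain ⟨j, hj, hxj, -⟩ := hM.crossings hlev cS cH
  obtain ⟨N, n1, n2, n3⟩ := IsBRMatching.exists_uncrossed hd hg hlev cS cH k hM (by omega)
  have hside : ∀ e ∈ N, P e.1 ↔ P e.2 := by
    intro e he
    have hX : ¬ Xes a b c e := fun hX => by
      have : e ∈ N.filter (Xes a b c) := mem_filter.2 ⟨he, hX⟩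
      rw [card_eq_zero.1 n2] at this; simp at this
    have l1 := hlev _ (mem_union_left _ (n1.1 e he).1)
    have l2 := hlev _ (mem_union_right _ (n1.1 e he).2)
    simp only [hP]
    constructor
    · intro h1; by_contra h2
      exact hX (Or.inl ⟨h1, lt_of_le_of_ne (not_lt.1 h2) l2.symm⟩)
    · intro h1; by_contra h2
      exact hX (Or.inr ⟨h1, lt_of_le_of_ne (not_lt.1 h2) l1.symm⟩)
  have t1 := (hN₁ _ (n1.restrict P hside)).mono (by omega : k ≤ m - k)
  have t2 := hN₂ _ (n1.restrict P' fun e he => by rw [hP', hP', hside e he])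
  have hu := t1.union (a := a) (b := b) (c := c) t2
    (fun p hp => (mem_union.1 hp).elim (fun h => (mem_filter.1 h).2) fun h => (mem_filter.1 h).2)
    (fun p hp => (hP' p).1 ((mem_union.1 hp).elim (fun h => (mem_filter.1 h).2)
      fun h => (mem_filter.1 h).2))
  rw [un, un] at hu
  have hN : N.filter (fun e => P e.1) ∪ N.filter (fun e => P' e.1) = N := by
    ext p; simp only [mem_union, mem_filter, hP']; tauto
  rw [hN] at hu
  have := n3.trans hu
  rwa [show k + (m - k) = m by omega] at this

end

/-- Points on a parabola. -/
def pt (i : ℕ) : Pt := ((i : ℝ), (i : ℝ) ^ 2)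

lemma pt_inj {i j : ℕ} : pt i = pt j ↔ i = j := by
  constructor
  · intro h
    have h1 : (i : ℝ) = j := congrArg Prod.fst h
    exact_mod_cast h1
  · rintro rfl; rfl

lemma cr_pt (a b c : ℕ) :
    cr (pt a) (pt b) (pt c) = ((b : ℝ) - a) * (((c : ℝ) - a) * ((c : ℝ) - b)) := by
  simp only [cr, pt]; ring

lemma cr_of_collinear {p q r : Pt} (h : Collinear ℝ ({p, q, r} : Set Pt)) : cr p q r = 0 := by
  rw [collinear_iff_of_mem (Set.mem_insert p _)] at h
  obtain ⟨v, hv⟩ := h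
  obtain ⟨s, hs⟩ := hv q (by simp)
  obtain ⟨t, ht⟩ := hv r (by simp)
  rw [hs, ht]
  simp only [cr, vadd_eq_add, Prod.fst_add, Prod.snd_add, Prod.smul_fst, Prod.smul_snd, smul_eq_mul]
  ring

lemma genPos_pt (I : Finset ℕ) : GenPos (I.image pt) := by
  intro p hp q hq r hr hpq hpr hqr hcol
  obtain ⟨a, -, rfl⟩ := mem_image.1 hp
  obtain ⟨b, -, rfl⟩ := mem_image.1 hq
  obtain ⟨c, -, rfl⟩ := mem_image.1 hr
  have h := cr_of_collinear hcol
  rw [cr_pt] at h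
  have ne : ∀ {i j : ℕ}, pt i ≠ pt j → (j : ℝ) - i ≠ 0 := fun hij => by
    rw [sub_ne_zero]; exact fun hh => hij (pt_inj.2 (by exact_mod_cast hh.symm))
  exact mul_ne_zero (ne hpq) (mul_ne_zero (ne hpr) (ne hqr)) h

lemma seg_inter_of_cr_mul_pos {p q r s : Pt} (h : 0 < cr p q r * cr p q s) :
    segment ℝ p q ∩ segment ℝ r s = ∅ := by
  rw [Set.eq_empty_iff_forall_notMem]
  rintro z ⟨h1, h2⟩
  obtain ⟨t, t0, t1, rfl⟩ := mem_seg.1 h2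
  have h3 := cr_of_mem_seg h1
  rw [cr_ip] at h3
  have hr : cr p q r ≠ 0 := by rintro hh; rw [hh, zero_mul] at h; exact lt_irrefl _ h
  have h4 : 0 = (1 - t) * (cr p q r * cr p q r) + t * (cr p q r * cr p q s) := by
    linear_combination (- cr p q r) * h3
  have h5 : 0 < cr p q r * cr p q r := mul_self_pos.2 hr
  rcases t0.eq_or_lt with rfl | t0
  · linarith
  · nlinarith [mul_pos t0 h, mul_nonneg (sub_nonneg.2 t1) h5.le]

/-- A matching of points on the parabola given by a pairing of their indices. -/
lemma isBRMatching_pt {I J : Finset ℕ} {μ : ℕ → ℕ} (h1 : ∀ i ∈ I, μ i ∈ J)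
    (h2 : ∀ j ∈ J, μ j ∈ I) (h3 : ∀ i ∈ I ∪ J, μ (μ i) = i) (h4 : Disjoint I J)
    (h5 : ∀ i ∈ I, ∀ j ∈ I, i ≠ j → (0 : ℝ) <
      (((j : ℝ) - i) * ((j : ℝ) - μ i)) * (((μ j : ℝ) - i) * ((μ j : ℝ) - μ i))) :
    IsBRMatching (I.image pt) (J.image pt) (I.image fun i => (pt i, pt (μ i))) := by
  refine ⟨fun e he => ?_, fun b hb => ?_, fun r hr => ?_, fun e he e' he' hne => ?_⟩
  · obtain ⟨i, hi, rfl⟩ := mem_image.1 he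
    exact ⟨mem_image_of_mem _ hi, mem_image_of_mem _ (h1 i hi)⟩
  · obtain ⟨i, hi, rfl⟩ := mem_image.1 hb
    refine ⟨(pt i, pt (μ i)), ⟨mem_image.2 ⟨i, hi, rfl⟩, rfl⟩, ?_⟩
    rintro e ⟨he, hei⟩
    obtain ⟨j, hj, rfl⟩ := mem_image.1 he
    rw [pt_inj.1 hei]
  · obtain ⟨j, hj, rfl⟩ := mem_image.1 hr
    have hj' := h3 j (mem_union_right _ hj)
    refine ⟨(pt (μ j), pt j), ⟨mem_image.2 ⟨μ j, h2 j hj, by rw [hj']⟩, rfl⟩, ?_⟩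
    rintro e ⟨he, hei⟩
    obtain ⟨i, hi, rfl⟩ := mem_image.1 he
    rw [← pt_inj.1 hei, h3 i (mem_union_left _ hi)]
  · obtain ⟨i, hi, rfl⟩ := mem_image.1 he
    obtain ⟨j, hj, rfl⟩ := mem_image.1 he'
    have hij : i ≠ j := fun hh => hne (by rw [hh])
    apply seg_inter_of_cr_mul_pos
    simp only [cr_pt]
    have hμ : ((μ i : ℝ) - i) ≠ 0 := by
      rw [sub_ne_zero]
      intro hh
      have : μ i = i := by exact_mod_cast hh
      exact disjoint_left.1 h4 hi (this ▸ h1 i hi)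
    have := mul_pos (mul_self_pos.2 hμ) (h5 i hi j hj hij)
    linarith

/-- Interleaving chords of the parabola cross. -/
lemma pt_cross {i l j m : ℕ} (h1 : i < l) (h2 : l < j) (h3 : j < m) :
    ∃ z, z ∈ segment ℝ (pt i) (pt j) ∧ z ∈ segment ℝ (pt l) (pt m) ∧ z ≠ pt l ∧ z ≠ pt m := by
  have g1 : (i : ℝ) < l := by exact_mod_cast h1
  have g2 : (l : ℝ) < j := by exact_mod_cast h2
  have g3 : (j : ℝ) < m := by exact_mod_cast h3
  set D : ℝ := l + m - i - j with hD
  have hD0 : 0 < D := by rw [hD]; linarith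
  set x : ℝ := (l * m - i * j) / D with hx
  have hxD : x * (l + m - i - j) = l * m - i * j := by
    rw [hx, ← hD]; exact div_mul_cancel₀ _ hD0.ne'
  have hlx : (l : ℝ) < x := by
    rw [hx, lt_div_iff₀ hD0, hD]; nlinarith [mul_pos (sub_pos.2 g2) (sub_pos.2 g1)]
  have hxj : x < (j : ℝ) := by
    rw [hx, div_lt_iff₀ hD0, hD]; nlinarith [mul_pos (sub_pos.2 g2) (sub_pos.2 g3)]
  have mem : ∀ {p q : ℕ}, (p : ℝ) < x → x < q →
      ((x, (p + q) * x - p * q) : Pt) ∈ segment ℝ (pt p) (pt q) := by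
    intro p q hp hq
    have hpq : (0 : ℝ) < q - p := by linarith
    refine mem_seg.2 ⟨(x - p) / (q - p), div_nonneg (by linarith) hpq.le,
      (div_le_one hpq).2 (by linarith), ?_⟩
    ext
    · simp only [ip, pt]; field_simp; ring
    · simp only [ip, pt]; field_simp; ring
  refine ⟨_, mem (g1.trans hlx) hxj, ?_, ?_, ?_⟩
  · have := mem hlx (hxj.trans g3)
    convert this using 2
    linear_combination -hxD
  · intro hh
    have := congrArg Prod.fst hh
    simp only [pt] at this; linarith
  · intro hh
    have := congrArg Prod.fst hh
    simp only [pt] at this; linarith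

def blueIx (k : ℕ) : Finset ℕ := range k ∪ Ico (2 * k) (3 * k)

def redIx (k : ℕ) : Finset ℕ := Ico k (2 * k) ∪ Ico (3 * k) (4 * k)

lemma mem_blueIx {k i : ℕ} : i ∈ blueIx k ↔ i < k ∨ 2 * k ≤ i ∧ i < 3 * k := by
  simp [blueIx]

lemma mem_redIx {k i : ℕ} : i ∈ redIx k ↔ k ≤ i ∧ i < 2 * k ∨ 3 * k ≤ i ∧ i < 4 * k := by
  simp [redIx]

lemma disjoint_ix (k : ℕ) : Disjoint (blueIx k) (redIx k) := by
  rw [disjoint_left]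
  intro i; rw [mem_blueIx, mem_redIx]; omega

lemma card_blueIx (k : ℕ) : (blueIx k).card = 2 * k := by
  rw [blueIx, card_union_of_disjoint, card_range, Nat.card_Ico]
  · omega
  · rw [disjoint_left]; intro i; rw [mem_range, mem_Ico]; omega

lemma card_redIx (k : ℕ) : (redIx k).card = 2 * k := by
  rw [redIx, card_union_of_disjoint, Nat.card_Ico, Nat.card_Ico]
  · omega
  · rw [disjoint_left]; intro i; rw [mem_Ico, mem_Ico]; omega

/-- The pairing nesting all edges. -/
def mu (k i : ℕ) : ℕ := 4 * k - 1 - i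

/-- The pairing forming two nested families. -/
def mu' (k i : ℕ) : ℕ := if i < 2 * k then 2 * k - 1 - i else 6 * k - 1 - i

lemma nested_pos {N a b c d : ℝ} (hb : b = N - a) (hd : d = N - c) (h1 : c ≠ a) (h2 : c ≠ b) :
    0 < ((c - a) * (c - b)) * ((d - a) * (d - b)) := by
  have e : ((c - a) * (c - b)) * ((d - a) * (d - b)) = ((c - a) * (c - b)) ^ 2 := by
    rw [hd, hb]; ring
  rw [e]
  exact pow_two_pos_of_ne_zero (mul_ne_zero (sub_ne_zero.2 h1) (sub_ne_zero.2 h2))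

lemma isBRMatching_mu (k : ℕ) : IsBRMatching ((blueIx k).image pt) ((redIx k).image pt)
    ((blueIx k).image fun i => (pt i, pt (mu k i))) := by
  refine isBRMatching_pt ?_ ?_ ?_ (disjoint_ix k) ?_
  · intro i; rw [mem_blueIx, mem_redIx, mu]; omega
  · intro i; rw [mem_blueIx, mem_redIx, mu]; omega
  · intro i; rw [mem_union, mem_blueIx, mem_redIx, mu, mu]; omega
  · intro i hi j hj hij
    rw [mem_blueIx] at hi hj
    have hi' : mu k i + i = 4 * k - 1 := by rw [mu]; omega
    have hj' : mu k j + j = 4 * k - 1 := by rw [mu]; omega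
    have hji : j ≠ mu k i := by rw [mu]; omega
    refine nested_pos (N := ((4 * k - 1 : ℕ) : ℝ)) ?_ ?_ ?_ ?_
    · rw [← hi']; push_cast; ring
    · rw [← hj']; push_cast; ring
    · exact_mod_cast hij.symm
    · exact_mod_cast hji

lemma isBRMatching_mu' (k : ℕ) : IsBRMatching ((blueIx k).image pt) ((redIx k).image pt)
    ((blueIx k).image fun i => (pt i, pt (mu' k i))) := by
  refine isBRMatching_pt ?_ ?_ ?_ (disjoint_ix k) ?_
  · intro i; rw [mem_blueIx, mem_redIx, mu']; split_ifs <;> omega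
  · intro i; rw [mem_blueIx, mem_redIx, mu']; split_ifs <;> omega
  · intro i; rw [mem_union, mem_blueIx, mem_redIx, mu', mu']; split_ifs <;> omega
  · intro i hi j hj hij
    rw [mem_blueIx] at hi hj
    have hji : j ≠ mu' k i := by rw [mu']; split_ifs <;> omega
    have same : ∀ N : ℕ, mu' k i + i = N → mu' k j + j = N → (0 : ℝ) <
        (((j : ℝ) - i) * ((j : ℝ) - mu' k i)) * (((mu' k j : ℝ) - i) * ((mu' k j : ℝ) - mu' k i)) := by
      intro N hi' hj'
      refine nested_pos (N := (N : ℝ)) ?_ ?_ ?_ ?_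
      · rw [← hi']; push_cast; ring
      · rw [← hj']; push_cast; ring
      · exact_mod_cast hij.symm
      · exact_mod_cast hji
    rcases hi with hi | hi <;> rcases hj with hj | hj
    · refine same (2 * k - 1) ?_ ?_ <;> rw [mu', if_pos (by omega)] <;> omega
    · have g1 : i < j := by omega
      have g2 : mu' k i < j := by rw [mu', if_pos (by omega)]; omega
      have g3 : i < mu' k j := by rw [mu', if_neg (by omega)]; omega
      have g4 : mu' k i < mu' k j := by
        rw [mu', if_pos (by omega), mu', if_neg (by omega)]; omega
      exact mul_pos (mul_pos (sub_pos.2 (by exact_mod_cast g1)) (sub_pos.2 (by exact_mod_cast g2)))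
        (mul_pos (sub_pos.2 (by exact_mod_cast g3)) (sub_pos.2 (by exact_mod_cast g4)))
    · have g1 : j < i := by omega
      have g2 : j < mu' k i := by rw [mu', if_neg (by omega)]; omega
      have g3 : mu' k j < i := by rw [mu', if_pos (by omega)]; omega
      have g4 : mu' k j < mu' k i := by
        rw [mu', if_pos (by omega), mu', if_neg (by omega)]; omega
      exact mul_pos (mul_pos_of_neg_of_neg (sub_neg.2 (by exact_mod_cast g1))
        (sub_neg.2 (by exact_mod_cast g2)))
        (mul_pos_of_neg_of_neg (sub_neg.2 (by exact_mod_cast g3))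
        (sub_neg.2 (by exact_mod_cast g4)))
    · refine same (6 * k - 1) ?_ ?_ <;> rw [mu', if_neg (by omega)] <;> omega

/-- The `i`-th point is matched to one of the first red points. -/
def IsNear (k : ℕ) (M : Finset (Pt × Pt)) (i : ℕ) : Prop :=
  ∃ j ∈ Ico k (2 * k), (pt i, pt j) ∈ M

/-- The first blue points that are matched to the first red points. -/
noncomputable def near (k : ℕ) (M : Finset (Pt × Pt)) : Finset ℕ := (range k).filter (IsNear k M)

lemma near_step {k : ℕ} {M N : Finset (Pt × Pt)}
    (hM : IsBRMatching ((blueIx k).image pt) ((redIx k).image pt) M) (hc : Compatible M N) :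
    (near k N).card ≤ (near k M).card + 1 := by
  have key : ∀ a ∈ near k N \ near k M, ∀ a' ∈ near k N \ near k M, ¬ a' < a := by
    intro a ha a' ha' hlt
    obtain ⟨ha1, ha2⟩ := mem_sdiff.1 ha
    obtain ⟨ha1', ha2'⟩ := mem_sdiff.1 ha'
    have hak := mem_range.1 (mem_filter.1 ha1).1
    obtain ⟨hak', j, hj, hjN⟩ := mem_filter.1 ha1'
    obtain ⟨e, ⟨he, hea⟩, -⟩ := hM.2.1 (pt a)
      (mem_image_of_mem _ (mem_blueIx.2 (Or.inl hak)))
    obtain ⟨d, hd, hed⟩ := mem_image.1 (hM.1 e he).2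
    have hee : e = (pt a, pt d) := Prod.ext hea hed.symm
    rw [hee] at he
    have hd3 : 3 * k ≤ d := by
      rcases mem_redIx.1 hd with h | h
      · exact absurd (mem_filter.2 ⟨mem_range.2 hak, d, mem_Ico.2 h, he⟩) ha2
      · exact h.1
    rw [mem_Ico] at hj
    obtain ⟨z, z1, z2, z3, z4⟩ := pt_cross hlt (by omega : a < j) (by omega : j < d)
    rcases hc _ he _ hjN with h | h
    · exact hlt.ne (pt_inj.1 (congrArg Prod.fst h)).symm
    · rcases (h ⟨z2, z1⟩).1 with h1 | h1
      · exact z3 h1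
      · exact z4 h1
  have h1 : (near k N \ near k M).card ≤ 1 := card_le_one.2 fun a ha a' ha' =>
    le_antisymm (not_lt.1 (key a ha a' ha')) (not_lt.1 (key a' ha' a ha))
  have h2 := card_le_card_sdiff_add_card (s := near k N) (t := near k M)
  omega

lemma near_mu (k : ℕ) : near k ((blueIx k).image fun i => (pt i, pt (mu k i))) = ∅ := by
  refine Finset.filter_false_of_mem ?_
  rintro i hi ⟨j, hj, hm⟩
  obtain ⟨i', -, h⟩ := mem_image.1 hm
  have h1 := pt_inj.1 (congrArg Prod.fst h)
  have h2 := pt_inj.1 (congrArg Prod.snd h)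
  rw [mem_range] at hi
  rw [mem_Ico] at hj
  rw [mu] at h2; omega

lemma near_mu' (k : ℕ) : near k ((blueIx k).image fun i => (pt i, pt (mu' k i))) = range k := by
  refine Finset.filter_true_of_mem fun i hi => ?_
  rw [mem_range] at hi
  refine ⟨mu' k i, ?_, mem_image.2 ⟨i, mem_blueIx.2 (Or.inl hi), rfl⟩⟩
  rw [mem_Ico, mu', if_pos (by omega)]; omega

lemma exists_far (k : ℕ) :
    ∃ B R : Finset Pt, B ∩ R = ∅ ∧ B.card = 2 * k ∧ R.card = 2 * k ∧ GenPos (B ∪ R) ∧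
      ∃ M M' : Finset (Pt × Pt), IsBRMatching B R M ∧ IsBRMatching B R M' ∧
        ∀ t < k, ¬ TCompatible B R t M M' := by
  have hinj : Function.Injective pt := fun _ _ => pt_inj.1
  refine ⟨(blueIx k).image pt, (redIx k).image pt, ?_, ?_, ?_, ?_, _, _, isBRMatching_mu k,
    isBRMatching_mu' k, ?_⟩
  · rw [← Finset.image_inter _ _ hinj, disjoint_iff_inter_eq_empty.1 (disjoint_ix k), image_empty]
  · rw [card_image_of_injective _ hinj, card_blueIx]
  · rw [card_image_of_injective _ hinj, card_redIx]
  · rw [← image_union]; exact genPos_pt _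
  · intro t ht h
    obtain ⟨f, f0, f1, f2, f3⟩ := h.exact
    have hle : ∀ i, (near k (f i)).card ≤ i := by
      intro i
      induction i with
      | zero => rw [f0, near_mu, card_empty]
      | succ i ih => exact (near_step (f2 i) (f3 i)).trans (by omega)
    have := hle t
    rw [f1, near_mu', card_range] at this
    omega

/-- For every even `n ≥ 2` there is a bichromatic set of `2n` points
in general position with two BR-matchings that are not `t`-compatible for any
`t < n / 2`; consequently (together with the `2n` upper bound valid for every point
set), the maximum diameter of the transformation graph of BR-matchings is `Θ(n)`. -/
theorem transformation_graph_diameter_linear (n : ℕ) (hn : 2 ≤ n) (hne : Even n) :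
    (∃ B R : Finset Pt, B ∩ R = ∅ ∧ B.card = n ∧ R.card = n ∧ GenPos (B ∪ R) ∧
      ∃ M M' : Finset (Pt × Pt), IsBRMatching B R M ∧ IsBRMatching B R M' ∧
        ∀ t : ℕ, t < n / 2 → ¬ TCompatible B R t M M') ∧
    (∀ B R : Finset Pt, B ∩ R = ∅ → B.card = n → R.card = n → GenPos (B ∪ R) →
      ∀ M M' : Finset (Pt × Pt), IsBRMatching B R M → IsBRMatching B R M' →
        TCompatible B R (2 * n) M M') := by
  refine ⟨?_, fun B R hd hB hR hg M M' hM hM' => ?_⟩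
  · obtain ⟨k, rfl⟩ := hne
    rw [← two_mul, Nat.mul_div_cancel_left k two_pos]
    exact exists_far k
  · obtain ⟨N, hN⟩ := exists_hub n B R hd hB hR hg
    rw [two_mul]
    exact (hN M hM).trans (hN M' hM').symm
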